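/- arXiv:1506.03940 — 4 statements merged into one kernel-verified Lean document; each statement's English description precedes it below -/
import Mathlib

section
/- Let p, q, k be non-negative integers with p + q ≥ 2 and k < p + q. Then any Lie group homomorphism ρ : SU(p,q) → GL(k, ℂ) is trivial. -/
open scoped Matrix

noncomputable section

/-- The matrix `J = diag[-E_q, E_p]` defining the indefinite Hermitian form of
signature `(p,q)` (the first `q` diagonal entries are `-1`, the last `p` are `1`). -/
def Jmat (p q : ℕ) : Matrix (Fin (p+q)) (Fin (p+q)) ℂ :=
  Matrix.diagonal fun i => if (i : ℕ) < q then (-1 : ℂ) else 1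

def SUIndef (p q : ℕ) : Subgroup (GL (Fin (p+q)) ℂ) where
  carrier := {A | (A : Matrix (Fin (p+q)) (Fin (p+q)) ℂ)ᴴ * Jmat p q * (A : Matrix (Fin (p+q)) (Fin (p+q)) ℂ) = Jmat p q ∧
    (A : Matrix (Fin (p+q)) (Fin (p+q)) ℂ).det = 1}
  one_mem' := by
    constructor
    · simp
    · simp
  mul_mem' := by
    rintro a b ⟨ha1, ha2⟩ ⟨hb1, hb2⟩
    constructor
    · rw [Units.val_mul, Matrix.conjTranspose_mul]
      calc (b : Matrix (Fin (p+q)) (Fin (p+q)) ℂ)ᴴ * (a : Matrix (Fin (p+q)) (Fin (p+q)) ℂ)ᴴ * Jmat p q *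
            ((a : Matrix (Fin (p+q)) (Fin (p+q)) ℂ) * (b : Matrix (Fin (p+q)) (Fin (p+q)) ℂ))
          = (b : Matrix (Fin (p+q)) (Fin (p+q)) ℂ)ᴴ *
            ((a : Matrix (Fin (p+q)) (Fin (p+q)) ℂ)ᴴ * Jmat p q * (a : Matrix (Fin (p+q)) (Fin (p+q)) ℂ)) *
            (b : Matrix (Fin (p+q)) (Fin (p+q)) ℂ) := by noncomm_ring
        _ = (b : Matrix (Fin (p+q)) (Fin (p+q)) ℂ)ᴴ * Jmat p q * (b : Matrix (Fin (p+q)) (Fin (p+q)) ℂ) := by rw [ha1]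
        _ = Jmat p q := hb1
    · rw [Units.val_mul, Matrix.det_mul, ha2, hb2, one_mul]
  inv_mem' := by
    rintro a ⟨ha1, ha2⟩
    have hmi : ((a : GL (Fin (p+q)) ℂ) : Matrix (Fin (p+q)) (Fin (p+q)) ℂ) *
        ((a⁻¹ : GL (Fin (p+q)) ℂ) : Matrix (Fin (p+q)) (Fin (p+q)) ℂ) = 1 := a.mul_inv
    have him : ((a⁻¹ : GL (Fin (p+q)) ℂ) : Matrix (Fin (p+q)) (Fin (p+q)) ℂ) *
        ((a : GL (Fin (p+q)) ℂ) : Matrix (Fin (p+q)) (Fin (p+q)) ℂ) = 1 := a.inv_mul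
    constructor
    · calc ((a⁻¹ : GL (Fin (p+q)) ℂ) : Matrix (Fin (p+q)) (Fin (p+q)) ℂ)ᴴ * Jmat p q *
            ((a⁻¹ : GL (Fin (p+q)) ℂ) : Matrix (Fin (p+q)) (Fin (p+q)) ℂ)
          = ((a⁻¹ : GL (Fin (p+q)) ℂ) : Matrix (Fin (p+q)) (Fin (p+q)) ℂ)ᴴ *
            ((a : Matrix (Fin (p+q)) (Fin (p+q)) ℂ)ᴴ * Jmat p q * (a : Matrix (Fin (p+q)) (Fin (p+q)) ℂ)) *
            ((a⁻¹ : GL (Fin (p+q)) ℂ) : Matrix (Fin (p+q)) (Fin (p+q)) ℂ) := by rw [ha1]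
        _ = (((a : GL (Fin (p+q)) ℂ) : Matrix (Fin (p+q)) (Fin (p+q)) ℂ) *
              ((a⁻¹ : GL (Fin (p+q)) ℂ) : Matrix (Fin (p+q)) (Fin (p+q)) ℂ))ᴴ * Jmat p q *
            (((a : GL (Fin (p+q)) ℂ) : Matrix (Fin (p+q)) (Fin (p+q)) ℂ) *
              ((a⁻¹ : GL (Fin (p+q)) ℂ) : Matrix (Fin (p+q)) (Fin (p+q)) ℂ)) := by
            rw [Matrix.conjTranspose_mul]; noncomm_ring
        _ = Jmat p q := by rw [hmi]; simp
    · have := congrArg Matrix.det him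
      rw [Matrix.det_mul, ha2, mul_one, Matrix.det_one] at this
      exact this


open Complex ComplexConjugate in
theorem blk_step3 (σ : ℝ) (hσ : σ = 1 ∨ σ = -1) (P : ℂ → ℂ → Prop)
    (hmul : ∀ a b c d, P a b → P c d → P (a * c + σ * b * conj d) (a * d + b * conj c))
    (hinv : ∀ a b, P a b → P (conj a) (-b))
    (w : ℂ) (hw1 : w ≠ 1) (hwn : normSq w = 1)
    (hw : ∀ a b, normSq a - σ * normSq b = 1 →
      P (normSq a - σ * w * normSq b) (a * b * (w - 1))) :
    ∀ a e x s, normSq a - σ * normSq e = 1 → a = 1 + σ * x → 0 < x.re →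
      s = normSq x / (2 * x.re) → (σ = 1 ∨ s < normSq (w - 1) / 4) → P a e := by
  have hw1' : w - 1 ≠ 0 := sub_ne_zero.mpr hw1
  have hδ : 0 < normSq (w - 1) := normSq_pos.mpr hw1'
  have hσσ : σ * σ = 1 := by rcases hσ with h | h <;> rw [h] <;> norm_num
  have hδ2 : normSq (w - 1) = 2 - 2 * w.re := by
    rw [normSq_sub, hwn]; simp; ring
  have hδ4 : normSq (w - 1) ≤ 4 := by
    have : -1 ≤ w.re := by
      rw [normSq_apply] at hwn; nlinarith [mul_self_nonneg w.im]
    linarith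
  set δ := normSq (w - 1) with hδd
  -- step 1
  have h1 : ∀ r : ℝ, 0 ≤ r → 0 < 1 + σ * r → ∀ b', normSq b' = δ * r * (1 + σ * r) →
      P (1 + σ * r * (1 - w)) b' := by
    intro r hr hr1 b' hb'
    have hq : ((Real.sqrt (1 + σ * r) : ℝ) : ℂ) ≠ 0 := by
      exact_mod_cast (Real.sqrt_pos.mpr hr1).ne'
    have hn : normSq ((Real.sqrt (1 + σ * r) : ℝ) : ℂ) = 1 + σ * r := by
      rw [normSq_ofReal, Real.mul_self_sqrt hr1.le]
    have hb : normSq (b' / ((Real.sqrt (1 + σ * r) : ℝ) * (w - 1))) = r := by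
      rw [normSq_div, normSq_mul, hn, hb', ← hδd]
      have := hr1.ne'
      rw [div_eq_iff (by positivity)]; ring
    have := hw (Real.sqrt (1 + σ * r) : ℝ) (b' / ((Real.sqrt (1 + σ * r) : ℝ) * (w - 1)))
      (by rw [hn, hb]; ring)
    rw [hn, hb] at this
    convert this using 1
    · push_cast; ring
    · field_simp
  -- step 2
  have h2 : ∀ s : ℝ, 0 ≤ s → (σ = 1 ∨ s < δ / 4) → ∃ a0 : ℂ, normSq a0 = 1 + σ * s ∧
      ∀ b', normSq b' = s → P a0 b' := by
    intro s hs hok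
    obtain ⟨r, hr, hr1, hrs⟩ : ∃ r : ℝ, 0 ≤ r ∧ 0 < 1 + σ * r ∧ δ * r * (1 + σ * r) = s := by
      have hsd : 0 ≤ s / δ := by positivity
      rcases hσ with h | h
      · refine ⟨(Real.sqrt (1 + 4 * (s / δ)) - 1) / 2, ?_, ?_, ?_⟩
        · have : 1 ≤ Real.sqrt (1 + 4 * (s / δ)) := by
            rw [Real.one_le_sqrt]; linarith
          linarith
        · rw [h]; have := Real.sqrt_nonneg (1 + 4 * (s / δ)); linarith
        · rw [h]
          have hh := Real.mul_self_sqrt (show 0 ≤ 1 + 4 * (s / δ) by linarith)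
          have : s = δ * (s / δ) := by field_simp
          linear_combination δ / 4 * hh - this
      · have hs4 : s < δ / 4 := by
          rcases hok with h' | h'
          · rw [h] at h'; norm_num at h'
          · exact h'
        have hlt : s / δ < 1 / 4 := by rw [div_lt_iff₀ hδ]; linarith
        refine ⟨(1 - Real.sqrt (1 - 4 * (s / δ))) / 2, ?_, ?_, ?_⟩
        · have : Real.sqrt (1 - 4 * (s / δ)) ≤ 1 := by
            rw [Real.sqrt_le_iff]; constructor <;> linarith
          linarith
        · rw [h]; have := Real.sqrt_nonneg (1 - 4 * (s / δ)); linarith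
        · rw [h]
          have hh := Real.mul_self_sqrt (show 0 ≤ 1 - 4 * (s / δ) by linarith)
          have : s = δ * (s / δ) := by field_simp
          linear_combination -δ / 4 * hh - this
    refine ⟨1 + σ * r * (1 - w), ?_, fun b' hb' => h1 r hr hr1 b' (by rw [hb', hrs])⟩
    rw [← hrs, hδ2]
    rw [normSq_apply] at hwn ⊢
    simp
    linear_combination r ^ 2 * σ ^ 2 * hwn
  intro a e x s hv ha hx hs hok
  have hs0 : 0 < s := by
    rw [hs]
    have : 0 < normSq x := normSq_pos.mpr (by rintro rfl; simp at hx)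
    positivity
  have hs1 : 0 < 1 + σ * s := by
    rcases hσ with h | h
    · rw [h]; linarith
    · rcases hok with h' | h'
      · rw [h] at h'; norm_num at h'
      · rw [h]; linarith
  obtain ⟨a0, ha0, hP⟩ := h2 s hs0.le hok
  have ha00 : a0 ≠ 0 := by rintro rfl; simp at ha0; linarith
  have hx0 : x ≠ 0 := by rintro rfl; simp at hx
  have hxs : normSq x = 2 * x.re * s := by rw [hs]; field_simp
  have he : normSq e = normSq x / s * (1 + σ * s) := by
    have h3 : normSq a = 1 + 2 * σ * x.re + normSq x := by
      rw [ha, normSq_apply, normSq_apply]; simp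
      linear_combination (x.re ^ 2 + x.im ^ 2) * hσσ
    have h4 : normSq e = 2 * x.re + σ * normSq x := by
      linear_combination (-σ) * hv + (1 - normSq e + 2 * x.re) * hσσ + σ * h3 - hσσ
    rw [h4, hxs]; field_simp
  have hsC : (s : ℂ) ≠ 0 := by exact_mod_cast hs0.ne'
  set d : ℂ := -e * s / (a0 * x) with hd
  have hdn : normSq d = s := by
    rw [hd, normSq_div, normSq_mul, normSq_mul, normSq_neg, normSq_ofReal, ha0, he]
    have := normSq_pos.mpr hx0
    rw [div_eq_iff (by positivity)]; field_simp
  have hz : normSq (1 - x / s) = 1 := by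
    have : (1 - x / s : ℂ) = ((s - x : ℂ)) / s := by field_simp
    rw [this, normSq_div, normSq_ofReal, div_eq_one_iff_eq (by positivity), normSq_apply]
    rw [normSq_apply] at hxs
    simp
    linear_combination hxs
  have hb : P a0 (d * (1 - x / s)) := hP _ (by rw [normSq_mul, hdn, hz, mul_one])
  have hdd := hinv _ _ (hP d hdn)
  have hfin := hmul _ _ _ _ hb hdd
  convert hfin using 1
  · have e1 := mul_conj a0
    have e2 := mul_conj d
    rw [ha0] at e1
    rw [hdn] at e2
    rw [ha, map_neg]
    push_cast at e1
    have : (s:ℂ) * (1 - x / s) = s - x := by field_simp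
    linear_combination (-1:ℂ) * e1 + σ * (1 - x / s) * e2 + σ * this
  · rw [hd]; simp; field_simp; ring

open Complex ComplexConjugate in
theorem blk_all (σ : ℝ) (hσ : σ = 1 ∨ σ = -1) (P : ℂ → ℂ → Prop)
    (hone : P 1 0)
    (hmul : ∀ a b c d, P a b → P c d → P (a * c + σ * b * conj d) (a * d + b * conj c))
    (hinv : ∀ a b, P a b → P (conj a) (-b))
    (hI : P I 0 → ∀ a b, normSq a - σ * normSq b = 1 →
      P (normSq a - σ * (-1 : ℂ) * normSq b) (a * b * ((-1 : ℂ) - 1)))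
    (w : ℂ) (hw1 : w ≠ 1) (hwn : normSq w = 1)
    (hw : ∀ a b, normSq a - σ * normSq b = 1 →
      P (normSq a - σ * w * normSq b) (a * b * (w - 1))) :
    ∀ a b, normSq a - σ * normSq b = 1 → P a b := by
  have h3 := blk_step3 σ hσ P hmul hinv w hw1 hwn hw
  have hσσ : σ * σ = 1 := by rcases hσ with h | h <;> rw [h] <;> norm_num
  have hσC : (σ : ℂ) * σ = 1 := by exact_mod_cast hσσ
  have hw1' : w - 1 ≠ 0 := sub_ne_zero.mpr hw1
  have hδ : 0 < normSq (w - 1) := normSq_pos.mpr hw1'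
  have hδ2 : normSq (w - 1) = 2 - 2 * w.re := by
    rw [normSq_sub, hwn]; simp; ring
  have hδ4 : normSq (w - 1) ≤ 4 := by
    have : -1 ≤ w.re := by
      rw [normSq_apply] at hwn; nlinarith [mul_self_nonneg w.im]
    linarith
  have hu : ∀ u : ℂ, normSq u = 1 → P u 0 := by
    set δ := normSq (w - 1) with hδd
    set a : ℂ := ((1 + σ * (δ / 4) : ℝ) : ℂ) with ha
    obtain ⟨e, he⟩ : ∃ e : ℂ, normSq a - σ * normSq e = 1 := by
      refine ⟨((Real.sqrt (σ * ((1 + σ * (δ / 4)) ^ 2 - 1)) : ℝ) : ℂ), ?_⟩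
      rw [ha, normSq_ofReal, normSq_ofReal, Real.mul_self_sqrt]
      · linear_combination (1 - (1 + σ * (δ / 4)) ^ 2) * hσσ
      · rcases hσ with h | h <;> rw [h] <;> nlinarith
    let X : ℂ → ℂ := fun u => σ * (u * a - 1)
    have hXc : Continuous X := by fun_prop
    have hX1 : X 1 = (δ / 4 : ℝ) := by
      simp only [X, ha]; push_cast
      linear_combination (δ / 4 : ℂ) * hσC
    have hnear : ∀ u, normSq u = 1 → 0 < (X u).re → normSq (X u) / (2 * (X u).re) < δ / 4 →
        P (u * a) (u * e) := by
      intro u hun hx hlt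
      refine h3 (u * a) (u * e) (X u) _ ?_ ?_ hx rfl (Or.inr hlt)
      · rw [normSq_mul, normSq_mul, hun]; simpa using he
      · simp only [X]; linear_combination (1 - u * a) * hσC
    have hev : ∀ᶠ u in nhds (1 : ℂ), 0 < (X u).re ∧ normSq (X u) / (2 * (X u).re) < δ / 4 := by
      have c1 : ContinuousAt (fun u => (X u).re) 1 := (continuous_re.comp hXc).continuousAt
      have v1 : (X 1).re = δ / 4 := by rw [hX1, ofReal_re]
      have c2 : ContinuousAt (fun u => normSq (X u) / (2 * (X u).re)) 1 := by
        refine ContinuousAt.div (continuous_normSq.comp hXc).continuousAt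
          (continuousAt_const.mul c1) ?_
        show 2 * (X 1).re ≠ 0
        rw [v1]; positivity
      refine (Filter.Tendsto.eventually_const_lt ?_ c1).and (Filter.Tendsto.eventually_lt_const ?_ c2)
      · show 0 < (X 1).re
        rw [v1]; positivity
      · show normSq (X 1) / (2 * (X 1).re) < δ / 4
        rw [v1, hX1, normSq_ofReal, div_lt_iff₀ (by positivity)]
        nlinarith
    have hev2 : ∀ᶠ u in nhds (1 : ℂ), normSq u = 1 → P u 0 := by
      have h1a := hnear 1 (by simp) hev.self_of_nhds.1 hev.self_of_nhds.2
      rw [one_mul, one_mul] at h1a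
      filter_upwards [hev] with u hu hun
      have := hmul _ _ _ _ (hnear u hun hu.1 hu.2) (hinv _ _ h1a)
      convert this using 1
      · have e1 := mul_conj a
        have e2 := mul_conj e
        have e3 : (normSq a : ℂ) - σ * normSq e = 1 := by exact_mod_cast he
        rw [map_neg]
        linear_combination (-u) * e3 - u * e1 + σ * u * e2
      · simp; ring
    have hpow : ∀ u, P u 0 → ∀ n : ℕ, P (u ^ n) 0 := by
      intro u hu n
      induction n with
      | zero => simpa using hone
      | succ n ih =>
        have := hmul _ _ _ _ ih hu
        simpa [pow_succ] using this
    intro u hun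
    have hnorm : ‖u‖ = 1 := by
      rw [normSq_eq_norm_sq] at hun
      nlinarith [norm_nonneg u]
    obtain ⟨θ, hθ⟩ := (norm_eq_one_iff u).mp hnorm
    have ht : Filter.Tendsto (fun n : ℕ => exp ((θ / (n : ℝ) : ℝ) * I)) Filter.atTop (nhds 1) := by
      have h0 : Filter.Tendsto (fun n : ℕ => (θ / (n : ℝ) : ℝ)) Filter.atTop (nhds 0) :=
        tendsto_const_div_atTop_nhds_zero_nat θ
      have hc : Continuous (fun t : ℝ => exp ((t : ℂ) * I)) := by fun_prop
      have := (hc.tendsto 0).comp h0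
      simpa [Function.comp_def] using this
    obtain ⟨n, hn, hn0⟩ := ((ht.eventually hev2).and (Filter.eventually_gt_atTop 0)).exists
    have := hpow _ (hn (by rw [normSq_eq_norm_sq, norm_exp_ofReal_mul_I]; norm_num)) n
    rw [← exp_nat_mul] at this
    rw [← hθ]
    convert this using 2
    have : (n : ℂ) ≠ 0 := by exact_mod_cast hn0.ne'
    push_cast
    field_simp
  have h3' := blk_step3 σ hσ P hmul hinv (-1) (by norm_num) (by simp)
    (fun a b h => hI (hu I (by simp)) a b h)
  intro a b hab
  by_cases hb : b = 0
  · subst hb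
    exact hu a (by simpa using hab)
  have hbp : 0 < normSq b := normSq_pos.mpr hb
  rcases hσ with h | h
  · subst h
    have ha1 : 1 < normSq a := by linarith
    have ha0 : a ≠ 0 := by rintro rfl; simp at ha1; linarith
    have hna : 1 < ‖a‖ := by
      rw [normSq_eq_norm_sq] at ha1; nlinarith [norm_nonneg a]
    have hna0 : (‖a‖ : ℂ) ≠ 0 := by simpa using ha0
    have hun : normSq (a / ‖a‖) = 1 := by
      rw [normSq_div, normSq_ofReal, normSq_eq_norm_sq]
      have : ‖a‖ ≠ 0 := by simpa using ha0
      field_simp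
    have hP1 := h3' (‖a‖ : ℂ) (b * (‖a‖ / a)) (‖a‖ - 1) _ (by
      rw [normSq_mul, normSq_div, normSq_ofReal, ← sq, ← normSq_eq_norm_sq, div_self (by linarith)]
      linarith) (by push_cast; ring) (by simpa using hna) rfl (Or.inl rfl)
    have := hmul _ _ _ _ (hu _ hun) hP1
    convert this using 1
    · field_simp; simp
    · simp; field_simp
  · subst h
    refine h3' a b (1 - a) _ hab (by push_cast; ring) ?_ rfl (Or.inr ?_)
    · have : normSq a < 1 := by linarith
      rw [normSq_apply] at this
      simp; nlinarith [mul_self_nonneg a.im]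
    · have h1 : normSq a < 1 := by linarith
      rw [normSq_apply] at h1
      have h2 : 0 < (1 - a).re := by simp; nlinarith [mul_self_nonneg a.im]
      rw [div_lt_iff₀ (by linarith)]
      have : normSq ((-1 : ℂ) - 1) = 4 := by norm_num [normSq_apply]
      rw [this, normSq_apply]
      simp; nlinarith

/-- Commuting matrices with `f x ^ m = 1` and determinant one: eigenvalue data. -/
theorem joint_diag {X : Type*} [Finite X] (k m : ℕ) (hm : 0 < m) (f : X → Matrix (Fin k) (Fin k) ℂ)
    (hc : ∀ x y, f x * f y = f y * f x) (hp : ∀ x, f x ^ m = 1) (hd : ∀ x, (f x).det = 1) :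
    ∃ χ : Fin k → X → ℂ, (∀ i x, χ i x ^ m = 1) ∧ (∀ x, ∏ i, χ i x = 1) ∧
      ∀ x y, (∀ i, χ i x = χ i y) → f x = f y := by
  classical
  let F : X → Module.End ℂ (Fin k → ℂ) := fun x => Matrix.toLin' (f x)
  have hss : ∀ x, (F x).IsSemisimple := by
    intro x
    refine Module.End.isSemisimple_of_squarefree_aeval_eq_zero
      (p := (Polynomial.X ^ m - 1 : Polynomial ℂ)) ?_ ?_
    · refine Polynomial.Separable.squarefree ?_
      exact (Polynomial.separable_X_pow_sub_C (1 : ℂ) (by exact_mod_cast hm.ne') one_ne_zero)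
    · simp only [map_sub, map_pow, Polynomial.aeval_X, map_one, F]
      rw [← Matrix.toLin'_pow, hp, Matrix.toLin'_one]
      exact sub_self _
  have htop : ⨆ χ : X → ℂ, ⨅ x, (F x).eigenspace (χ x) = ⊤ := by
    have := Module.End.iSup_iInf_maxGenEigenspace_eq_top_of_iSup_maxGenEigenspace_eq_top_of_commute
      F (fun x y _ => by
        show F x * F y = F y * F x
        simp only [F, Module.End.mul_eq_comp, ← Matrix.toLin'_mul, hc x y])
      (fun x => Module.End.iSup_maxGenEigenspace_eq_top _)
    simpa only [fun x => (hss x).isFinitelySemisimple.maxGenEigenspace_eq_eigenspace] using this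
  let S : Set (Fin k → ℂ) := {v | ∃ χ : X → ℂ, ∀ x, F x v = χ x • v}
  have hS : Submodule.span ℂ S = ⊤ := by
    rw [eq_top_iff, ← htop]
    refine iSup_le fun χ v hv => Submodule.subset_span ⟨χ, fun x => ?_⟩
    exact Module.End.mem_eigenspace_iff.mp ((Submodule.mem_iInf _).mp hv x)
  obtain ⟨b, hbS, hbsp, hbl⟩ := exists_linearIndependent ℂ S
  let B0 : Module.Basis b ℂ (Fin k → ℂ) := Module.Basis.mk hbl (by simp [hbsp, hS])
  have hfin : Finite b := Module.Finite.finite_basis B0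
  have : Fintype b := Fintype.ofFinite b
  have hcard : Fintype.card b = k := by
    rw [← Module.finrank_eq_card_basis B0]; simp
  let B : Module.Basis (Fin k) ℂ (Fin k → ℂ) := B0.reindex (Fintype.equivFinOfCardEq hcard)
  have hBS : ∀ i, B i ∈ S := by
    intro i
    have : B i = ((Fintype.equivFinOfCardEq hcard).symm i : b).1 := by
      simp [B, B0]
    rw [this]
    exact hbS (Subtype.property _)
  choose χ hχ using hBS
  have hmat : ∀ x, LinearMap.toMatrix B B (F x) = Matrix.diagonal (fun i => χ i x) := by
    intro x
    ext i j
    rw [LinearMap.toMatrix_apply, hχ]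
    simp [Matrix.diagonal_apply, Finsupp.single_apply, eq_comm]
    split_ifs with h
    · rw [h]
    · rfl
  refine ⟨χ, ?_, ?_, ?_⟩
  · intro i x
    have h1 : (LinearMap.toMatrix B B (F x)) ^ m = 1 := by
      rw [LinearMap.toMatrix_pow B (F x) m, ← Matrix.toLin'_pow, hp, Matrix.toLin'_one,
        LinearMap.toMatrix_id]
    rw [hmat, Matrix.diagonal_pow] at h1
    have := congrFun (congrFun h1 i) i
    simpa using this
  · intro x
    rw [← Matrix.det_diagonal, ← hmat, LinearMap.det_toMatrix, LinearMap.det_toLin', hd]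
  · intro x y h
    have : F x = F y := by
      apply (LinearMap.toMatrix B B).injective
      rw [hmat, hmat]; congr 1; funext i; exact h i
    exact Matrix.toLin'.injective this

/-- Pigeonhole. -/
theorem pigeon (n k : ℕ) (hk : k < n) (f : (Fin n → rootsOfUnity (n+1) ℂ) → Matrix (Fin k) (Fin k) ℂ)
    (hk0 : 0 < k) (hc : ∀ x y, f x * f y = f y * f x) (hp : ∀ x, f x ^ (n+1) = 1) (hd : ∀ x, (f x).det = 1) :
    ∃ x y i j, f x = f y ∧ x i = y i ∧ x j ≠ y j := by
  classical
  have hn0 : 0 < n := by omega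
  obtain ⟨χ, h1, h2, h3⟩ := joint_diag k (n+1) (by omega) f hc hp hd
  let R : Type := rootsOfUnity (n+1) ℂ
  let _ : Fintype R := Fintype.ofFinite (rootsOfUnity (n+1) ℂ)
  have hR : Fintype.card R = n + 1 := by
    rw [← Nat.card_eq_fintype_card]; exact Complex.card_rootsOfUnity (n+1)
  let χ' : Fin k → (Fin n → R) → R := fun i x => rootsOfUnity.mkOfPowEq (χ i x) (h1 i x)
  have hχ' : ∀ i x, (((χ' i x : rootsOfUnity (n+1) ℂ) : ℂˣ) : ℂ) = χ i x := fun i x =>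
    rootsOfUnity.coe_mkOfPowEq _
  let i0 : Fin n := ⟨0, hn0⟩
  rcases k with _ | k
  · omega
  let Φ : (Fin n → R) → (Fin (k+1) → R) := fun x => Fin.cons (x i0) (fun i => χ' i.succ x)
  have hlt : Fintype.card (Fin (k+1) → R) < Fintype.card (Fin n → R) := by
    rw [Fintype.card_fun, Fintype.card_fun, hR, Fintype.card_fin, Fintype.card_fin]
    exact Nat.pow_lt_pow_right (by omega) hk
  obtain ⟨x, y, hxy, hΦ⟩ := Fintype.exists_ne_map_eq_of_card_lt Φ hlt
  obtain ⟨j, hj⟩ := Function.ne_iff.mp hxy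
  have hs : ∀ i : Fin k, χ i.succ x = χ i.succ y := by
    intro i
    have := congrFun hΦ i.succ
    simp only [Φ, Fin.cons_succ] at this
    rw [← hχ', ← hχ', this]
  refine ⟨x, y, i0, j, h3 x y ?_, by simpa [Φ] using congrFun hΦ 0, hj⟩
  have hx := h2 x
  have hy := h2 y
  rw [Fin.prod_univ_succ] at hx hy
  simp only [hs] at hx
  have hne : ∏ i : Fin k, χ i.succ y ≠ 0 := by
    intro h; rw [h, mul_zero] at hy; exact zero_ne_one hy
  intro i
  refine Fin.cases ?_ hs i
  exact mul_right_cancel₀ hne (hx.trans hy.symm)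

/-- sign of the Hermitian form -/
def eps (p q : ℕ) (i : Fin (p+q)) : ℝ := if (i : ℕ) < q then -1 else 1

theorem eps_cases (p q : ℕ) (i : Fin (p+q)) : eps p q i = 1 ∨ eps p q i = -1 := by
  unfold eps; split_ifs <;> simp

theorem eps_sq (p q : ℕ) (i : Fin (p+q)) : eps p q i * eps p q i = 1 := by
  rcases eps_cases p q i with h | h <;> rw [h] <;> norm_num

theorem eps_sqC (p q : ℕ) (i : Fin (p+q)) : (eps p q i : ℂ) * eps p q i = 1 := by
  exact_mod_cast eps_sq p q i

theorem Jmat_eq (p q : ℕ) : Jmat p q = Matrix.diagonal fun i => (eps p q i : ℂ) := by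
  unfold Jmat eps
  congr 1; funext i; split_ifs <;> simp

def sg (p q : ℕ) (i j : Fin (p+q)) : ℝ := -(eps p q i * eps p q j)

theorem sg_cases (p q : ℕ) (i j : Fin (p+q)) : sg p q i j = 1 ∨ sg p q i j = -1 := by
  unfold sg
  rcases eps_cases p q i with h | h <;> rcases eps_cases p q j with h' | h' <;> rw [h, h'] <;>
    norm_num

open ComplexConjugate

def bU {n : ℕ} (i j : Fin n) : Matrix (Fin n) (Fin 2) ℂ :=
  Matrix.of fun r x => if r = ![i, j] x then 1 else 0

def bM (σ : ℝ) (a b : ℂ) : Matrix (Fin 2) (Fin 2) ℂ := !![a, b; σ * conj b, conj a]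

/-- block matrix acting on coordinates `i, j`. -/
def bMat {n : ℕ} (i j : Fin n) (σ : ℝ) (a b : ℂ) : Matrix (Fin n) (Fin n) ℂ :=
  1 + bU i j * ((bM σ a b - 1) * (bU i j)ᵀ)

theorem bU_mul {n : ℕ} (i j : Fin n) {m : Type*} (B : Matrix (Fin 2) m ℂ) (r : Fin n) (c : m) :
    (bU i j * B) r c = (if r = i then B 0 c else 0) + (if r = j then B 1 c else 0) := by
  simp [Matrix.mul_apply, Fin.sum_univ_two, bU]
  rfl

theorem bUT_mul {n : ℕ} (i j : Fin n) {m : Type*} (A : Matrix (Fin n) m ℂ) (x : Fin 2) (c : m) :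
    ((bU i j)ᵀ * A) x c = A (![i, j] x) c := by
  simp [Matrix.mul_apply, bU]

theorem bUT_bU {n : ℕ} (i j : Fin n) (hij : i ≠ j) : (bU i j)ᵀ * bU i j = 1 := by
  ext x y
  rw [bUT_mul]
  fin_cases x <;> fin_cases y <;> simp [bU, hij, hij.symm]

theorem bMat_det {n : ℕ} (i j : Fin n) (hij : i ≠ j) (σ : ℝ) (a b : ℂ) :
    (bMat i j σ a b).det = ((Complex.normSq a - σ * Complex.normSq b : ℝ) : ℂ) := by
  unfold bMat
  rw [Matrix.det_one_add_mul_comm, Matrix.mul_assoc, bUT_bU i j hij, mul_one, add_sub_cancel,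
    bM, Matrix.det_fin_two_of]
  push_cast
  rw [← Complex.mul_conj, ← Complex.mul_conj]; ring

theorem bMat_mul_i {n : ℕ} (i j : Fin n) (hij : i ≠ j) (σ : ℝ) (a b : ℂ)
    (A : Matrix (Fin n) (Fin n) ℂ) (c : Fin n) :
    (bMat i j σ a b * A) i c = a * A i c + b * A j c := by
  unfold bMat
  rw [Matrix.add_mul, one_mul, Matrix.mul_assoc, Matrix.mul_assoc, Matrix.add_apply, bU_mul]
  rw [if_pos rfl, if_neg hij, Matrix.mul_apply, Fin.sum_univ_two, bUT_mul, bUT_mul]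
  simp [bM]; ring

theorem bMat_mul_j {n : ℕ} (i j : Fin n) (hij : i ≠ j) (σ : ℝ) (a b : ℂ)
    (A : Matrix (Fin n) (Fin n) ℂ) (c : Fin n) :
    (bMat i j σ a b * A) j c = σ * conj b * A i c + conj a * A j c := by
  unfold bMat
  rw [Matrix.add_mul, one_mul, Matrix.mul_assoc, Matrix.mul_assoc, Matrix.add_apply, bU_mul]
  rw [if_pos rfl, if_neg hij.symm, Matrix.mul_apply, Fin.sum_univ_two, bUT_mul, bUT_mul]
  simp [bM]; ring

theorem bMat_mul_r {n : ℕ} (i j : Fin n) (σ : ℝ) (a b : ℂ)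
    (A : Matrix (Fin n) (Fin n) ℂ) (r c : Fin n) (hi : r ≠ i) (hj : r ≠ j) :
    (bMat i j σ a b * A) r c = A r c := by
  unfold bMat
  rw [Matrix.add_mul, one_mul, Matrix.mul_assoc, Matrix.mul_assoc, Matrix.add_apply, bU_mul]
  rw [if_neg hi, if_neg hj]; simp

theorem bMat_ext {n : ℕ} (i j : Fin n) (hij : i ≠ j) (σ : ℝ) (a b : ℂ)
    (A B : Matrix (Fin n) (Fin n) ℂ) (h1 : ∀ c, a * A i c + b * A j c = B i c)
    (h2 : ∀ c, σ * conj b * A i c + conj a * A j c = B j c)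
    (h3 : ∀ r c, r ≠ i → r ≠ j → A r c = B r c) : bMat i j σ a b * A = B := by
  ext r c
  by_cases hi : r = i
  · subst hi; rw [bMat_mul_i _ _ hij, h1]
  by_cases hj : r = j
  · subst hj; rw [bMat_mul_j _ _ hij, h2]
  rw [bMat_mul_r _ _ _ _ _ _ _ _ hi hj, h3 r c hi hj]

theorem bMat_i {n : ℕ} (i j : Fin n) (hij : i ≠ j) (σ : ℝ) (a b : ℂ) (c : Fin n) :
    (bMat i j σ a b) i c = a * (1 : Matrix (Fin n) (Fin n) ℂ) i c
      + b * (1 : Matrix (Fin n) (Fin n) ℂ) j c := by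
  rw [← bMat_mul_i i j hij σ, mul_one]

theorem bMat_j {n : ℕ} (i j : Fin n) (hij : i ≠ j) (σ : ℝ) (a b : ℂ) (c : Fin n) :
    (bMat i j σ a b) j c = σ * conj b * (1 : Matrix (Fin n) (Fin n) ℂ) i c
      + conj a * (1 : Matrix (Fin n) (Fin n) ℂ) j c := by
  rw [← bMat_mul_j i j hij σ, mul_one]

theorem bMat_r {n : ℕ} (i j : Fin n) (σ : ℝ) (a b : ℂ) (r c : Fin n) (hi : r ≠ i)
    (hj : r ≠ j) : (bMat i j σ a b) r c = (1 : Matrix (Fin n) (Fin n) ℂ) r c := by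
  rw [← bMat_mul_r i j σ a b 1 r c hi hj, mul_one]

theorem bMat_mul {n : ℕ} (i j : Fin n) (hij : i ≠ j) (σ : ℝ) (hσ : σ * σ = 1) (a b c d : ℂ) :
    bMat i j σ a b * bMat i j σ c d =
      bMat i j σ (a * c + σ * b * conj d) (a * d + b * conj c) := by
  apply bMat_ext i j hij
  · intro x
    rw [bMat_i _ _ hij, bMat_j _ _ hij, bMat_i _ _ hij]; ring
  · intro x
    rw [bMat_i _ _ hij, bMat_j _ _ hij, bMat_j _ _ hij]
    simp
    ring
  · intro r x hi hj
    rw [bMat_r _ _ _ _ _ _ _ hi hj, bMat_r _ _ _ _ _ _ _ hi hj]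

theorem bMat_one {n : ℕ} (i j : Fin n) (σ : ℝ) : bMat i j σ 1 0 = 1 := by
  have : bM σ 1 0 = 1 := by
    ext x y; fin_cases x <;> fin_cases y <;> simp [bM]
  simp [bMat, this]

theorem bMat_conj {n : ℕ} (i j : Fin n) (σ : ℝ) (hσ : σ * σ = 1) (a b : ℂ) :
    (bMat i j σ a b)ᴴ = bMat i j σ (conj a) (σ * b) := by
  have hσC : (σ : ℂ) * σ = 1 := by exact_mod_cast hσ
  have h1 : (bM σ a b)ᴴ = bM σ (conj a) (σ * b) := by
    ext x y; fin_cases x <;> fin_cases y <;> simp [bM, Matrix.conjTranspose_apply]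
    rw [← mul_assoc, hσC, one_mul]
  have h2 : ((bU i j)ᵀ)ᴴ = bU i j := by
    ext x y; simp [bU, Matrix.conjTranspose_apply, apply_ite]
  have h3 : (bU i j)ᴴ = (bU i j)ᵀ := by
    ext x y; simp [bU, Matrix.conjTranspose_apply, apply_ite]
  unfold bMat
  rw [Matrix.conjTranspose_add, Matrix.conjTranspose_mul, Matrix.conjTranspose_mul,
    Matrix.conjTranspose_sub, h1, h2, h3, Matrix.conjTranspose_one, Matrix.conjTranspose_one, Matrix.mul_assoc]

theorem bMat_diag {n : ℕ} (i j : Fin n) (hij : i ≠ j) (σ : ℝ) (u : ℂ) :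
    bMat i j σ u 0 = Matrix.diagonal fun r => if r = i then u else if r = j then conj u else 1 := by
  rw [← mul_one (bMat i j σ u 0)]
  apply bMat_ext i j hij
  · intro c; simp [Matrix.diagonal_apply, Matrix.one_apply]
  · intro c; simp [Matrix.diagonal_apply, Matrix.one_apply, hij.symm]
  · intro r c hi hj; simp [Matrix.diagonal_apply, Matrix.one_apply, hi, hj]

/-- build an element of SU(p,q). -/
theorem exists_SU {p q : ℕ} (K : Matrix (Fin (p+q)) (Fin (p+q)) ℂ)
    (hJ : Kᴴ * Jmat p q * K = Jmat p q) (hd : K.det = 1) :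
    ∃ g : SUIndef p q, ((g : GL (Fin (p+q)) ℂ) : Matrix (Fin (p+q)) (Fin (p+q)) ℂ) = K := by
  let g := Matrix.GeneralLinearGroup.mkOfDetNeZero K (by rw [hd]; exact one_ne_zero)
  exact ⟨⟨g, hJ, hd⟩, rfl⟩

theorem SU_ext {p q : ℕ} {g h : SUIndef p q}
    (H : ((g : GL (Fin (p+q)) ℂ) : Matrix (Fin (p+q)) (Fin (p+q)) ℂ) =
      ((h : GL (Fin (p+q)) ℂ) : Matrix (Fin (p+q)) (Fin (p+q)) ℂ)) : g = h :=
  Subtype.ext (Units.ext H)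

theorem SU_form {p q : ℕ} (A : SUIndef p q) (r c : Fin (p+q)) :
    ∑ x, conj (((A : GL (Fin (p+q)) ℂ) : Matrix (Fin (p+q)) (Fin (p+q)) ℂ) x r) * eps p q x *
      ((A : GL (Fin (p+q)) ℂ) : Matrix (Fin (p+q)) (Fin (p+q)) ℂ) x c =
      if r = c then (eps p q r : ℂ) else 0 := by
  have := congrFun (congrFun A.2.1 r) c
  rw [Jmat_eq, Matrix.diagonal_apply, Matrix.mul_apply] at this
  simp only [Matrix.mul_diagonal, Matrix.conjTranspose_apply] at this
  exact this

theorem exists_blk {p q : ℕ} (i j : Fin (p+q)) (hij : i ≠ j) (a b : ℂ)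
    (hab : Complex.normSq a - sg p q i j * Complex.normSq b = 1) :
    ∃ g : SUIndef p q, ((g : GL (Fin (p+q)) ℂ) : Matrix (Fin (p+q)) (Fin (p+q)) ℂ) =
      bMat i j (sg p q i j) a b := by
  have hσ : sg p q i j * sg p q i j = 1 := by
    rcases sg_cases p q i j with h | h <;> rw [h] <;> norm_num
  have hσC : (sg p q i j : ℂ) * sg p q i j = 1 := by exact_mod_cast hσ
  have h1 : (sg p q i j : ℂ) * eps p q j = - eps p q i := by
    unfold sg; push_cast; linear_combination (-(eps p q i) : ℂ) * eps_sqC p q j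
  have h2 : (sg p q i j : ℂ) * eps p q i = - eps p q j := by
    unfold sg; push_cast; linear_combination (-(eps p q j) : ℂ) * eps_sqC p q i
  have habC : a * conj a - sg p q i j * (b * conj b) = 1 := by
    rw [Complex.mul_conj, Complex.mul_conj]; exact_mod_cast hab
  apply exists_SU
  · rw [bMat_conj _ _ _ hσ, Matrix.mul_assoc]
    apply bMat_ext i j hij
    · intro c
      rw [Jmat_eq, Matrix.diagonal_mul, Matrix.diagonal_mul, bMat_i _ _ hij, bMat_j _ _ hij]
      rw [Matrix.diagonal_apply, Matrix.one_apply, Matrix.one_apply]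
      by_cases hc : i = c
      · subst hc
        simp only [if_true, if_neg hij.symm]
        linear_combination (eps p q i : ℂ) * habC + (sg p q i j : ℂ) * b * conj b * h1
      · rw [if_neg hc, if_neg hc]
        linear_combination ((b * conj a) * if j = c then 1 else 0) * h1
    · intro c
      rw [Jmat_eq, Matrix.diagonal_mul, Matrix.diagonal_mul, bMat_i _ _ hij, bMat_j _ _ hij]
      rw [Matrix.diagonal_apply, Matrix.one_apply, Matrix.one_apply]
      simp only [map_mul, Complex.conj_ofReal, Complex.conj_conj]
      by_cases hc : j = c
      · subst hc
        simp only [if_true, if_neg hij]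
        linear_combination (eps p q j : ℂ) * habC + (sg p q i j : ℂ) * b * conj b * h2
      · rw [if_neg hc, if_neg hc]
        linear_combination ((a * conj b * sg p q i j) * if i = c then 1 else 0) * h2
    · intro r c hi hj
      rw [Jmat_eq, Matrix.diagonal_mul, bMat_r _ _ _ _ _ _ _ hi hj, Matrix.diagonal_apply,
        Matrix.one_apply]
      simp
  · rw [bMat_det i j hij, hab]; simp

theorem SU_diag_norm {p q : ℕ} (t : SUIndef p q) (d : Fin (p+q) → ℂ)
    (ht : ((t : GL (Fin (p+q)) ℂ) : Matrix (Fin (p+q)) (Fin (p+q)) ℂ) = Matrix.diagonal d)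
    (r : Fin (p+q)) : d r * conj (d r) = 1 := by
  have := SU_form t r r
  rw [ht, Finset.sum_eq_single r] at this
  · simp only [Matrix.diagonal_apply_eq, if_true] at this
    linear_combination (eps p q r : ℂ) * this + (1 - d r * conj (d r)) * eps_sqC p q r
  · intro x _ hx
    rw [Matrix.diagonal_apply_ne _ hx]; simp
  · simp

/-- all blocks at `(i,j)` lie in `N`. -/
def HasBlk {p q : ℕ} (N : Subgroup (SUIndef p q)) (i j : Fin (p+q)) : Prop :=
  ∀ a b : ℂ, Complex.normSq a - sg p q i j * Complex.normSq b = 1 →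
    ∃ g ∈ N, ((g : GL (Fin (p+q)) ℂ) : Matrix (Fin (p+q)) (Fin (p+q)) ℂ) =
      bMat i j (sg p q i j) a b

theorem comm_blk {p q : ℕ} (N : Subgroup (SUIndef p q)) (i j : Fin (p+q)) (hij : i ≠ j)
    (t : SUIndef p q) (d : Fin (p+q) → ℂ)
    (ht : ((t : GL (Fin (p+q)) ℂ) : Matrix (Fin (p+q)) (Fin (p+q)) ℂ) = Matrix.diagonal d)
    (hN : ∀ h, t * h * t⁻¹ * h⁻¹ ∈ N) (w : ℂ) (hw : w = d i * conj (d j)) (a b : ℂ)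
    (hab : Complex.normSq a - sg p q i j * Complex.normSq b = 1) :
    ∃ g ∈ N, ((g : GL (Fin (p+q)) ℂ) : Matrix (Fin (p+q)) (Fin (p+q)) ℂ) =
      bMat i j (sg p q i j) (Complex.normSq a - sg p q i j * w * Complex.normSq b)
        (a * b * (w - 1)) := by
  have hi := SU_diag_norm t d ht i
  have hj := SU_diag_norm t d ht j
  have hσ : sg p q i j * sg p q i j = 1 := by
    rcases sg_cases p q i j with h | h <;> rw [h] <;> norm_num
  have hwn : w * conj w = 1 := by
    rw [hw]; simp only [map_mul, Complex.conj_conj]; linear_combination d j * conj (d j) * hi + hj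
  have hwn' : Complex.normSq w = 1 := by
    rw [Complex.mul_conj] at hwn; exact_mod_cast hwn
  have habC : a * conj a - sg p q i j * (b * conj b) = 1 := by
    rw [Complex.mul_conj, Complex.mul_conj]; exact_mod_cast hab
  obtain ⟨h, hh⟩ := exists_blk i j hij a b hab
  obtain ⟨h', hh'⟩ := exists_blk i j hij a (w * b) (by rw [Complex.normSq_mul, hwn', one_mul, hab])
  obtain ⟨hi', hhi⟩ := exists_blk i j hij (conj a) (-b)
    (by rw [Complex.normSq_neg, Complex.normSq_conj, hab])
  have e1 : h * hi' = 1 := by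
    apply SU_ext
    show (_ * _ : Matrix _ _ ℂ) = 1
    rw [hh, hhi, bMat_mul i j hij _ hσ]
    rw [show a * conj a + (sg p q i j : ℂ) * b * conj (-b) = 1 by
      rw [map_neg]; linear_combination habC]
    rw [show a * -b + b * conj (conj a) = 0 by simp; ring, bMat_one]
  have e2 : t * h = h' * t := by
    apply SU_ext
    show (_ * _ : Matrix _ _ ℂ) = (_ * _ : Matrix _ _ ℂ)
    rw [ht, hh, hh']
    symm
    apply bMat_ext i j hij
    · intro c
      rw [Matrix.diagonal_mul, bMat_i _ _ hij]
      simp only [Matrix.diagonal_apply, Matrix.one_apply]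
      by_cases h1 : i = c
      · subst h1; simp only [if_true, if_neg hij.symm]; ring
      · by_cases h2 : j = c
        · subst h2; simp only [if_true, if_neg hij]; rw [hw]; linear_combination b * d i * hj
        · simp [h1, h2]
    · intro c
      rw [Matrix.diagonal_mul, bMat_j _ _ hij]
      simp only [Matrix.diagonal_apply, Matrix.one_apply]
      by_cases h1 : i = c
      · subst h1; simp only [if_true, if_neg hij.symm]; rw [hw]
        simp only [map_mul, Complex.conj_conj]
        linear_combination (sg p q i j : ℂ) * conj b * d j * hi
      · by_cases h2 : j = c
        · subst h2; simp only [if_true, if_neg hij]; ring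
        · simp [h1, h2]
    · intro r c h1 h2
      rw [Matrix.diagonal_mul, bMat_r _ _ _ _ _ _ _ h1 h2]
      simp only [Matrix.diagonal_apply, Matrix.one_apply]
      split_ifs <;> simp
  have e3 : t * h * t⁻¹ * h⁻¹ = h' * hi' := by
    rw [e2, eq_inv_of_mul_eq_one_right e1]; group
  refine ⟨_, hN h, ?_⟩
  rw [e3]
  show (_ * _ : Matrix _ _ ℂ) = _
  rw [hh', hhi, bMat_mul i j hij _ hσ]
  congr 1
  · rw [map_neg, ← Complex.mul_conj, ← Complex.mul_conj]; ring
  · simp; ring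

theorem block_in {p q : ℕ} (N : Subgroup (SUIndef p q)) [hNn : N.Normal] (i j : Fin (p+q))
    (hij : i ≠ j) (t : SUIndef p q) (d : Fin (p+q) → ℂ)
    (ht : ((t : GL (Fin (p+q)) ℂ) : Matrix (Fin (p+q)) (Fin (p+q)) ℂ) = Matrix.diagonal d)
    (hN : ∀ h, t * h * t⁻¹ * h⁻¹ ∈ N) (hd : d i ≠ d j) : HasBlk N i j := by
  have hi := SU_diag_norm t d ht i
  have hj := SU_diag_norm t d ht j
  have hσ : sg p q i j * sg p q i j = 1 := by
    rcases sg_cases p q i j with h | h <;> rw [h] <;> norm_num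
  have hwn : (d i * conj (d j)) * conj (d i * conj (d j)) = 1 := by
    simp only [map_mul, Complex.conj_conj]; linear_combination d j * conj (d j) * hi + hj
  have hwn' : Complex.normSq (d i * conj (d j)) = 1 := by
    rw [Complex.mul_conj] at hwn; exact_mod_cast hwn
  let P : ℂ → ℂ → Prop := fun a b => Complex.normSq a - sg p q i j * Complex.normSq b = 1 ∧
    ∃ g ∈ N, ((g : GL (Fin (p+q)) ℂ) : Matrix (Fin (p+q)) (Fin (p+q)) ℂ) =
      bMat i j (sg p q i j) a b
  have hval : ∀ a b, (∃ g ∈ N, ((g : GL (Fin (p+q)) ℂ) : Matrix (Fin (p+q)) (Fin (p+q)) ℂ) =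
      bMat i j (sg p q i j) a b) → P a b := by
    rintro a b ⟨g, hg, hgm⟩
    refine ⟨?_, g, hg, hgm⟩
    have := g.2.2
    rw [hgm, bMat_det i j hij] at this
    exact_mod_cast this
  have key : ∀ a b, Complex.normSq a - sg p q i j * Complex.normSq b = 1 → P a b := by
    refine blk_all (sg p q i j) (sg_cases p q i j) P ?_ ?_ ?_ ?_ (d i * conj (d j)) ?_ hwn' ?_
    · exact hval _ _ ⟨1, N.one_mem, by rw [bMat_one]; rfl⟩
    · rintro a b c e ⟨-, g, hg, hgm⟩ ⟨-, g', hg', hgm'⟩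
      refine hval _ _ ⟨g * g', N.mul_mem hg hg', ?_⟩
      rw [← bMat_mul i j hij _ hσ, ← hgm, ← hgm']; rfl
    · rintro a b ⟨hab, g, hg, hgm⟩
      obtain ⟨g', hg'⟩ := exists_blk i j hij (conj a) (-b)
        (by rw [Complex.normSq_neg, Complex.normSq_conj, hab])
      have habC : a * conj a - sg p q i j * (b * conj b) = 1 := by
        rw [Complex.mul_conj, Complex.mul_conj]; exact_mod_cast hab
      have e1 : g * g' = 1 := by
        apply SU_ext
        show (_ * _ : Matrix _ _ ℂ) = 1
        rw [hgm, hg', bMat_mul i j hij _ hσ]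
        rw [show a * conj a + (sg p q i j : ℂ) * b * conj (-b) = 1 by
          rw [map_neg]; linear_combination habC]
        rw [show a * -b + b * conj (conj a) = 0 by simp; ring, bMat_one]
      refine hval _ _ ⟨g', ?_, hg'⟩
      rw [eq_inv_of_mul_eq_one_right e1]
      exact N.inv_mem hg
    · rintro ⟨-, g, hg, hgm⟩ a b hab
      rw [bMat_diag i j hij] at hgm
      refine hval _ _ (comm_blk N i j hij g _ hgm ?_ (-1) ?_ a b hab)
      · intro h
        rw [mul_assoc, mul_assoc]
        exact N.mul_mem hg (by
          rw [← mul_assoc]; exact hNn.conj_mem _ (N.inv_mem hg) h)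
      · simp [hij.symm]
    · intro h
      apply hd
      linear_combination d j * h - d i * hj
    · intro a b hab
      exact hval _ _ (comm_blk N i j hij t d ht hN _ rfl a b hab)
  exact fun a b hab => (key a b hab).2

theorem conj_comm_mem {G : Type*} [Group G] (N : Subgroup G) [hNn : N.Normal] (g : G) (hg : g ∈ N)
    (h : G) : g * h * g⁻¹ * h⁻¹ ∈ N := by
  rw [mul_assoc, mul_assoc]
  exact N.mul_mem hg (by rw [← mul_assoc]; exact hNn.conj_mem _ (N.inv_mem hg) h)

theorem all_blocks {p q : ℕ} (N : Subgroup (SUIndef p q)) [hNn : N.Normal] (i j : Fin (p+q))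
    (hij : i ≠ j) (t : SUIndef p q) (d : Fin (p+q) → ℂ)
    (ht : ((t : GL (Fin (p+q)) ℂ) : Matrix (Fin (p+q)) (Fin (p+q)) ℂ) = Matrix.diagonal d)
    (hN : t ∈ N) (hd : d i ≠ d j) : ∀ c e, c ≠ e → HasBlk N c e := by
  have h0 := block_in N i j hij t d ht (conj_comm_mem N t hN) hd
  have hI1 : Complex.I ≠ 1 := by
    intro h; have := congrArg Complex.re h; simp at this
  have hI2 : Complex.I ≠ -Complex.I := by
    intro h; have := congrArg Complex.im h; norm_num at this
  have hI3 : -Complex.I ≠ 1 := by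
    intro h; have := congrArg Complex.re h; simp at this
  have step1 : ∀ i j, i ≠ j → HasBlk N i j → ∀ l, i ≠ l → HasBlk N i l := by
    intro i j hij hB l hl
    obtain ⟨g, hg, hgm⟩ := hB Complex.I 0 (by simp)
    rw [bMat_diag i j hij] at hgm
    refine block_in N i l hl g _ hgm (conj_comm_mem N g hg) ?_
    simp only [if_true, if_neg hl.symm, Complex.conj_I]
    split_ifs
    · exact hI2
    · exact hI1
  have step2 : ∀ i j, i ≠ j → HasBlk N i j → ∀ l, j ≠ l → HasBlk N j l := by
    intro i j hij hB l hl
    obtain ⟨g, hg, hgm⟩ := hB Complex.I 0 (by simp)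
    rw [bMat_diag i j hij] at hgm
    refine block_in N j l hl g _ hgm (conj_comm_mem N g hg) ?_
    simp only [if_true, if_neg hij.symm, if_neg hl.symm, Complex.conj_I]
    split_ifs
    · exact hI2.symm
    · exact hI3
  intro c e hce
  by_cases hc : i = c
  · subst hc; exact step1 i j hij h0 e hce
  · exact step2 i c hc (step1 i j hij h0 c hc) e hce

theorem gen_step {p q : ℕ} (N : Subgroup (SUIndef p q))
    (hB : ∀ i j, i ≠ j → HasBlk N i j) (s : Finset (Fin (p+q))) (j : Fin (p+q)) (hj : j ∉ s)
    (hs : ∀ A : SUIndef p q, (∀ c ∈ insert j s, ∀ r,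
      ((A : GL (Fin (p+q)) ℂ) : Matrix (Fin (p+q)) (Fin (p+q)) ℂ) r c = if r = c then 1 else 0) →
      A ∈ N) (m : ℕ) :
    ∀ A : SUIndef p q, (∀ c ∈ s, ∀ r,
      ((A : GL (Fin (p+q)) ℂ) : Matrix (Fin (p+q)) (Fin (p+q)) ℂ) r c = if r = c then 1 else 0) →
      (Finset.univ.filter fun r => r ≠ j ∧
        ((A : GL (Fin (p+q)) ℂ) : Matrix (Fin (p+q)) (Fin (p+q)) ℂ) r j ≠ 0).card = m → A ∈ N := by
  induction m with
  | zero =>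
    intro A hA hcard
    set M := ((A : GL (Fin (p+q)) ℂ) : Matrix (Fin (p+q)) (Fin (p+q)) ℂ) with hM
    have h0 : ∀ r, r ≠ j → M r j = 0 := by
      intro r hr
      by_contra hne
      have : r ∈ (Finset.univ.filter fun r => r ≠ j ∧ M r j ≠ 0) := by simp [hr, hne]
      rw [Finset.card_eq_zero.mp hcard] at this
      simp at this
    have hjj : M j j * conj (M j j) = 1 := by
      have := SU_form A j j
      rw [← hM, Finset.sum_eq_single j] at this
      · simp only [if_true] at this
        linear_combination (eps p q j : ℂ) * this + (1 - M j j * conj (M j j)) * eps_sqC p q j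
      · intro x _ hx
        rw [h0 x hx]; simp
      · simp
    by_cases hex : ∃ i, i ∉ s ∧ i ≠ j
    · obtain ⟨i, his, hij⟩ := hex
      obtain ⟨g, hg, hgm⟩ := hB j i hij.symm (conj (M j j)) 0 (by
        rw [Complex.normSq_conj]
        rw [Complex.mul_conj] at hjj
        have : Complex.normSq (M j j) = 1 := by exact_mod_cast hjj
        simp [this])
      have hgA : g * A ∈ N := by
        apply hs
        have hco : (((g * A : SUIndef p q) : GL (Fin (p+q)) ℂ) : Matrix (Fin (p+q)) (Fin (p+q)) ℂ)
          = bMat j i (sg p q j i) (conj (M j j)) 0 * M := by rw [← hgm]; rfl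
        rw [hco]
        intro c hc r
        by_cases hrj : r = j
        · subst hrj
          rw [bMat_mul_i _ _ hij.symm]
          rcases Finset.mem_insert.mp hc with h | h
          · subst h; rw [if_pos rfl, zero_mul, add_zero, mul_comm, hjj]
          · have : r ≠ c := by rintro rfl; exact hj h
            rw [hA c h r, if_neg this]; simp
        by_cases hri : r = i
        · subst hri
          rw [bMat_mul_j _ _ hij.symm]
          rcases Finset.mem_insert.mp hc with h | h
          · subst h; rw [if_neg hij, h0 r hij]; simp
          · have : r ≠ c := by rintro rfl; exact his h
            rw [hA c h r, if_neg this]; simp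
        rw [bMat_mul_r _ _ _ _ _ _ _ _ hrj hri]
        rcases Finset.mem_insert.mp hc with h | h
        · subst h; rw [if_neg hrj, h0 r hrj]
        · exact hA c h r
      exact (N.mul_mem_cancel_left hg).mp hgA
    · push Not at hex
      have hMd : M = Matrix.diagonal (fun r => if r = j then M j j else 1) := by
        ext r c
        by_cases hc : c = j
        · subst hc
          by_cases hr : r = c
          · subst hr; simp
          · rw [h0 r hr, Matrix.diagonal_apply_ne _ hr]
        · have hcs : c ∈ s := by
            by_contra h; exact hc (hex c h)
          rw [hA c hcs r, Matrix.diagonal_apply]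
          split_ifs with h1 h2
          · exact absurd (h1 ▸ h2) hc
          · rfl
          · rfl
      have hdet : M.det = 1 := A.2.2
      have hj1 : M j j = 1 := by
        rw [hMd, Matrix.det_diagonal] at hdet
        simpa using hdet
      apply hs
      intro c _ r
      rw [← hM, hMd, hj1, Matrix.diagonal_apply]
      simp
  | succ m ih =>
    intro A hA hcard
    set M := ((A : GL (Fin (p+q)) ℂ) : Matrix (Fin (p+q)) (Fin (p+q)) ℂ) with hM
    have hsz : ∀ r ∈ s, M r j = 0 := by
      intro r hr
      have := SU_form A r j
      have hrj : r ≠ j := by rintro rfl; exact hj hr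
      rw [← hM, Finset.sum_eq_single r, if_neg hrj, hA r hr r, if_pos rfl] at this
      · simp only [map_one, one_mul] at this
        have := congrArg (fun z => (eps p q r : ℂ) * z) this
        simp only [← mul_assoc, eps_sqC, one_mul, mul_zero] at this
        exact this
      · intro x _ hx
        rw [hA r hr x, if_neg hx]; simp
      · simp
    obtain ⟨i, hij, hi0, hpos⟩ : ∃ i, i ≠ j ∧ M i j ≠ 0 ∧
        0 < Complex.normSq (M j j) - sg p q j i * Complex.normSq (M i j) := by
      by_cases hex : ∃ i, i ≠ j ∧ M i j ≠ 0 ∧ sg p q j i = -1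
      · obtain ⟨i, h1, h2, h3⟩ := hex
        refine ⟨i, h1, h2, ?_⟩
        rw [h3]
        have := Complex.normSq_pos.mpr h2
        have := Complex.normSq_nonneg (M j j)
        linarith
      · push Not at hex
        obtain ⟨i, hi⟩ : (Finset.univ.filter fun r => r ≠ j ∧ M r j ≠ 0).Nonempty := by
          rw [← Finset.card_pos, hcard]; omega
        simp only [Finset.mem_filter, Finset.mem_univ, true_and] at hi
        refine ⟨i, hi.1, hi.2, ?_⟩
        have hform := SU_form A j j
        have hreal : ∑ x, (-sg p q j x) * Complex.normSq (M x j) = 1 := by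
          have h1 : (∑ x, ((-sg p q j x * Complex.normSq (M x j) : ℝ) : ℂ)) = 1 := by
            rw [if_pos rfl] at hform
            have := congrArg (fun z => (eps p q j : ℂ) * z) hform
            simp only [eps_sqC, Finset.mul_sum] at this
            rw [← this]
            refine Finset.sum_congr rfl fun x _ => ?_
            unfold sg
            push_cast
            rw [← Complex.mul_conj]; ring
          exact_mod_cast h1
        have hle : ∑ x ∈ ({j, i} : Finset (Fin (p+q)))ᶜ,
            (-sg p q j x) * Complex.normSq (M x j) ≤ 0 := by
          refine Finset.sum_nonpos fun x hx => ?_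
          simp only [Finset.mem_compl, Finset.mem_insert, Finset.mem_singleton, not_or] at hx
          by_cases h0 : M x j = 0
          · simp [h0]
          · have := hex x hx.1 h0
            have h1 : sg p q j x = 1 := (sg_cases p q j x).resolve_right this
            rw [h1]
            have := Complex.normSq_nonneg (M x j)
            linarith
        rw [← Finset.sum_add_sum_compl ({j, i} : Finset (Fin (p+q))),
          Finset.sum_pair hi.1.symm] at hreal
        have hjj : sg p q j j = -1 := by unfold sg; rw [eps_sq]
        rw [hjj] at hreal
        linarith
    have his : i ∉ s := fun h => hi0 (hsz i h)
    set σ := sg p q j i with hσ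
    set ρ2 := Complex.normSq (M j j) - σ * Complex.normSq (M i j) with hρ2
    have hsq : Real.sqrt ρ2 * Real.sqrt ρ2 = ρ2 := Real.mul_self_sqrt hpos.le
    have hσσ : σ * σ = 1 := by
      rcases sg_cases p q j i with h | h <;> rw [hσ, h] <;> norm_num
    have hq0 : ((Real.sqrt ρ2 : ℝ) : ℂ) ≠ 0 := by
      exact_mod_cast (Real.sqrt_pos.mpr hpos).ne'
    obtain ⟨g, hg, hgm⟩ := hB j i hij.symm (conj (M j j) / (Real.sqrt ρ2 : ℝ))
      (-σ * conj (M i j) / (Real.sqrt ρ2 : ℝ)) (by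
        rw [← hσ, Complex.normSq_div, Complex.normSq_div, Complex.normSq_mul, Complex.normSq_neg,
          Complex.normSq_conj, Complex.normSq_conj, Complex.normSq_ofReal, Complex.normSq_ofReal,
          hsq, hσσ, one_mul, ← mul_div_assoc, ← sub_div, ← hρ2, div_self hpos.ne'])
    rw [← hσ] at hgm
    have hco : (((g * A : SUIndef p q) : GL (Fin (p+q)) ℂ) : Matrix (Fin (p+q)) (Fin (p+q)) ℂ)
      = bMat j i σ (conj (M j j) / (Real.sqrt ρ2 : ℝ))
        (-σ * conj (M i j) / (Real.sqrt ρ2 : ℝ)) * M := by rw [← hgm]; rfl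
    have hσC : (σ : ℂ) * σ = 1 := by exact_mod_cast hσσ
    have hgA : g * A ∈ N := by
      apply ih
      · rw [hco]
        intro c hc r
        by_cases hrj : r = j
        · subst hrj
          rw [bMat_mul_i _ _ hij.symm]
          have h1 : r ≠ c := by rintro rfl; exact hj hc
          have h2 : i ≠ c := by rintro rfl; exact his hc
          rw [hA c hc r, hA c hc i, if_neg h1, if_neg h2]; simp
        by_cases hri : r = i
        · subst hri
          rw [bMat_mul_j _ _ hij.symm]
          have h1 : r ≠ c := by rintro rfl; exact his hc
          have h2 : j ≠ c := by rintro rfl; exact hj hc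
          rw [hA c hc r, hA c hc j, if_neg h1, if_neg h2]; simp
        rw [bMat_mul_r _ _ _ _ _ _ _ _ hrj hri]
        exact hA c hc r
      · have hset : (Finset.univ.filter fun r => r ≠ j ∧
            (((g * A : SUIndef p q) : GL (Fin (p+q)) ℂ) :
              Matrix (Fin (p+q)) (Fin (p+q)) ℂ) r j ≠ 0) =
            (Finset.univ.filter fun r => r ≠ j ∧ M r j ≠ 0).erase i := by
          rw [hco]
          ext r
          simp only [Finset.mem_filter, Finset.mem_univ, true_and, Finset.mem_erase]
          by_cases hri : r = i
          · subst hri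
            rw [bMat_mul_j _ _ hij.symm]
            have : (σ : ℂ) * conj (-σ * conj (M r j) / (Real.sqrt ρ2 : ℝ)) * M j j +
                conj (conj (M j j) / (Real.sqrt ρ2 : ℝ)) * M r j = 0 := by
              simp only [map_div₀, map_mul, map_neg, Complex.conj_conj, Complex.conj_ofReal]
              field_simp
              linear_combination (-(M r j * M j j)) * hσC
            rw [this]; simp
          · by_cases hrj : r = j
            · simp [hrj]
            · rw [bMat_mul_r _ _ _ _ _ _ _ _ hrj hri]
              simp [hri]
        rw [hset, Finset.card_erase_of_mem (by simp [hij, hi0]), hcard]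
        rfl
    exact (N.mul_mem_cancel_left hg).mp hgA

theorem gen_all {p q : ℕ} (N : Subgroup (SUIndef p q))
    (hB : ∀ i j, i ≠ j → HasBlk N i j) (A : SUIndef p q) : A ∈ N := by
  have key : ∀ m : ℕ, ∀ s : Finset (Fin (p+q)), sᶜ.card = m → ∀ A : SUIndef p q, (∀ c ∈ s, ∀ r,
      ((A : GL (Fin (p+q)) ℂ) : Matrix (Fin (p+q)) (Fin (p+q)) ℂ) r c = if r = c then 1 else 0) →
      A ∈ N := by
    intro m
    induction m with
    | zero =>
      intro s hs A hA
      have hsu : s = Finset.univ := by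
        rw [← Finset.compl_eq_empty_iff]; exact Finset.card_eq_zero.mp hs
      have : A = 1 := by
        apply SU_ext
        ext r c
        rw [hA c (by simp [hsu]) r]
        rfl
      rw [this]; exact N.one_mem
    | succ m ih =>
      intro s hs A hA
      obtain ⟨j, hj⟩ : sᶜ.Nonempty := by rw [← Finset.card_pos, hs]; omega
      have hjs : j ∉ s := by simpa using hj
      refine gen_step N hB s j hjs (ih (insert j s) ?_) _ A hA rfl
      rw [Finset.compl_insert, Finset.card_erase_of_mem hj, hs]; rfl
  exact key _ ∅ rfl A (by simp)

/-- the torus of `(n+1)`-torsion diagonal elements. -/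
theorem exists_torus (p q : ℕ) : ∃ T : (Fin (p+q) → rootsOfUnity (p+q+1) ℂ) →* SUIndef p q,
    ∀ x, ((T x : GL (Fin (p+q)) ℂ) : Matrix (Fin (p+q)) (Fin (p+q)) ℂ) =
      Matrix.diagonal fun i => ((((x i)⁻¹ * (∏ l, x l)⁻¹ : rootsOfUnity (p+q+1) ℂ) : ℂˣ) : ℂ) := by
  have hnorm : ∀ y : rootsOfUnity (p+q+1) ℂ, conj (((y : ℂˣ) : ℂ)) * ((y : ℂˣ) : ℂ) = 1 := by
    intro y
    have h1 : ((y : ℂˣ) : ℂ) ^ (p+q+1) = 1 := by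
      have := y.2
      rw [mem_rootsOfUnity'] at this
      exact this
    have := Complex.norm_eq_one_of_pow_eq_one h1 (by omega)
    rw [mul_comm, Complex.mul_conj, Complex.normSq_eq_norm_sq, this]; simp
  have hex : ∀ x : Fin (p+q) → rootsOfUnity (p+q+1) ℂ, ∃ g : SUIndef p q,
      ((g : GL (Fin (p+q)) ℂ) : Matrix (Fin (p+q)) (Fin (p+q)) ℂ) =
      Matrix.diagonal fun i => ((((x i)⁻¹ * (∏ l, x l)⁻¹ : rootsOfUnity (p+q+1) ℂ) : ℂˣ) : ℂ) := by
    intro x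
    apply exists_SU
    · rw [Jmat_eq, Matrix.diagonal_conjTranspose, Matrix.diagonal_mul_diagonal,
        Matrix.diagonal_mul_diagonal]
      congr 1
      funext i
      have := hnorm ((x i)⁻¹ * (∏ l, x l)⁻¹)
      have h2 : ∀ y : ℂ, conj y * y = 1 → star y * (eps p q i : ℂ) * y = eps p q i := by
        intro y hy
        show conj y * _ * y = _
        linear_combination (eps p q i : ℂ) * hy
      exact h2 _ this
    · rw [Matrix.det_diagonal]
      have h1 : ∏ i, ((x i)⁻¹ * (∏ l, x l)⁻¹) = 1 := by
        rw [Finset.prod_mul_distrib, Finset.prod_const, Finset.prod_inv_distrib, ← pow_succ']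
        simp only [Finset.card_univ, Fintype.card_fin]
        apply Subtype.ext
        have := ((∏ l, x l)⁻¹).2
        rw [mem_rootsOfUnity] at this
        simpa using this
      have h2 := congrArg (fun y : rootsOfUnity (p+q+1) ℂ => ((y : ℂˣ) : ℂ)) h1
      simp only [OneMemClass.coe_one, Units.val_one] at h2
      rw [← h2]
      push_cast
      rfl
  choose T hT using hex
  refine ⟨MonoidHom.mk' T ?_, hT⟩
  intro x y
  apply SU_ext
  show _ = (_ * _ : Matrix _ _ ℂ)
  rw [hT, hT, hT, Matrix.diagonal_mul_diagonal]
  congr 1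
  funext i
  have : ((x * y) i)⁻¹ * (∏ l, (x * y) l)⁻¹ = ((x i)⁻¹ * (∏ l, x l)⁻¹) * ((y i)⁻¹ * (∏ l, y l)⁻¹) := by
    simp only [Pi.mul_apply, Finset.prod_mul_distrib, mul_inv]
    exact mul_mul_mul_comm _ _ _ _
  rw [this]; rfl

theorem det_one {p q k : ℕ} (ρ : SUIndef p q →* GL (Fin k) ℂ) (A : SUIndef p q) :
    ((ρ A : GL (Fin k) ℂ) : Matrix (Fin k) (Fin k) ℂ).det = 1 := by
  let χ : SUIndef p q →* ℂˣ := Matrix.GeneralLinearGroup.det.comp ρ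
  have hA : A ∈ χ.ker := by
    apply gen_all
    intro i j hij
    obtain ⟨t, ht⟩ := exists_blk i j hij Complex.I 0 (by simp)
    rw [bMat_diag i j hij] at ht
    refine block_in χ.ker i j hij t _ ht ?_ ?_
    · intro h
      rw [MonoidHom.mem_ker]
      simp only [map_mul, map_inv]
      rw [mul_comm (χ t) (χ h)]; group
    · simp only [if_true, if_neg hij.symm, Complex.conj_I]
      intro h; have := congrArg Complex.im h; norm_num at this
  have := congrArg Units.val (MonoidHom.mem_ker.mp hA)
  simpa [χ] using this

/-- Let `p, q, k` be non-negative integers with `p + q ≥ 2` and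
`k < p + q`. Then any Lie group homomorphism (here: continuous group homomorphism)
`ρ : SU(p,q) → GL(k, ℂ)` is trivial. -/
theorem su_pq_hom_to_smaller_GL_trivial (p q k : ℕ) (hpq : 2 ≤ p + q) (hk : k < p + q)
    (ρ : SUIndef p q →* GL (Fin k) ℂ) (hρ : Continuous ρ) :
    ∀ A : SUIndef p q, ρ A = 1 := by
  intro A
  rcases Nat.eq_zero_or_pos k with hk0 | hk0
  · subst hk0
    exact Units.ext (Subsingleton.elim _ _)
  obtain ⟨T, hT⟩ := exists_torus p q
  let f : (Fin (p+q) → rootsOfUnity (p+q+1) ℂ) →* Matrix (Fin k) (Fin k) ℂ :=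
    (Units.coeHom _).comp (ρ.comp T)
  obtain ⟨x, y, i, j, hfxy, hi, hj⟩ := pigeon (p+q) k hk f hk0
    (fun x y => by rw [← map_mul, ← map_mul, mul_comm])
    (fun x => by
      rw [← map_pow]
      have : x ^ (p+q+1) = 1 := by
        funext l
        apply Subtype.ext
        exact (mem_rootsOfUnity _ _).mp (x l).2
      rw [this, map_one])
    (fun x => det_one ρ (T x))
  have hxy : ρ (T x) = ρ (T y) := Units.ext hfxy
  have hker : T (x * y⁻¹) ∈ ρ.ker := by
    rw [MonoidHom.mem_ker, map_mul, map_mul, hxy, ← map_mul, ← map_mul, mul_inv_cancel, map_one,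
      map_one]
  have hij : i ≠ j := by rintro rfl; exact hj hi
  have hA : A ∈ ρ.ker := by
    apply gen_all
    refine all_blocks ρ.ker i j hij (T (x * y⁻¹)) _ (hT _) hker ?_
    intro h
    have h1 := Subtype.ext (Units.ext h)
    have h2 := inv_injective (mul_right_cancel h1)
    simp only [Pi.mul_apply, Pi.inv_apply, hi, mul_inv_cancel] at h2
    exact hj (mul_inv_eq_one.mp h2.symm)
  exact hA

end
end

section
/- Every automorphism f = (f_0, f_1, …, f_n) of the complex manifold ℂ × 𝔹^n has the form f_0(z_0, z') = a(z')z_0 + b(z') and (f_1,…,f_n)(z_0, z') = T(z') where a is a nowhere vanishing holomorphic function on 𝔹^n, b is a holomorphic function on 𝔹^n, and T ∈ Aut(𝔹^n) is a fractional linear transformation induced by a matrix in SU(n,1). -/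
open scoped Matrix

noncomputable section

/-- The unit ball `𝔹^n = {z' ∈ ℂ^n : Σ |z'_i|² < 1}`. -/
def balln (n : ℕ) : Set (Fin n → ℂ) := {z' | ∑ i : Fin n, ‖z' i‖ ^ 2 < 1}

/-- The domain `ℂ × 𝔹^n`. -/
def CBall (n : ℕ) : Set (ℂ × (Fin n → ℂ)) := {z | z.2 ∈ balln n}

/-- The matrix `J = diag[-1, E_n]` of the Hermitian form `-|z_0|² + |z_1|² + ⋯ + |z_n|²`
of signature `(n,1)`. -/
def Jn1 (n : ℕ) : Matrix (Fin (n+1)) (Fin (n+1)) ℂ :=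
  Matrix.diagonal fun i => if i = 0 then (-1 : ℂ) else 1

open Filter Topology Bornology Asymptotics

lemma aux_growth {h : ℂ → ℂ} (hd : Differentiable ℂ h)
    (ht : Tendsto h (cobounded ℂ) (cobounded ℂ)) : (fun z : ℂ => z) =O[cobounded ℂ] h := by
  set F : ℂ → ℂ := Function.update (fun w => (h w⁻¹)⁻¹) 0 0 with hF
  have hFne : ∀ w, w ≠ 0 → F w = (h w⁻¹)⁻¹ := fun w hw => by simp [hF, hw]
  have hF0 : F 0 = 0 := by simp [hF]
  have ht0 : Tendsto (fun w => h w⁻¹) (𝓝[≠] 0) (cobounded ℂ) :=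
    ht.comp tendsto_inv₀_nhdsNE_zero
  have hc : ContinuousAt F 0 := by
    rw [hF, continuousAt_update_same]
    exact tendsto_inv₀_cobounded.comp ht0
  have hdiff : ∀ᶠ z in 𝓝[≠] 0, DifferentiableAt ℂ F z := by
    have h1 : ∀ᶠ z in 𝓝[≠] (0:ℂ), h z⁻¹ ≠ 0 := ht0.eventually_ne_cobounded 0
    filter_upwards [h1, self_mem_nhdsWithin] with z hz hz0
    have hz0 : z ≠ 0 := hz0
    have : DifferentiableAt ℂ (fun w => (h w⁻¹)⁻¹) z := by
      refine DifferentiableAt.inv ?_ hz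
      exact (hd _).comp z (differentiableAt_inv hz0)
    refine this.congr_of_eventuallyEq ?_
    filter_upwards [isOpen_ne.mem_nhds hz0] with w hw using hFne w hw
  have han := Complex.analyticAt_of_differentiable_on_punctured_nhds_of_continuousAt hdiff hc
  have hO := han.differentiableAt.isBigO_sub
  simp only [hF0, sub_zero] at hO
  have hO2 := hO.comp_tendsto tendsto_inv₀_cobounded
  have hO3 : (fun z => (h z)⁻¹) =O[cobounded ℂ] (fun z : ℂ => z⁻¹) := by
    refine hO2.congr' ?_ ?_
    · filter_upwards [eventually_ne_cobounded (0:ℂ)] with z hz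
      simp [hFne z⁻¹ (inv_ne_zero hz)]
    · exact Eventually.of_forall fun z => rfl
  have := hO3.inv_rev ?_
  · simpa using this
  · filter_upwards [ht.eventually_ne_cobounded 0] with z hz h0
    exact absurd h0 (by simpa using hz)

lemma aux_affine {h k : ℂ → ℂ} (hd : Differentiable ℂ h) (kd : Differentiable ℂ k)
    (hk : ∀ z, h (k z) = z) (kh : ∀ z, k (h z) = z) (z : ℂ) :
    h z = (h 1 - h 0) * z + h 0 := by
  let e : ℂ ≃ₜ ℂ := ⟨⟨h, k, kh, hk⟩, hd.continuous, kd.continuous⟩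
  have th : Tendsto h (cobounded ℂ) (cobounded ℂ) := by
    rw [Metric.cobounded_eq_cocompact]; exact e.isClosedEmbedding.tendsto_cocompact
  have tk : Tendsto k (cobounded ℂ) (cobounded ℂ) := by
    rw [Metric.cobounded_eq_cocompact]; exact e.symm.isClosedEmbedding.tendsto_cocompact
  have h1 : h =O[cobounded ℂ] (fun z : ℂ => z) := by
    have := (aux_growth kd tk).comp_tendsto th
    simpa [Function.comp_def, kh] using this
  have h2 : (fun z => h z - h 0) =O[cobounded ℂ] (fun z : ℂ => z) := by
    refine h1.sub ?_
    exact (isLittleO_const_id_cobounded _).isBigO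
  set q := dslope h 0
  have qd : Differentiable ℂ q := by
    rw [← differentiableOn_univ]
    exact (Complex.differentiableOn_dslope univ_mem).2 hd.differentiableOn
  have qb : ∃ C, ∀ᶠ z in cobounded ℂ, ‖q z‖ ≤ C := by
    obtain ⟨C, hC⟩ := h2.bound
    refine ⟨C, ?_⟩
    filter_upwards [hC, eventually_ne_cobounded (0:ℂ)] with z hz hz0
    have : 0 < ‖z‖ := norm_pos_iff.2 hz0
    simp only [q, dslope_of_ne _ hz0, slope_def_field, sub_zero, norm_div]
    rwa [div_le_iff₀ this]
  have qb2 : IsBounded (Set.range q) := by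
    obtain ⟨C, hC⟩ := qb
    rw [Metric.cobounded_eq_cocompact, Filter.Eventually, mem_cocompact] at hC
    obtain ⟨t, ht, hts⟩ := hC
    have := (ht.image qd.continuous).isBounded
    refine (this.union (Metric.isBounded_closedBall (x := (0:ℂ)) (r := C))).subset ?_
    rintro _ ⟨z, rfl⟩
    by_cases hz : z ∈ t
    · exact Or.inl ⟨z, hz, rfl⟩
    · right; simpa using hts hz
  have key : ∀ w, h w - h 0 = w * q 1 := by
    intro w
    rw [qd.apply_eq_apply_of_bounded qb2 1 w]
    have := sub_smul_dslope h 0 w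
    simpa using this.symm
  have k1 := key 1
  have kz := key z
  rw [one_mul] at k1
  rw [k1]; linear_combination kz


lemma aux_linear {E : Type*} [NormedAddCommGroup E] [InnerProductSpace ℂ E] {φ ψ : E → E}
    (hφ : DifferentiableOn ℂ φ (Metric.ball 0 1)) (hψ : DifferentiableOn ℂ ψ (Metric.ball 0 1))
    (mφ : Set.MapsTo φ (Metric.ball 0 1) (Metric.ball 0 1))
    (mψ : Set.MapsTo ψ (Metric.ball 0 1) (Metric.ball 0 1))
    (hl : ∀ z ∈ Metric.ball (0:E) 1, ψ (φ z) = z) (h0 : φ 0 = 0) :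
    ∃ L : E →ₗ[ℂ] E, (∀ z ∈ Metric.ball (0:E) 1, φ z = L z) ∧ ∀ z, ‖L z‖ = ‖z‖ := by
  have : UniformConvexSpace E := by
    letI := InnerProductSpace.rclikeToReal ℂ E
    infer_instance
  have zmem : (0:E) ∈ Metric.ball (0:E) 1 := by simp
  have p0 : ψ 0 = 0 := by simpa [h0] using hl 0 zmem
  have hn : ∀ z ∈ Metric.ball (0:E) 1, ‖φ z‖ = ‖z‖ := by
    intro z hz
    apply le_antisymm
    · exact Complex.norm_le_norm_of_mapsTo_ball hφ
        (mφ.mono_right Metric.ball_subset_closedBall) h0 (by simpa using hz)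
    · have := Complex.norm_le_norm_of_mapsTo_ball hψ
        (mψ.mono_right Metric.ball_subset_closedBall) p0 (z := φ z) (by simpa using mφ hz)
      rwa [hl z hz] at this
  have hd0 : DifferentiableAt ℂ φ 0 := hφ.differentiableAt (Metric.ball_mem_nhds _ one_pos)
  have hL : ∀ z ∈ Metric.ball (0:E) 1, φ z = fderiv ℂ φ 0 z := by
    intro z hz
    by_cases hz0 : z = 0
    · simp [hz0, h0]
    have hr : 0 < ‖z‖ := norm_pos_iff.2 hz0
    have hr1 : ‖z‖ < 1 := by simpa using hz
    set u : E := ((‖z‖ : ℂ)⁻¹) • z with hu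
    have hrc : (‖z‖ : ℂ) ≠ 0 := by exact_mod_cast hr.ne'
    have hzu : (‖z‖ : ℂ) • u = z := by rw [hu, smul_smul, mul_inv_cancel₀ hrc, one_smul]
    have hun : ‖u‖ = 1 := by rw [hu, norm_smul]; simp [hr.ne']
    let c : ℂ → E := fun ζ => φ (ζ • u)
    have mc : Set.MapsTo (fun ζ : ℂ => ζ • u) (Metric.ball 0 1) (Metric.ball 0 1) := by
      intro ζ hζ
      simpa [norm_smul, hun] using hζ
    have dc : DifferentiableOn ℂ c (Metric.ball 0 1) :=
      hφ.comp (by fun_prop) mc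
    have c0 : c 0 = 0 := by simp [c, h0]
    have mcc : Set.MapsTo c (Metric.ball 0 1) (Metric.closedBall (c 0) 1) := by
      rw [c0]
      exact (mφ.comp mc).mono_right Metric.ball_subset_closedBall
    have hrm : (‖z‖ : ℂ) ∈ Metric.ball (0:ℂ) 1 := by simpa using hr1
    have hds : dslope c 0 (‖z‖ : ℂ) = (‖z‖ : ℂ)⁻¹ • φ z := by
      rw [dslope_of_ne _ hrc, slope_def_module, c0]
      simp [c, hzu]
    have heq := Complex.affine_of_mapsTo_ball_of_norm_dslope_eq_div dc mcc hrm (by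
      rw [hds, norm_smul, hn z hz]; simp [hr.ne'])
    rw [hds] at heq
    simp only [c0, zero_add, sub_zero] at heq
    have hder1 : HasDerivAt c (fderiv ℂ φ 0 u) 0 := by
      have h1 : HasFDerivAt φ (fderiv ℂ φ 0) ((0:ℂ) • u) := by simpa using hd0.hasFDerivAt
      have h2 : HasDerivAt (fun ζ : ℂ => ζ • u) u 0 := by
        simpa using (hasDerivAt_id (0:ℂ)).smul_const u
      exact h1.comp_hasDerivAt 0 h2
    have hder2 : HasDerivAt c ((‖z‖ : ℂ)⁻¹ • φ z) 0 := by
      have h2 : HasDerivAt (fun ζ : ℂ => ζ • ((‖z‖ : ℂ)⁻¹ • φ z)) ((‖z‖ : ℂ)⁻¹ • φ z) 0 := by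
        simpa using (hasDerivAt_id (0:ℂ)).smul_const ((‖z‖ : ℂ)⁻¹ • φ z)
      refine h2.congr_of_eventuallyEq ?_
      filter_upwards [Metric.ball_mem_nhds (0:ℂ) one_pos] with w hw using heq hw
    have := hder1.unique hder2
    conv_rhs => rw [← hzu, map_smul, this, smul_smul, mul_inv_cancel₀ hrc, one_smul]
  refine ⟨(fderiv ℂ φ 0 : E →ₗ[ℂ] E), hL, ?_⟩
  intro z
  set t : ℝ := (‖z‖ + 1)⁻¹
  have ht : 0 < t := by positivity
  have hm : (t : ℂ) • z ∈ Metric.ball (0:E) 1 := by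
    rw [mem_ball_zero_iff, norm_smul, Complex.norm_real, Real.norm_of_nonneg ht.le]
    simp only [t]
    rw [inv_mul_lt_one₀ (by positivity)]; linarith
  have h1 := hn _ hm
  rw [hL _ hm, map_smul, norm_smul, norm_smul] at h1
  have : ‖(t:ℂ)‖ ≠ 0 := by simpa using ht.ne'
  exact mul_left_cancel₀ this h1

def auxQ {n : ℕ} (v : Fin (n+1) → ℂ) : ℝ := -‖v 0‖ ^ 2 + ∑ i : Fin n, ‖v i.succ‖ ^ 2

def auxHom {n : ℕ} (z : Fin n → ℂ) : Fin (n+1) → ℂ := Fin.cons 1 z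

lemma auxQ_eq {n : ℕ} (v : Fin (n+1) → ℂ) : star v ⬝ᵥ (Jn1 n *ᵥ v) = (auxQ v : ℂ) := by
  simp only [dotProduct, Jn1, Matrix.mulVec_diagonal, Fin.sum_univ_succ, auxQ, Fin.succ_ne_zero,
    if_true, if_false, Pi.star_apply]
  push_cast
  simp only [← Complex.conj_mul', Complex.star_def]
  congr 1
  · ring
  · exact Finset.sum_congr rfl fun i _ => by ring

lemma auxQ_mulVec {n : ℕ} {A : Matrix (Fin (n+1)) (Fin (n+1)) ℂ} (hA : Aᴴ * Jn1 n * A = Jn1 n)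
    (v : Fin (n+1) → ℂ) : auxQ (A *ᵥ v) = auxQ v := by
  have : ((auxQ (A *ᵥ v) : ℝ) : ℂ) = (auxQ v : ℂ) := by
    rw [← auxQ_eq, ← auxQ_eq, Matrix.star_mulVec, ← Matrix.dotProduct_mulVec,
      Matrix.mulVec_mulVec, Matrix.mulVec_mulVec, hA]
  exact_mod_cast this

lemma auxQ_hom {n : ℕ} (z : Fin n → ℂ) : auxQ (auxHom z) < 0 ↔ z ∈ balln n := by
  simp only [auxQ, auxHom, balln, Fin.cons_zero, Fin.cons_succ, Set.mem_ofPred_eq]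
  norm_num

lemma auxQ_smul {n : ℕ} (c : ℂ) (v : Fin (n+1) → ℂ) : auxQ (c • v) = ‖c‖ ^ 2 * auxQ v := by
  simp only [auxQ, Pi.smul_apply, smul_eq_mul, norm_mul, mul_pow, ← Finset.mul_sum]
  ring

lemma auxQ_neg {n : ℕ} {v : Fin (n+1) → ℂ} (hv : auxQ v < 0) : v 0 ≠ 0 := by
  intro h
  have : 0 ≤ ∑ i : Fin n, ‖v i.succ‖ ^ 2 := by positivity
  simp only [auxQ, h] at hv
  norm_num at hv
  linarith

def auxAct {n : ℕ} (A : Matrix (Fin (n+1)) (Fin (n+1)) ℂ) (z : Fin n → ℂ) : Fin n → ℂ :=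
  fun i => (A *ᵥ auxHom z) i.succ / (A *ᵥ auxHom z) 0

lemma auxDen_ne {n : ℕ} {A : Matrix (Fin (n+1)) (Fin (n+1)) ℂ} (hA : Aᴴ * Jn1 n * A = Jn1 n)
    {z : Fin n → ℂ} (hz : z ∈ balln n) : (A *ᵥ auxHom z) 0 ≠ 0 := by
  apply auxQ_neg
  rw [auxQ_mulVec hA, auxQ_hom]; exact hz

lemma auxHom_act {n : ℕ} {A : Matrix (Fin (n+1)) (Fin (n+1)) ℂ} (hA : Aᴴ * Jn1 n * A = Jn1 n)
    {z : Fin n → ℂ} (hz : z ∈ balln n) :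
    A *ᵥ auxHom z = (A *ᵥ auxHom z) 0 • auxHom (auxAct A z) := by
  have := auxDen_ne hA hz
  funext i
  refine Fin.cases ?_ (fun i => ?_) i
  · simp [auxHom]
  · simp only [auxHom, auxAct, Pi.smul_apply, Fin.cons_succ, smul_eq_mul]
    exact (mul_div_cancel₀ _ this).symm

lemma auxAct_mem {n : ℕ} {A : Matrix (Fin (n+1)) (Fin (n+1)) ℂ} (hA : Aᴴ * Jn1 n * A = Jn1 n)
    {z : Fin n → ℂ} (hz : z ∈ balln n) : auxAct A z ∈ balln n := by
  have h0 := auxDen_ne hA hz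
  have h1 := (auxQ_hom z).2 hz
  rw [← auxQ_mulVec hA, auxHom_act hA hz, auxQ_smul] at h1
  rw [← auxQ_hom]
  have : 0 < ‖(A *ᵥ auxHom z) 0‖ ^ 2 := by positivity
  by_contra hcon
  push Not at hcon
  nlinarith [mul_nonneg this.le hcon]

lemma auxAct_eq {n : ℕ} {A : Matrix (Fin (n+1)) (Fin (n+1)) ℂ} {z w : Fin n → ℂ} {c : ℂ}
    (hc : c ≠ 0) (h : A *ᵥ auxHom z = c • auxHom w) : auxAct A z = w := by
  funext i
  simp only [auxAct, h]
  simp only [auxHom, Pi.smul_apply, Fin.cons_succ, Fin.cons_zero, smul_eq_mul, mul_one]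
  field_simp

lemma auxAct_invol {n : ℕ} {A : Matrix (Fin (n+1)) (Fin (n+1)) ℂ} (hA : Aᴴ * Jn1 n * A = Jn1 n)
    (hAA : A * A = 1) {z : Fin n → ℂ} (hz : z ∈ balln n) : auxAct A (auxAct A z) = z := by
  have h0 := auxDen_ne hA hz
  refine auxAct_eq (inv_ne_zero h0) ?_
  have h1 := congrArg (fun v => A *ᵥ v) (auxHom_act hA hz)
  simp only [Matrix.mulVec_mulVec, hAA, Matrix.one_mulVec, Matrix.mulVec_smul] at h1
  rw [eq_inv_smul_iff₀ h0]
  exact h1.symm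

lemma auxAct_diff {n : ℕ} {A : Matrix (Fin (n+1)) (Fin (n+1)) ℂ} (hA : Aᴴ * Jn1 n * A = Jn1 n) :
    DifferentiableOn ℂ (auxAct A) (balln n) := by
  have hh : ∀ i, Differentiable ℂ (fun z : Fin n → ℂ => (A *ᵥ auxHom z) i) := by
    intro i
    simp only [Matrix.mulVec, dotProduct, Fin.sum_univ_succ, auxHom, Fin.cons_zero, Fin.cons_succ]
    fun_prop
  rw [differentiableOn_pi]
  intro i
  simp only [auxAct, div_eq_mul_inv]
  exact (hh i.succ).differentiableOn.mul
    ((hh 0).differentiableOn.inv fun z hz => auxDen_ne hA hz)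

lemma auxTrans {n : ℕ} {p : Fin n → ℂ} (hp : p ∈ balln n) :
    ∃ M : Matrix (Fin (n+1)) (Fin (n+1)) ℂ, Mᴴ * Jn1 n * M = Jn1 n ∧ M * M = 1 ∧
      auxAct M 0 = p := by
  have hp' : ∑ i : Fin n, ‖p i‖ ^ 2 < 1 := hp
  set s : ℝ := √(1 - ∑ i : Fin n, ‖p i‖ ^ 2) with hs
  have hs2 : s ^ 2 = 1 - ∑ i : Fin n, ‖p i‖ ^ 2 := Real.sq_sqrt (by linarith)
  have hs0 : 0 < s := Real.sqrt_pos.2 (by linarith)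
  have hsc : (s : ℂ) ≠ 0 := by exact_mod_cast hs0.ne'
  have hsc1 : (1 + s : ℂ) ≠ 0 := by
    have : (1 + s : ℝ) ≠ 0 := by positivity
    exact_mod_cast this
  let u : Fin (n+1) → ℂ := Fin.cons (1 + s : ℂ) p
  let c : ℝ := (s * (1 + s))⁻¹
  have hu : star u ⬝ᵥ (Jn1 n *ᵥ u) = (-2 * s * (1 + s) : ℝ) := by
    rw [auxQ_eq]
    congr 1
    have h1 : ‖(1 + s : ℂ)‖ = 1 + s := by
      have : ((1 + s : ℝ) : ℂ) = 1 + s := by push_cast; rfl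
      rw [← this, Complex.norm_real, Real.norm_of_nonneg (by positivity)]
    simp only [auxQ, u, Fin.cons_zero, Fin.cons_succ, h1]
    linarith
  have hcu : (c : ℂ) * (star u ⬝ᵥ (Jn1 n *ᵥ u)) = -2 := by
    rw [hu]
    simp only [c]
    push_cast
    field_simp
  have hJ : (Jn1 n)ᴴ = Jn1 n := by
    simp only [Jn1, Matrix.diagonal_conjTranspose]
    congr 1
    funext i
    by_cases h : i = 0 <;> simp [h]
  -- the rank one matrix
  let P : Matrix (Fin (n+1)) (Fin (n+1)) ℂ := Matrix.vecMulVec u (star u)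
  have hPJP : P * Jn1 n * P = (star u ⬝ᵥ (Jn1 n *ᵥ u)) • P := by
    simp only [P]
    rw [Matrix.vecMulVec_mul, Matrix.vecMulVec_mul_vecMulVec, Matrix.dotProduct_mulVec,
      Matrix.vecMulVec_smul]
  have hPH : Pᴴ = P := by simp [P, Matrix.conjTranspose_vecMulVec]
  have hcc : star (c : ℂ) = c := by simp
  have hPJP' : ((c : ℂ) * (c : ℂ)) • (P * Jn1 n * P) = (-2 * (c:ℂ)) • P := by
    rw [hPJP, smul_smul, ← hcu]; congr 1; ring
  refine ⟨1 + (c : ℂ) • (P * Jn1 n), ?_, ?_, ?_⟩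
  · simp only [Matrix.conjTranspose_add, Matrix.conjTranspose_one, Matrix.conjTranspose_smul,
      Matrix.conjTranspose_mul, hJ, hPH, hcc]
    have : (1 + (c:ℂ) • (Jn1 n * P)) * Jn1 n * (1 + (c:ℂ) • (P * Jn1 n)) =
        Jn1 n + (2 * (c:ℂ)) • (Jn1 n * P * Jn1 n)
          + Jn1 n * (((c : ℂ) * (c : ℂ)) • (P * Jn1 n * P)) * Jn1 n := by
      simp only [add_mul, mul_add, one_mul, mul_one, Matrix.smul_mul, Matrix.mul_smul, smul_smul,
        Matrix.mul_assoc, two_mul, add_smul]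
      abel
    rw [this, hPJP']
    rw [Matrix.mul_smul, Matrix.smul_mul, neg_mul, neg_smul]
    abel
  · have : (1 + (c:ℂ) • (P * Jn1 n)) * (1 + (c:ℂ) • (P * Jn1 n)) =
        1 + (2 * (c:ℂ)) • (P * Jn1 n)
          + (((c : ℂ) * (c : ℂ)) • (P * Jn1 n * P)) * Jn1 n := by
      simp only [add_mul, mul_add, one_mul, mul_one, Matrix.smul_mul, Matrix.mul_smul, smul_smul,
        Matrix.mul_assoc, two_mul, add_smul]
      abel
    rw [this, hPJP']
    simp only [Matrix.smul_mul, neg_mul, neg_smul]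
    abel
  · refine auxAct_eq (c := -(s : ℂ)⁻¹) (by simpa using hsc) ?_
    have hd : star u ⬝ᵥ (Jn1 n *ᵥ auxHom 0) = -(1 + s : ℂ) := by
      simp [dotProduct, Jn1, Matrix.mulVec_diagonal, Fin.sum_univ_succ, auxHom, u]
    have hPv : (P * Jn1 n) *ᵥ auxHom 0 = (-(1 + s : ℂ)) • u := by
      rw [← Matrix.mulVec_mulVec]
      simp only [P]
      rw [Matrix.vecMulVec_mulVec, hd, op_smul_eq_smul]
    rw [Matrix.add_mulVec, Matrix.one_mulVec, Matrix.smul_mulVec, hPv]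
    funext i
    refine Fin.cases ?_ (fun i => ?_) i
    · simp only [auxHom, u, c, Pi.add_apply, Pi.smul_apply, Fin.cons_zero, smul_eq_mul]
      push_cast
      field_simp
      ring
    · simp only [auxHom, u, c, Pi.add_apply, Pi.smul_apply, Fin.cons_succ, smul_eq_mul]
      push_cast
      field_simp
      simp

lemma aux_mem_ball {n : ℕ} (x : EuclideanSpace ℂ (Fin n)) :
    x ∈ Metric.ball (0 : EuclideanSpace ℂ (Fin n)) 1 ↔ WithLp.ofLp x ∈ balln n := by
  rw [mem_ball_zero_iff, ← sq_lt_one_iff₀ (norm_nonneg x), EuclideanSpace.norm_sq_eq]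
  rfl

lemma aux_unitary {n : ℕ} {φ ψ : (Fin n → ℂ) → (Fin n → ℂ)}
    (hφ : DifferentiableOn ℂ φ (balln n)) (hψ : DifferentiableOn ℂ ψ (balln n))
    (mφ : Set.MapsTo φ (balln n) (balln n)) (mψ : Set.MapsTo ψ (balln n) (balln n))
    (hl : ∀ z ∈ balln n, ψ (φ z) = z) (h0 : φ 0 = 0) :
    ∃ U : Matrix (Fin n) (Fin n) ℂ, Uᴴ * U = 1 ∧ ∀ z ∈ balln n, φ z = U *ᵥ z := by
  let e := PiLp.continuousLinearEquiv 2 ℂ (fun _ : Fin n => ℂ)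
  have he : ∀ x, x ∈ Metric.ball (0 : EuclideanSpace ℂ (Fin n)) 1 ↔ e x ∈ balln n :=
    fun x => aux_mem_ball x
  have hd : ∀ {χ : (Fin n → ℂ) → (Fin n → ℂ)}, DifferentiableOn ℂ χ (balln n) →
      DifferentiableOn ℂ (fun x => e.symm (χ (e x))) (Metric.ball 0 1) := by
    intro χ hχ
    refine e.symm.differentiable.comp_differentiableOn ?_
    exact hχ.comp e.differentiable.differentiableOn fun x hx => (he x).1 hx
  have hm : ∀ {χ : (Fin n → ℂ) → (Fin n → ℂ)}, Set.MapsTo χ (balln n) (balln n) →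
      Set.MapsTo (fun x => e.symm (χ (e x))) (Metric.ball 0 1) (Metric.ball 0 1) := by
    intro χ hχ x hx
    rw [he] at hx ⊢
    simpa using hχ hx
  obtain ⟨L, hL, hLn⟩ := aux_linear (hd hφ) (hd hψ) (hm mφ) (hm mψ)
    (fun z hz => by simp [hl _ ((he z).1 hz)]) (by simp [h0])
  let Li : EuclideanSpace ℂ (Fin n) →ₗᵢ[ℂ] EuclideanSpace ℂ (Fin n) := ⟨L, hLn⟩
  let K : (Fin n → ℂ) →ₗ[ℂ] (Fin n → ℂ) :=
    (e : EuclideanSpace ℂ (Fin n) →ₗ[ℂ] (Fin n → ℂ)) ∘ₗ L ∘ₗ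
      (e.symm : (Fin n → ℂ) →ₗ[ℂ] EuclideanSpace ℂ (Fin n))
  refine ⟨LinearMap.toMatrix' K, ?_, ?_⟩
  · ext i j
    have h1 := Li.inner_map_map (EuclideanSpace.single i 1) (EuclideanSpace.single j 1)
    have hK : ∀ i j, LinearMap.toMatrix' K i j = (L (EuclideanSpace.single j 1)) i := by
      intro i j
      rw [LinearMap.toMatrix'_apply]
      rfl
    rw [Matrix.mul_apply]
    simp only [Matrix.conjTranspose_apply, hK]
    have h2 : inner ℂ (EuclideanSpace.single i (1:ℂ)) (EuclideanSpace.single j (1:ℂ))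
        = (1 : Matrix (Fin n) (Fin n) ℂ) i j := by
      simp [Matrix.one_apply, EuclideanSpace.inner_single_left, Pi.single_apply]
    rw [← h2, ← h1, PiLp.inner_apply]
    refine Finset.sum_congr rfl fun k _ => ?_
    simp [Li, mul_comm]
  · intro z hz
    have h1 := hL (e.symm z) ((he _).2 (by simpa using hz))
    rw [← Matrix.toLin'_apply, Matrix.toLin'_toMatrix']
    have h2 := congrArg e h1
    simpa [K] using h2

lemma aux_blockJ {n : ℕ} {U : Matrix (Fin n) (Fin n) ℂ} (hU : Uᴴ * U = 1) :
    ∃ B : Matrix (Fin (n+1)) (Fin (n+1)) ℂ, Bᴴ * Jn1 n * B = Jn1 n ∧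
      ∀ z, B *ᵥ auxHom z = auxHom (U *ᵥ z) := by
  refine ⟨Matrix.of (Fin.cons (Fin.cons 1 0) (fun i => Fin.cons 0 (U i))), ?_, ?_⟩
  · have hU' : ∀ i j, ∑ k, star (U k i) * U k j = if i = j then 1 else 0 := by
      intro i j
      have := congrFun (congrFun hU i) j
      simpa [Matrix.mul_apply, Matrix.one_apply] using this
    ext i j
    rw [Matrix.mul_apply]
    simp only [Jn1, Matrix.mul_diagonal]
    refine Fin.cases ?_ (fun i => ?_) i <;> refine Fin.cases ?_ (fun j => ?_) j
    · simp [Fin.sum_univ_succ]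
    · simp [Fin.sum_univ_succ, Matrix.diagonal_apply, (Fin.succ_ne_zero _).symm]
    · simp [Fin.sum_univ_succ, Matrix.diagonal_apply]
    · simpa [Fin.sum_univ_succ, Matrix.diagonal_apply] using hU' i j
  · intro z
    funext i
    refine Fin.cases ?_ (fun i => ?_) i
    · simp [Matrix.mulVec, dotProduct, Fin.sum_univ_succ, auxHom]
    · simp [Matrix.mulVec, dotProduct, Fin.sum_univ_succ, auxHom]

lemma aux_normalize {n : ℕ} {C : Matrix (Fin (n+1)) (Fin (n+1)) ℂ}
    (hC : Cᴴ * Jn1 n * C = Jn1 n) :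
    ∃ μ : ℂ, μ ≠ 0 ∧ (μ • C)ᴴ * Jn1 n * (μ • C) = Jn1 n ∧ (μ • C).det = 1 := by
  have hJ : (Jn1 n).det ≠ 0 := by
    simp only [Jn1, Matrix.det_diagonal]
    refine Finset.prod_ne_zero_iff.2 fun i _ => ?_
    split_ifs <;> norm_num
  have hd : star C.det * C.det = 1 := by
    have := congrArg Matrix.det hC
    rw [Matrix.det_mul, Matrix.det_mul, Matrix.det_conjTranspose] at this
    apply mul_right_cancel₀ hJ
    linear_combination this
  have hd0 : C.det ≠ 0 := right_ne_zero_of_mul_eq_one hd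
  have hnorm : ‖C.det‖ = 1 := by
    have := congrArg norm hd
    rw [norm_mul, norm_star, norm_one] at this
    nlinarith [norm_nonneg C.det]
  obtain ⟨μ, hμ⟩ := IsAlgClosed.exists_pow_nat_eq (C.det)⁻¹ (Nat.succ_pos n)
  have hμn : ‖μ‖ = 1 := by
    have := congrArg norm hμ
    rw [norm_pow, norm_inv, hnorm, inv_one] at this
    exact (pow_eq_one_iff_of_nonneg (norm_nonneg _) (Nat.succ_ne_zero n)).1 this
  have hμs : star μ * μ = 1 := by
    rw [Complex.star_def, Complex.conj_mul', hμn]; norm_num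
  refine ⟨μ, right_ne_zero_of_mul_eq_one hμs, ?_, ?_⟩
  · rw [Matrix.conjTranspose_smul, Matrix.smul_mul, Matrix.smul_mul, Matrix.mul_smul, smul_smul,
      hμs, one_smul, hC]
  · rw [Matrix.det_smul, Fintype.card_fin]
    have : μ ^ (n + 1) = (C.det)⁻¹ := hμ
    rw [this, inv_mul_cancel₀ hd0]

lemma aux_autBall {n : ℕ} {T S : (Fin n → ℂ) → (Fin n → ℂ)}
    (hT : DifferentiableOn ℂ T (balln n)) (hS : DifferentiableOn ℂ S (balln n))
    (mT : Set.MapsTo T (balln n) (balln n)) (mS : Set.MapsTo S (balln n) (balln n))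
    (hl : ∀ z ∈ balln n, S (T z) = z) :
    ∃ A : Matrix (Fin (n+1)) (Fin (n+1)) ℂ, Aᴴ * Jn1 n * A = Jn1 n ∧ A.det = 1 ∧
      ∀ z ∈ balln n, T z = auxAct A z := by
  have z0 : (0 : Fin n → ℂ) ∈ balln n := by simp [balln]
  obtain ⟨M, hM, hMM, hM0⟩ := auxTrans (mT z0)
  have mM : Set.MapsTo (auxAct M) (balln n) (balln n) := fun z hz => auxAct_mem hM hz
  have dM := auxAct_diff hM
  obtain ⟨U, hU, hφ⟩ := aux_unitary (φ := auxAct M ∘ T) (ψ := S ∘ auxAct M)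
    (dM.comp hT mT) (hS.comp dM mM) (mM.comp mT) (mS.comp mM)
    (fun z hz => by
      simp only [Function.comp_apply]
      rw [auxAct_invol hM hMM (mT hz), hl z hz])
    (by
      simp only [Function.comp_apply]
      rw [← hM0, auxAct_invol hM hMM z0])
  obtain ⟨B, hB, hBz⟩ := aux_blockJ hU
  have hC : (M * B)ᴴ * Jn1 n * (M * B) = Jn1 n := by
    rw [Matrix.conjTranspose_mul]
    calc _ = Bᴴ * (Mᴴ * Jn1 n * M) * B := by simp only [Matrix.mul_assoc]
      _ = _ := by rw [hM, hB]
  obtain ⟨μ, hμ, hA, hdet⟩ := aux_normalize hC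
  refine ⟨μ • (M * B), hA, hdet, fun z hz => ?_⟩
  have hw : U *ᵥ z ∈ balln n := by rw [← hφ z hz]; exact mM (mT hz)
  have hTz : T z = auxAct M (U *ᵥ z) := by
    rw [← hφ z hz]
    exact (auxAct_invol hM hMM (mT hz)).symm
  symm
  refine auxAct_eq (c := μ * (M *ᵥ auxHom (U *ᵥ z)) 0) (mul_ne_zero hμ (auxDen_ne hM hw)) ?_
  rw [Matrix.smul_mulVec, ← Matrix.mulVec_mulVec, hBz, mul_smul, hTz, ← auxHom_act hM hw]

lemma aux_isOpen_balln (n : ℕ) : IsOpen (balln n) := by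
  apply isOpen_lt <;> fun_prop

lemma aux_isOpen_CBall (n : ℕ) : IsOpen (CBall n) :=
  (aux_isOpen_balln n).preimage continuous_snd

lemma aux_slice {n : ℕ} {f : ℂ × (Fin n → ℂ) → ℂ × (Fin n → ℂ)}
    (hf : DifferentiableOn ℂ f (CBall n)) {z : Fin n → ℂ} (hz : z ∈ balln n) :
    Differentiable ℂ (fun t : ℂ => f (t, z)) := by
  intro t
  have h1 : DifferentiableAt ℂ f (t, z) := hf.differentiableAt ((aux_isOpen_CBall n).mem_nhds hz)
  exact h1.comp t (by fun_prop)

lemma aux_snd {n : ℕ} {f : ℂ × (Fin n → ℂ) → ℂ × (Fin n → ℂ)}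
    (hfm : Set.MapsTo f (CBall n) (CBall n))
    (hf : DifferentiableOn ℂ f (CBall n)) {z : Fin n → ℂ} (hz : z ∈ balln n) (t : ℂ) :
    (f (t, z)).2 = (f (0, z)).2 := by
  have hd : Differentiable ℂ (fun t : ℂ => (f (t, z)).2) := (aux_slice hf hz).snd
  refine hd.apply_eq_apply_of_bounded ?_ t 0
  refine (Metric.isBounded_closedBall (x := (0 : Fin n → ℂ)) (r := 1)).subset ?_
  rintro _ ⟨t, rfl⟩
  have h1 : ∑ i, ‖(f (t, z)).2 i‖ ^ 2 < 1 := hfm (x := (t, z)) hz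
  rw [mem_closedBall_zero_iff, pi_norm_le_iff_of_nonneg zero_le_one]
  intro i
  have h2 : ‖(f (t, z)).2 i‖ ^ 2 ≤ ∑ i, ‖(f (t, z)).2 i‖ ^ 2 :=
    Finset.single_le_sum (f := fun i => ‖(f (t, z)).2 i‖ ^ 2) (fun _ _ => by positivity)
      (Finset.mem_univ i)
  nlinarith [norm_nonneg ((f (t, z)).2 i)]

lemma aux_base {n : ℕ} {f : ℂ × (Fin n → ℂ) → ℂ × (Fin n → ℂ)}
    (hf : DifferentiableOn ℂ f (CBall n)) (t : ℂ) :
    DifferentiableOn ℂ (fun z => f (t, z)) (balln n) :=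
  hf.comp (by fun_prop) fun _ hz => hz

/-- Every automorphism `f = (f_0, f_1, …, f_n)` of `ℂ × 𝔹^n` has the
form `f_0(z_0, z') = a(z') z_0 + b(z')`, `(f_1,…,f_n)(z_0,z') = T(z')`, where `a` is a
nowhere vanishing holomorphic function on `𝔹^n`, `b` is holomorphic on `𝔹^n`, and `T`
is the fractional linear transformation of `𝔹^n` induced by a matrix in `SU(n,1)`. -/
theorem aut_CBall_form (n : ℕ) (f g : ℂ × (Fin n → ℂ) → ℂ × (Fin n → ℂ))
    (hfm : Set.MapsTo f (CBall n) (CBall n)) (hgm : Set.MapsTo g (CBall n) (CBall n))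
    (hinv : Set.InvOn g f (CBall n) (CBall n))
    (hf : DifferentiableOn ℂ f (CBall n)) (hg : DifferentiableOn ℂ g (CBall n)) :
    ∃ (a b : (Fin n → ℂ) → ℂ) (A : Matrix (Fin (n+1)) (Fin (n+1)) ℂ),
      DifferentiableOn ℂ a (balln n) ∧ (∀ z' ∈ balln n, a z' ≠ 0) ∧
      DifferentiableOn ℂ b (balln n) ∧
      Aᴴ * Jn1 n * A = Jn1 n ∧ A.det = 1 ∧
      ∀ z ∈ CBall n,
        (f z).1 = a z.2 * z.1 + b z.2 ∧
        ∀ i : Fin n, (f z).2 i =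
          (A i.succ 0 + ∑ j : Fin n, A i.succ j.succ * z.2 j) /
            (A 0 0 + ∑ j : Fin n, A 0 j.succ * z.2 j) := by
  have T1 : ∀ z ∈ balln n, ∀ t, (f (t, z)).2 = (f (0, z)).2 := fun z hz t => aux_snd hfm hf hz t
  have S1 : ∀ z ∈ balln n, ∀ t, (g (t, z)).2 = (g (0, z)).2 := fun z hz t => aux_snd hgm hg hz t
  have mT : ∀ z ∈ balln n, ∀ t, (f (t, z)).2 ∈ balln n := fun z hz t => hfm (x := (t, z)) hz
  have mS : ∀ z ∈ balln n, ∀ t, (g (t, z)).2 ∈ balln n := fun z hz t => hgm (x := (t, z)) hz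
  have gf : ∀ z ∈ balln n, ∀ t, g (f (t, z)) = (t, z) := fun z hz t => hinv.1 (show (t, z) ∈ CBall n from hz)
  have fg : ∀ z ∈ balln n, ∀ t, f (g (t, z)) = (t, z) := fun z hz t => hinv.2 (show (t, z) ∈ CBall n from hz)
  have hST : ∀ z ∈ balln n, (g (0, (f (0, z)).2)).2 = z := by
    intro z hz
    rw [← S1 _ (mT z hz 0) (f (0, z)).1, Prod.mk.eta, gf z hz]
  obtain ⟨A, hA, hdet, hTA⟩ := aux_autBall (T := fun z => (f (0, z)).2) (S := fun z => (g (0, z)).2)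
    (aux_base hf 0).snd (aux_base hg 0).snd (fun z hz => mT z hz 0) (fun z hz => mS z hz 0) hST
  refine ⟨fun z => (f (1, z)).1 - (f (0, z)).1, fun z => (f (0, z)).1, A,
    (aux_base hf 1).fst.sub (aux_base hf 0).fst, ?_, (aux_base hf 0).fst, hA, hdet, ?_⟩
  · intro z hz h
    have h1 : f (1, z) = f (0, z) := Prod.ext (sub_eq_zero.1 h) (T1 z hz 1)
    have h2 := gf z hz 1
    rw [h1, gf z hz 0] at h2
    simpa using congrArg Prod.fst h2
  · rintro ⟨t, z⟩ hz
    have hz : z ∈ balln n := hz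
    constructor
    · have hw := mT z hz 0
      refine aux_affine (h := fun t => (f (t, z)).1) (k := fun t => (g (t, (f (0, z)).2)).1)
        (aux_slice hf hz).fst (aux_slice hg hw).fst ?_ ?_ t
      · intro s
        have h1 : (g (s, (f (0, z)).2)).2 = z := by rw [S1 _ hw, hST z hz]
        have h2 : ((g (s, (f (0, z)).2)).1, z) = g (s, (f (0, z)).2) := Prod.ext rfl h1.symm
        simp only [h2]
        rw [fg _ hw]
      · intro s
        have h2 : ((f (s, z)).1, (f (0, z)).2) = f (s, z) := Prod.ext rfl (T1 z hz s).symm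
        simp only [h2]
        rw [gf _ hz]
    · intro i
      have h1 : (f (t, z)).2 i = auxAct A z i := by
        rw [T1 z hz t]
        exact congrFun (hTA z hz) i
      refine h1.trans ?_
      simp [auxAct, Matrix.mulVec, dotProduct, Fin.sum_univ_succ, auxHom]

end
end

section
/- For p > 1 and q > 0, the automorphism group of the domain D^{p,q} is isomorphic to GU(p,q): every biholomorphic self-map of D^{p,q} is the restriction of a linear map belonging to GU(p,q). -/
open scoped Matrix

noncomputable section

/-- The domain `D^{p,q} = {z ∈ ℂ^{p+q} : -Σ_{i≤q} |z_i|² + Σ_{i>q} |z_i|² > 0}`. -/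
def Dpq (p q : ℕ) : Set (Fin (p+q) → ℂ) :=
  {z | 0 < ∑ i : Fin (p+q), (if (i : ℕ) < q then (-1 : ℝ) else 1) * ‖z i‖ ^ 2}

/-- Membership in `GU(p,q)`: `Aᴴ J A = ν J` for some positive real `ν`. -/
def memGU (p q : ℕ) (A : Matrix (Fin (p+q)) (Fin (p+q)) ℂ) : Prop :=
  ∃ ν : ℝ, 0 < ν ∧ Aᴴ * Jmat p q * A = (ν : ℂ) • Jmat p q

section helpers

open Set Filter Topology MeasureTheory

theorem entire_zero_of_real {u : ℂ → ℂ} (hu : Differentiable ℂ u) (h : ∀ x : ℝ, u x = 0) (w : ℂ) :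
    u w = 0 := by
  have h1 : AnalyticOnNhd ℂ u univ := fun x _ => hu.analyticAt x
  have h2 : AnalyticOnNhd ℂ (fun _ : ℂ => (0:ℂ)) univ := fun x _ => analyticAt_const
  have hfr : ∃ᶠ z in 𝓝[≠] (0:ℂ), u z = 0 := by
    have ht : Tendsto (fun x : ℝ => (x : ℂ)) (𝓝[≠] 0) (𝓝[≠] (0:ℂ)) := by
      refine tendsto_nhdsWithin_iff.2 ⟨?_, ?_⟩
      · exact (Complex.continuous_ofReal.tendsto' 0 0 (by simp)).mono_left nhdsWithin_le_nhds
      · filter_upwards [self_mem_nhdsWithin] with x hx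
        simpa using hx
    exact ht.frequently (Frequently.of_forall h)
  exact congrFun (h1.eq_of_frequently_eq h2 hfr) w

theorem entire_eq_of_eventually {E : Type*} [NormedAddCommGroup E] [NormedSpace ℂ E] [CompleteSpace E]
    {u v : ℂ → E} (hu : Differentiable ℂ u) (hv : Differentiable ℂ v) {t : ℂ}
    (h : ∀ᶠ x in 𝓝 t, u x = v x) (w : ℂ) : u w = v w := by
  have h1 : AnalyticOnNhd ℂ u univ := fun x _ => hu.analyticAt x
  have h2 : AnalyticOnNhd ℂ v univ := fun x _ => hv.analyticAt x
  exact congrFun (h1.eq_of_eventuallyEq h2 h) w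

theorem differentiableAt_param {E : Type*} [NormedAddCommGroup E] [NormedSpace ℂ E] [CompleteSpace E]
    {k : ℂ → ℝ → E} {U : Set ℂ} (hU : IsOpen U) {t0 : ℂ} (ht0 : t0 ∈ U)
    (hc : ContinuousOn (Function.uncurry k) (U ×ˢ univ))
    (hd : ∀ θ, DifferentiableOn ℂ (fun t => k t θ) U) (a b : ℝ) :
    DifferentiableAt ℂ (fun t => ∫ θ in a..b, k t θ) t0 := by
  obtain ⟨r, hr, hrU⟩ := Metric.isOpen_iff.1 hU t0 ht0
  have hsub : Metric.closedBall t0 (r/2) ⊆ U :=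
    (Metric.closedBall_subset_ball (by linarith)).trans hrU
  have hK : IsCompact (Metric.closedBall t0 (r/2) ×ˢ uIcc a b) :=
    (isCompact_closedBall _ _).prod isCompact_uIcc
  obtain ⟨M, hM⟩ := hK.exists_bound_of_continuousOn
    (hc.mono (prod_mono hsub (subset_univ _)))
  have hkc : ∀ t ∈ U, Continuous (k t) := by
    intro t ht
    have : ContinuousOn (fun θ : ℝ => Function.uncurry k (t, θ)) univ :=
      hc.comp (by fun_prop) (fun θ _ => ⟨ht, mem_univ _⟩)
    exact continuousOn_univ.1 this
  have hs : Metric.ball t0 (r/4) ∈ 𝓝 t0 := Metric.ball_mem_nhds _ (by linarith)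
  have hmem : ∀ t ∈ Metric.ball t0 (r/4), t ∈ U := fun t ht =>
    hrU (Metric.ball_subset_ball (by linarith) ht)
  have hder : ∀ θ, ∀ t ∈ U, HasDerivAt (fun t => k t θ) (deriv (fun t => k t θ) t) t :=
    fun θ t ht => ((hd θ).differentiableAt (hU.mem_nhds ht)).hasDerivAt
  refine (intervalIntegral.hasDerivAt_integral_of_dominated_loc_of_deriv_le (𝕜 := ℂ) (μ := volume)
    (F := k) (F' := fun t θ => deriv (fun t => k t θ) t) (bound := fun _ => M / (r/4))
    hs ?_ ?_ ?_ ?_ ?_ ?_).2.differentiableAt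
  · filter_upwards [hs] with t ht
    exact (hkc t (hmem t ht)).aestronglyMeasurable
  · exact (hkc t0 ht0).intervalIntegrable _ _
  · have hlim : ∀ θ, Tendsto (fun n : ℕ => ((r/4 / (n+2) : ℝ) : ℂ)⁻¹ •
        (k (t0 + ((r/4 / (n+2) : ℝ) : ℂ)) θ - k t0 θ)) atTop (𝓝 (deriv (fun t => k t θ) t0)) := by
      intro θ
      have h1 := (hasDerivAt_iff_tendsto_slope_zero.1 (hder θ t0 ht0))
      refine h1.comp (tendsto_nhdsWithin_iff.2 ⟨?_, ?_⟩)
      · have h0 : Tendsto (fun n : ℕ => (r/4 / (n+2) : ℝ)) atTop (𝓝 0) := by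
          apply Tendsto.div_atTop tendsto_const_nhds
          exact tendsto_atTop_add_const_right _ _ tendsto_natCast_atTop_atTop
        exact (Complex.continuous_ofReal.tendsto' 0 0 (by simp)).comp h0
      · refine Eventually.of_forall fun n => ?_
        have : (0:ℝ) < r/4/(n+2) := by positivity
        exact Complex.ofReal_ne_zero.2 this.ne'
    refine aestronglyMeasurable_of_tendsto_ae (u := atTop) (f := fun n : ℕ => fun θ => ((r/4 / (n+2) : ℝ) : ℂ)⁻¹ •
        (k (t0 + ((r/4 / (n+2) : ℝ) : ℂ)) θ - k t0 θ)) ?_ (Eventually.of_forall hlim)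
    intro n
    refine (((hkc _ (hmem _ ?_)).sub (hkc _ ht0)).const_smul _).aestronglyMeasurable
    have h2 : (0:ℝ) < r/4/(n+2) := by positivity
    rw [Metric.mem_ball, dist_eq_norm, add_sub_cancel_left, Complex.norm_real, Real.norm_of_nonneg h2.le]
    apply div_lt_self (by linarith)
    have : (0:ℝ) ≤ n := Nat.cast_nonneg n
    linarith
  · refine Eventually.of_forall fun θ hθ t ht => ?_
    have hsub2 : Metric.closedBall t (r/4) ⊆ Metric.closedBall t0 (r/2) := by
      apply Metric.closedBall_subset_closedBall'
      have := Metric.mem_ball.1 ht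
      linarith
    refine Complex.norm_deriv_le_of_forall_mem_sphere_norm_le (by linarith) ?_ ?_
    · refine DifferentiableOn.diffContOnCl ?_
      exact (hd θ).mono ((Metric.closure_ball_subset_closedBall).trans (hsub2.trans hsub))
    · intro z hz
      exact hM (z, θ) ⟨hsub2 (Metric.sphere_subset_closedBall hz), uIoc_subset_uIcc hθ⟩
  · exact intervalIntegrable_const
  · exact Eventually.of_forall fun θ hθ t ht => hder θ t (hmem t ht)

theorem differentiable_dslope0 {E : Type*} [NormedAddCommGroup E] [NormedSpace ℂ E] [CompleteSpace E]
    {u : ℂ → E} (hu : Differentiable ℂ u) : Differentiable ℂ (dslope u 0) := by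
  have := (Complex.differentiableOn_dslope (f := u) (c := 0) (s := univ) univ_mem).2 hu.differentiableOn
  exact differentiableOn_univ.1 this

theorem entire_linear_of_inv {c d : ℂ → ℂ} (hc : Differentiable ℂ c) (hd : Differentiable ℂ d)
    (hdc : ∀ t, d (c t) = t) (hc0 : c 0 = 0) (hd0 : d 0 = 0) (hc1 : c 1 = 1) (t : ℂ) : c t = t := by
  have he := differentiable_dslope0 hc
  set e := dslope c 0 with hedef
  have hce : ∀ t, c t = t * e t := by
    intro t
    have := sub_smul_dslope c 0 t
    simp only [sub_zero, hc0, smul_eq_mul] at this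
    exact this.symm
  have hcne : ∀ t, t ≠ 0 → c t ≠ 0 := by
    intro t ht h
    apply ht
    rw [← hdc t, h, hd0]
  have hene : ∀ t, e t ≠ 0 := by
    intro t
    by_cases ht : t = 0
    · subst ht
      rw [hedef, dslope_same]
      intro h
      have h1 : HasDerivAt (d ∘ c) (deriv d (c 0) * deriv c 0) 0 :=
        (hd (c 0)).hasDerivAt.comp 0 (hc 0).hasDerivAt
      have h2 : d ∘ c = id := funext hdc
      rw [h2] at h1
      have := h1.unique (hasDerivAt_id 0)
      rw [h] at this
      simp at this
    · intro h
      apply hcne t ht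
      rw [hce, h, mul_zero]
  have hk : Differentiable ℂ (fun t => (e t)⁻¹) := he.inv hene
  obtain ⟨M, hM⟩ := (isCompact_closedBall (0:ℂ) 1).exists_bound_of_continuousOn hd.continuous.continuousOn
  have hgrow : ∀ t, M < ‖t‖ → ‖(e t)⁻¹‖ ≤ ‖t‖ := by
    intro t ht
    have h1 : 1 < ‖c t‖ := by
      by_contra hcon
      have := hM (c t) (by simpa using not_lt.1 hcon)
      rw [hdc] at this
      linarith
    rw [hce, norm_mul] at h1
    rw [norm_inv, inv_le_iff_one_le_mul₀ (norm_pos_iff.2 (hene t))]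
    exact h1.le
  have hm := differentiable_dslope0 hk
  set m := dslope (fun t => (e t)⁻¹) 0 with hmdef
  have hkm : ∀ t, (e t)⁻¹ = (e 0)⁻¹ + t * m t := by
    intro t
    have := sub_smul_dslope (fun t => (e t)⁻¹) 0 t
    simp only [sub_zero, smul_eq_mul] at this
    rw [hmdef, this]; ring
  have hmb : Bornology.IsBounded (range m) := by
    obtain ⟨B, hB⟩ := (isCompact_closedBall (0:ℂ) (max M 1)).exists_bound_of_continuousOn
      hm.continuous.continuousOn
    rw [isBounded_iff_forall_norm_le]
    refine ⟨max B (1 + ‖(e 0)⁻¹‖), ?_⟩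
    rintro _ ⟨t, rfl⟩
    by_cases ht : ‖t‖ ≤ max M 1
    · exact (hB t (by simpa using ht)).trans (le_max_left _ _)
    · push Not at ht
      refine le_trans ?_ (le_max_right _ _)
      have ht1 : 1 < ‖t‖ := (le_max_right _ _).trans_lt ht
      have h1 : ‖t‖ * ‖m t‖ ≤ ‖t‖ + ‖(e 0)⁻¹‖ := by
        rw [← norm_mul, show t * m t = (e t)⁻¹ - (e 0)⁻¹ by rw [hkm t]; ring]
        exact (norm_sub_le _ _).trans (by gcongr; exact hgrow t ((le_max_left _ _).trans_lt ht))
      have h2 : ‖t‖ * ‖m t‖ ≤ ‖t‖ * (1 + ‖(e 0)⁻¹‖) := by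
        nlinarith [norm_nonneg (e 0)⁻¹]
      exact le_of_mul_le_mul_left h2 (by linarith)
  have hmc : ∀ t, m t = m 0 := fun t => hm.apply_eq_apply_of_bounded hmb t 0
  have hm0 : m 0 = 0 := by
    by_contra hne
    have := hkm (-(e 0)⁻¹ / m 0)
    rw [hmc (-(e 0)⁻¹ / m 0), div_mul_cancel₀ _ hne, add_neg_cancel] at this
    exact inv_ne_zero (hene _) this
  have hec : ∀ t, e t = e 0 := by
    intro t
    have := hkm t
    rw [hmc, hm0, mul_zero, add_zero] at this
    exact inv_injective this
  have h1 := hce 1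
  rw [hc1, hec, one_mul] at h1
  rw [hce, hec, ← h1, mul_one]

def QN {ι : Type*} [Fintype ι] (ε : ι → ℝ) (z : ι → ℂ) : ℝ := ∑ i, ε i * ‖z i‖ ^ 2

def SN {ι : Type*} [Fintype ι] (z : ι → ℂ) : ℝ := ∑ i, ‖z i‖ ^ 2

def Ent {ι E : Type*} [Fintype ι] [NormedAddCommGroup E] [NormedSpace ℂ E] (F : (ι → ℂ) → E) : Prop :=
  ∀ φ : ℂ → (ι → ℂ), Differentiable ℂ φ → Differentiable ℂ (fun t => F (φ t))

theorem continuous_QN {ι : Type*} [Fintype ι] (ε : ι → ℝ) : Continuous (QN ε) := by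
  unfold QN; fun_prop

theorem continuous_SN {ι : Type*} [Fintype ι] : Continuous (SN (ι := ι)) := by
  unfold SN; fun_prop

theorem isOpen_QN {ι : Type*} [Fintype ι] (ε : ι → ℝ) : IsOpen {z | 0 < QN ε z} :=
  isOpen_lt continuous_const (continuous_QN ε)

theorem QN_update {ι : Type*} [Fintype ι] [DecidableEq ι] (ε : ι → ℝ) (z : ι → ℂ) (j : ι) (hj : ε j = 1)
    (s : ℂ) : QN ε (Function.update z j s) = QN ε z - ‖z j‖ ^ 2 + ‖s‖ ^ 2 := by
  unfold QN
  rw [← Finset.add_sum_erase _ _ (Finset.mem_univ j), ← Finset.add_sum_erase (a := j) _ (fun i => ε i * ‖z i‖^2) (Finset.mem_univ j)]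
  have : ∑ x ∈ Finset.univ.erase j, ε x * ‖Function.update z j s x‖ ^ 2
      = ∑ x ∈ Finset.univ.erase j, ε x * ‖z x‖ ^ 2 := by
    apply Finset.sum_congr rfl
    intro x hx
    rw [Function.update_of_ne (Finset.ne_of_mem_erase hx)]
  rw [this, hj]
  simp only [Function.update_self]
  ring

theorem SN_nonneg {ι : Type*} [Fintype ι] (z : ι → ℂ) : 0 ≤ SN z :=
  Finset.sum_nonneg fun i _ => by positivity

theorem sq_le_SN {ι : Type*} [Fintype ι] (z : ι → ℂ) (j : ι) : ‖z j‖ ^ 2 ≤ SN z :=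
  Finset.single_le_sum (f := fun i => ‖z i‖^2) (fun i _ => by positivity) (Finset.mem_univ j)

theorem QN_lower {ι : Type*} [Fintype ι] (ε : ι → ℝ) (hε : ∀ i, ε i = 1 ∨ ε i = -1)
    (z : ι → ℂ) (j : ι) (hj : ε j = 1) : ‖z j‖ ^ 2 - SN z ≤ QN ε z - ‖z j‖ ^ 2 := by
  have h : (ε j + 1) * ‖z j‖ ^ 2 ≤ ∑ i, (ε i + 1) * ‖z i‖ ^ 2 := by
    refine Finset.single_le_sum (f := fun i => (ε i + 1) * ‖z i‖^2) (fun i _ => ?_) (Finset.mem_univ j)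
    rcases hε i with h | h <;> rw [h] <;> positivity
  have h2 : ∑ i, (ε i + 1) * ‖z i‖ ^ 2 = QN ε z + SN z := by
    unfold QN SN
    rw [← Finset.sum_add_distrib]
    exact Finset.sum_congr rfl fun i _ => by ring
  rw [h2, hj] at h
  linarith

theorem upd_mem {ι : Type*} [Fintype ι] [DecidableEq ι] (ε : ι → ℝ) (hε : ∀ i, ε i = 1 ∨ ε i = -1)
    (j : ι) (hj : ε j = 1) {z : ι → ℂ} {s : ℂ} (hs : SN z < ‖s‖ ^ 2) :
    0 < QN ε (Function.update z j s) := by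
  rw [QN_update ε z j hj]
  have := QN_lower ε hε z j hj
  have : 0 ≤ ‖z j‖^2 := by positivity
  linarith

def FR {ι E : Type*} [Fintype ι] [DecidableEq ι] [NormedAddCommGroup E] [NormedSpace ℂ E]
    (f : (ι → ℂ) → E) (j : ι) (R : ℝ) (z : ι → ℂ) : E :=
  (2 * Real.pi * Complex.I : ℂ)⁻¹ • ∮ s in C(0, R), (s - z j)⁻¹ • f (Function.update z j s)

theorem update_diff {ι : Type*} [Fintype ι] [DecidableEq ι] (z : ι → ℂ) (j : ι) :
    Differentiable ℂ (fun s : ℂ => Function.update z j s) := by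
  rw [differentiable_pi]
  intro i
  by_cases h : i = j
  · subst h; simp
  · simp [Function.update_of_ne h]

section hart
variable {ι E : Type*} [Fintype ι] [DecidableEq ι] [NormedAddCommGroup E] [NormedSpace ℂ E]
  [CompleteSpace E]

theorem FR_indep (ε : ι → ℝ) (hε : ∀ i, ε i = 1 ∨ ε i = -1)
    (j : ι) (hj : ε j = 1) (f : (ι → ℂ) → E) (hf : DifferentiableOn ℂ f {z | 0 < QN ε z})
    {r R : ℝ} (hr : 0 < r) (hrR : r ≤ R) {z : ι → ℂ} (hz : SN z < r ^ 2) :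
    FR f j R z = FR f j r z := by
  unfold FR
  congr 1
  have hd : ∀ s : ℂ, r ≤ ‖s‖ → DifferentiableAt ℂ (fun s => (s - z j)⁻¹ • f (Function.update z j s)) s := by
    intro s hs
    have hs2 : SN z < ‖s‖ ^ 2 := hz.trans_le (by gcongr)
    have hne : s - z j ≠ 0 := by
      intro h
      rw [sub_eq_zero.1 h] at hs2
      exact absurd (sq_le_SN z j) (not_le.2 hs2)
    refine DifferentiableAt.smul ((differentiableAt_id.sub_const _).inv hne) ?_
    exact (hf.differentiableAt ((isOpen_QN ε).mem_nhds (upd_mem ε hε j hj hs2))).comp s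
      (update_diff z j s)
  apply Complex.circleIntegral_eq_of_differentiable_on_annulus_off_countable hr hrR countable_empty
  · intro s hs
    refine (hd s ?_).continuousAt.continuousWithinAt
    simpa using hs.2
  · intro s hs
    apply hd
    have := hs.1.2
    simp at this
    exact this.le

theorem FR_diff (ε : ι → ℝ) (hε : ∀ i, ε i = 1 ∨ ε i = -1)
    (j : ι) (hj : ε j = 1) (f : (ι → ℂ) → E) (hf : DifferentiableOn ℂ f {z | 0 < QN ε z})
    {R : ℝ} (hR : 0 < R) {φ : ℂ → (ι → ℂ)} (hφ : Differentiable ℂ φ) {t0 : ℂ}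
    (ht0 : SN (φ t0) < R ^ 2) : DifferentiableAt ℂ (fun t => FR f j R (φ t)) t0 := by
  unfold FR circleIntegral
  refine DifferentiableAt.const_smul ?_ _
  have hφj : ∀ i, Differentiable ℂ (fun t => φ t i) := fun i => differentiable_pi.1 hφ i
  have hn : ∀ θ : ℝ, ‖circleMap 0 R θ‖ = R := fun θ => by simp [abs_of_pos hR]
  have hmem : ∀ t ∈ {t | SN (φ t) < R ^ 2}, ∀ θ : ℝ,
      0 < QN ε (Function.update (φ t) j (circleMap 0 R θ)) := by
    intro t ht θ
    apply upd_mem ε hε j hj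
    rw [hn]; exact ht
  have hne : ∀ t ∈ {t | SN (φ t) < R ^ 2}, ∀ θ : ℝ, circleMap 0 R θ - φ t j ≠ 0 := by
    intro t ht θ h
    have h1 : ‖φ t j‖ = R := by rw [← sub_eq_zero.1 h, hn]
    have := sq_le_SN (φ t) j
    rw [h1] at this
    exact absurd this (not_le.2 ht)
  have hU : IsOpen {t | SN (φ t) < R ^ 2} :=
    isOpen_lt (continuous_SN.comp hφ.continuous) continuous_const
  refine differentiableAt_param hU ht0 ?_ ?_ _ _
  · have hc1 : Continuous (fun p : ℂ × ℝ => deriv (circleMap 0 R) p.2) := by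
      simp only [deriv_circleMap]
      have := continuous_circleMap 0 R
      fun_prop
    have hcm : Continuous (fun p : ℂ × ℝ => circleMap 0 R p.2) :=
      (continuous_circleMap 0 R).comp continuous_snd
    have hc2 : ContinuousOn (fun p : ℂ × ℝ => (circleMap 0 R p.2 - φ p.1 j)⁻¹)
        ({t | SN (φ t) < R ^ 2} ×ˢ univ) := by
      refine ContinuousOn.inv₀ ?_ (fun p hp => hne p.1 hp.1 p.2)
      exact (hcm.sub ((hφj j).continuous.comp continuous_fst)).continuousOn
    have hc3 : ContinuousOn (fun p : ℂ × ℝ => f (Function.update (φ p.1) j (circleMap 0 R p.2)))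
        ({t | SN (φ t) < R ^ 2} ×ˢ univ) := by
      refine hf.continuousOn.comp ?_ (fun p hp => hmem p.1 hp.1 p.2)
      exact ((hφ.continuous.comp continuous_fst).update j hcm).continuousOn
    exact hc1.continuousOn.smul (hc2.smul hc3)
  · intro θ t ht
    refine DifferentiableAt.differentiableWithinAt ?_
    refine DifferentiableAt.const_smul ?_ _
    refine DifferentiableAt.smul (((differentiableAt_const _).sub (hφj j t)).inv (hne t ht θ)) ?_
    refine (hf.differentiableAt ((isOpen_QN ε).mem_nhds (hmem t ht θ))).comp t ?_
    rw [differentiableAt_pi]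
    intro i
    by_cases h : i = j
    · subst h; simp
    · simpa [Function.update_of_ne h] using hφj i t

theorem hartogs (ε : ι → ℝ) (hε : ∀ i, ε i = 1 ∨ ε i = -1)
    (j k : ι) (hj : ε j = 1) (hk : ε k = 1) (hjk : k ≠ j)
    (f : (ι → ℂ) → E) (hf : DifferentiableOn ℂ f {z | 0 < QN ε z}) :
    ∃ F : (ι → ℂ) → E, Ent F ∧ ∀ z, 0 < QN ε z → F z = f z := by
  have hSR : ∀ z : ι → ℂ, SN z < (1 + SN z) ^ 2 := fun z => by nlinarith [SN_nonneg z]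
  have hEnt : Ent (fun z => FR f j (1 + SN z) z) := by
    intro φ hφ t0
    have hev : ∀ᶠ t in 𝓝 t0, 1 + SN (φ t) < 2 + SN (φ t0) := by
      have hc : Continuous (fun t => 1 + SN (φ t)) :=
        continuous_const.add (continuous_SN.comp hφ.continuous)
      exact hc.continuousAt.eventually_lt continuousAt_const (by linarith)
    have hd := FR_diff ε hε j hj f hf (R := 2 + SN (φ t0)) (by linarith [SN_nonneg (φ t0)]) hφ (t0 := t0)
      (by nlinarith [SN_nonneg (φ t0)])
    refine hd.congr_of_eventuallyEq ?_
    filter_upwards [hev] with t ht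
    exact (FR_indep ε hε j hj f hf (by linarith [SN_nonneg (φ t)]) ht.le (hSR _)).symm
  have step1 : ∀ z, 0 < QN ε z - ‖z j‖ ^ 2 → FR f j (1 + SN z) z = f z := by
    intro z hz
    have hd : Differentiable ℂ (fun s => f (Function.update z j s)) := by
      intro s
      refine (hf.differentiableAt ((isOpen_QN ε).mem_nhds ?_)).comp s (update_diff z j s)
      change 0 < QN ε (Function.update z j s)
      rw [QN_update ε z j hj]
      positivity
    have h := Complex.two_pi_I_inv_smul_circleIntegral_sub_inv_smul_of_differentiable_on_off_countable
      (R := 1 + SN z) (c := 0) (w := z j) (f := fun s => f (Function.update z j s)) countable_empty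
      (by
        rw [mem_ball_zero_iff]
        have h1 := (sq_le_SN z j).trans_lt (hSR z)
        exact lt_of_pow_lt_pow_left₀ 2 (by linarith [SN_nonneg z]) h1)
      hd.continuous.continuousOn (fun s _ => hd s)
    simp only [Function.update_eq_self] at h
    exact h
  have step2 : ∀ z, 0 < QN ε z → z k ≠ 0 → FR f j (1 + SN z) z = f z := by
    intro z hz hzk
    set φ : ℂ → (ι → ℂ) := fun τ i => if ε i = 1 then z i else τ * z i with hφdef
    have hφ : Differentiable ℂ φ := by
      rw [differentiable_pi]
      intro i
      simp only [hφdef]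
      split_ifs <;> fun_prop
    have hφ1 : φ 1 = z := by
      ext i; simp [hφdef]
    have hφj : ∀ τ, φ τ j = z j := fun τ => by simp [hφdef, hj]
    set U : Set ℂ := {τ | 0 < QN ε (φ τ)} with hUdef
    have hU : IsOpen U := isOpen_lt continuous_const ((continuous_QN ε).comp hφ.continuous)
    have hmono : ∀ τ τ' : ℂ, ‖τ'‖ ≤ ‖τ‖ → QN ε (φ τ) ≤ QN ε (φ τ') := by
      intro τ τ' h
      unfold QN
      refine Finset.sum_le_sum fun i _ => ?_
      rcases hε i with h1 | h1
      · simp [hφdef, h1]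
      · have : ¬ ((-1:ℝ) = 1) := by norm_num
        simp only [hφdef, h1, this, if_false, norm_mul]
        have : (‖τ'‖ * ‖z i‖) ^ 2 ≤ (‖τ‖ * ‖z i‖) ^ 2 := by gcongr
        linarith
    have h0 : 0 < QN ε (φ 0) - ‖φ 0 j‖ ^ 2 := by
      have h1 : QN ε (φ 0) - ‖φ 0 j‖ ^ 2 = QN ε (Function.update (φ 0) j 0) := by
        rw [QN_update ε _ j hj]; simp
      rw [h1]
      unfold QN
      refine Finset.sum_pos' (fun i _ => ?_) ⟨k, Finset.mem_univ _, ?_⟩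
      · rcases hε i with h1 | h1
        · rw [h1]; positivity
        · have h2 : ¬ ((-1:ℝ) = 1) := by norm_num
          have hij : i ≠ j := by
            intro h; rw [h, hj] at h1; norm_num at h1
          rw [Function.update_of_ne hij]
          simp only [hφdef, h1, h2, if_false]; simp
      · rw [Function.update_of_ne hjk]
        simp only [hφdef, hk, if_true]
        positivity
    have hU1 : (1:ℂ) ∈ U := by
      change 0 < QN ε (φ 1); rw [hφ1]; exact hz
    have hU0 : (0:ℂ) ∈ U := lt_of_lt_of_le hU1 (hmono 1 0 (by simp))
    have hpre : IsPreconnected U := by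
      have hstar : StarConvex ℝ (0:ℂ) U := by
        rw [starConvex_zero_iff]
        intro τ hτ a ha0 ha1
        refine lt_of_lt_of_le hτ (hmono τ _ ?_)
        rw [norm_smul, Real.norm_of_nonneg ha0]
        exact mul_le_of_le_one_left (norm_nonneg _) ha1
      exact (hstar.isPathConnected hU0).isConnected.isPreconnected
    have ha1 : AnalyticOnNhd ℂ (fun τ => FR f j (1 + SN (φ τ)) (φ τ)) U :=
      (hEnt φ hφ).differentiableOn.analyticOnNhd hU
    have ha2 : AnalyticOnNhd ℂ (fun τ => f (φ τ)) U := by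
      refine DifferentiableOn.analyticOnNhd ?_ hU
      exact hf.comp hφ.differentiableOn (fun τ hτ => hτ)
    have hev : (fun τ => FR f j (1 + SN (φ τ)) (φ τ)) =ᶠ[𝓝 0] (fun τ => f (φ τ)) := by
      have hc : Continuous (fun τ => QN ε (φ τ) - ‖φ τ j‖ ^ 2) := by
        have := (continuous_QN ε).comp hφ.continuous
        have h2 : Continuous (fun τ => φ τ j) := (differentiable_pi.1 hφ j).continuous
        exact this.sub (h2.norm.pow 2)
      filter_upwards [continuousAt_const.eventually_lt hc.continuousAt h0] with τ hτ
      exact step1 _ hτ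
    have := ha1.eqOn_of_preconnected_of_eventuallyEq ha2 hpre hU0 hev hU1
    simpa only [hφ1] using this
  refine ⟨_, hEnt, ?_⟩
  intro z hz
  by_cases hzk : z k = 0
  · have hup : Function.update z k 0 = z := by rw [← hzk]; simp
    have hc := update_diff z k
    have h1 : Tendsto (fun s : ℂ => FR f j (1 + SN (Function.update z k s)) (Function.update z k s))
        (𝓝[≠] 0) (𝓝 (FR f j (1 + SN z) z)) := by
      have := ((hEnt _ hc).continuous.tendsto 0)
      simp only [hup] at this
      exact this.mono_left nhdsWithin_le_nhds
    have hzf : ContinuousAt f z := (hf.differentiableAt ((isOpen_QN ε).mem_nhds hz)).continuousAt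
    have h2 : Tendsto (fun s : ℂ => f (Function.update z k s)) (𝓝[≠] 0) (𝓝 (f z)) := by
      have h3 := hc.continuous.tendsto 0
      rw [hup] at h3
      exact (hzf.tendsto.comp h3).mono_left nhdsWithin_le_nhds
    refine tendsto_nhds_unique h1 (h2.congr' ?_)
    filter_upwards [self_mem_nhdsWithin] with s hs
    refine (step2 _ ?_ ?_).symm
    · rw [QN_update ε z k hk, hzk]
      simp
      positivity
    · simpa using hs
  · exact step2 z hz hzk
end hart

def hh {ι : Type*} [Fintype ι] (ε : ι → ℝ) (z w : ι → ℂ) : ℂ :=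
  ∑ i, (ε i : ℂ) * z i * (starRingEnd ℂ) (w i)

section form
variable {ι : Type*} [Fintype ι] (ε : ι → ℝ)

theorem hh_self (z : ι → ℂ) : hh ε z z = (QN ε z : ℂ) := by
  unfold hh QN
  push_cast
  refine Finset.sum_congr rfl fun i _ => ?_
  rw [mul_assoc, Complex.mul_conj, Complex.normSq_eq_norm_sq]
  push_cast; rfl

theorem hh_add_left (z z' w : ι → ℂ) : hh ε (z + z') w = hh ε z w + hh ε z' w := by
  unfold hh
  rw [← Finset.sum_add_distrib]
  exact Finset.sum_congr rfl fun i _ => by simp; ring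

theorem hh_smul_left (a : ℂ) (z w : ι → ℂ) : hh ε (a • z) w = a * hh ε z w := by
  unfold hh
  rw [Finset.mul_sum]
  exact Finset.sum_congr rfl fun i _ => by simp; ring

theorem hh_conj (z w : ι → ℂ) : (starRingEnd ℂ) (hh ε z w) = hh ε w z := by
  unfold hh
  rw [map_sum]
  exact Finset.sum_congr rfl fun i _ => by simp; ring

theorem hh_add_right (z w w' : ι → ℂ) : hh ε z (w + w') = hh ε z w + hh ε z w' := by
  rw [← hh_conj, hh_add_left, map_add, hh_conj, hh_conj]

theorem hh_smul_right (a : ℂ) (z w : ι → ℂ) : hh ε z (a • w) = (starRingEnd ℂ) a * hh ε z w := by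
  rw [← hh_conj, hh_smul_left, map_mul, hh_conj]

theorem hh_sub_left (z z' w : ι → ℂ) : hh ε (z - z') w = hh ε z w - hh ε z' w := by
  have : z - z' = z + (-1 : ℂ) • z' := by simp [sub_eq_add_neg]
  rw [this, hh_add_left, hh_smul_left]; ring

theorem hh_sub_right (z w w' : ι → ℂ) : hh ε z (w - w') = hh ε z w - hh ε z w' := by
  rw [← hh_conj, hh_sub_left, map_sub, hh_conj, hh_conj]

theorem hh_nondeg [DecidableEq ι] (hε : ∀ i, ε i = 1 ∨ ε i = -1) (z : ι → ℂ) (h : ∀ w, hh ε z w = 0) : z = 0 := by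
  ext i
  have := h (Pi.single i 1)
  unfold hh at this
  rw [Finset.sum_eq_single i] at this
  · rcases hε i with h1 | h1 <;> simpa [h1] using this
  · intro b _ hb; simp [hb]
  · simp

theorem QN_smul (a : ℂ) (z : ι → ℂ) : QN ε (a • z) = ‖a‖ ^ 2 * QN ε z := by
  unfold QN
  rw [Finset.mul_sum]
  exact Finset.sum_congr rfl fun i _ => by simp; ring

theorem QN_add (z w : ι → ℂ) : QN ε (z + w) = QN ε z + QN ε w + 2 * (hh ε z w).re := by
  have h := hh_self ε (z + w)
  rw [hh_add_left, hh_add_right, hh_add_right, hh_self, hh_self, ← hh_conj ε z w] at h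
  have := congrArg Complex.re h
  simp at this
  linarith

theorem QN_single [DecidableEq ι] (j : ι) : QN ε (Pi.single j (1:ℂ)) = ε j := by
  unfold QN
  rw [Finset.sum_eq_single j]
  · simp
  · intro b _ hb; simp [hb]
  · simp

theorem hh_diff {φ ψ : ℂ → (ι → ℂ)} (hφ : Differentiable ℂ φ) (hψ : Differentiable ℂ ψ) :
    Differentiable ℂ (fun t => hh ε (φ t) (ψ ((starRingEnd ℂ) t))) := by
  unfold hh
  refine Differentiable.fun_sum fun i _ => ?_
  refine Differentiable.mul ((differentiable_const _).mul (differentiable_pi.1 hφ i)) ?_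
  intro t
  have := (differentiable_pi.1 hψ i ((starRingEnd ℂ) t)).conj_conj
  simpa [Function.comp_def] using this

end form

structure Setup (ι : Type*) [Fintype ι] (ε : ι → ℝ) (F G : (ι → ℂ) → (ι → ℂ)) : Prop where
  hε : ∀ i, ε i = 1 ∨ ε i = -1
  entF : Ent F
  entG : Ent G
  FG : ∀ z, F (G z) = z
  GF : ∀ z, G (F z) = z
  FD : ∀ z, 0 < QN ε z → 0 < QN ε (F z)
  GD : ∀ z, 0 < QN ε z → 0 < QN ε (G z)
  ex : ∃ j k i, k ≠ j ∧ ε j = 1 ∧ ε k = 1 ∧ ε i = -1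

namespace Setup
variable {ι : Type*} [Fintype ι] {ε : ι → ℝ} {F G : (ι → ℂ) → (ι → ℂ)}

theorem symm (S : Setup ι ε F G) : Setup ι ε G F :=
  ⟨S.hε, S.entG, S.entF, S.GF, S.FG, S.GD, S.FD, S.ex⟩

theorem neg_neg (S : Setup ι ε F G) {z : ι → ℂ} (h : QN ε z ≤ 0) : QN ε (F z) ≤ 0 := by
  by_contra hc
  have := S.GD _ (not_le.1 hc)
  rw [S.GF] at this
  linarith

theorem line_diff (z d : ι → ℂ) : Differentiable ℂ (fun t : ℂ => z + t • d) := by fun_prop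

theorem null (S : Setup ι ε F G) {z : ι → ℂ} (h : QN ε z = 0) : QN ε (F z) = 0 := by
  classical
  refine le_antisymm (S.neg_neg h.le) ?_
  obtain ⟨j, k, i, hkj, hj, hk, hi⟩ := S.ex
  have : ∃ d : ι → ℂ, 0 < QN ε d ∧ 0 ≤ (hh ε z d).re := by
    by_cases hs : 0 ≤ (hh ε z (Pi.single j 1)).re
    · exact ⟨_, by rw [QN_single, hj]; norm_num, hs⟩
    · refine ⟨(-1:ℂ) • Pi.single j 1, ?_, ?_⟩
      · rw [QN_smul, QN_single, hj]; norm_num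
      · rw [hh_smul_right]; simp; linarith
  obtain ⟨d, hd, hre⟩ := this
  have hpos : ∀ t : ℝ, 0 < t → 0 < QN ε (z + (t : ℂ) • d) := by
    intro t ht
    rw [QN_add, h, QN_smul, hh_smul_right]
    simp only [Complex.conj_ofReal, Complex.re_ofReal_mul, Complex.norm_real]
    have : 0 < ‖t‖ ^ 2 := pow_pos (norm_pos_iff.2 ht.ne') 2
    have := mul_nonneg ht.le hre
    have := mul_pos ‹0 < ‖t‖ ^ 2› hd
    linarith
  have hc : Continuous (fun t : ℝ => QN ε (F (z + (t : ℂ) • d))) :=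
    (continuous_QN ε).comp ((S.entF _ (line_diff z d)).continuous.comp Complex.continuous_ofReal)
  have ht := (hc.tendsto 0).mono_left (nhdsWithin_le_nhds (s := Ioi 0))
  simp only [Complex.ofReal_zero, zero_smul, add_zero] at ht
  refine ge_of_tendsto ht ?_
  filter_upwards [self_mem_nhdsWithin] with t ht
  exact (S.FD _ (hpos t ht)).le

theorem polar (S : Setup ι ε F G) {z w : ι → ℂ} (h : hh ε z w = 0) (hN : QN ε z = - QN ε w) :
    hh ε (F z) (F w) = 0 := by
  have hdiff1 : ∀ (a : ℂ), Differentiable ℂ (fun b : ℂ => F ((a + Complex.I * b) • z + (a - Complex.I * b) • w)) :=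
    fun a => S.entF _ (by fun_prop)
  have hdiff2 : ∀ (b : ℂ), Differentiable ℂ (fun a : ℂ => F ((a + Complex.I * b) • z + (a - Complex.I * b) • w)) :=
    fun b => S.entF _ (by fun_prop)
  set Q : ℂ → ℂ → (ι → ℂ) := fun a b => F ((a + Complex.I * b) • z + (a - Complex.I * b) • w) with hQ
  have hreal : ∀ a b : ℝ, hh ε (Q a b) (Q a b) = 0 := by
    intro a b
    rw [hh_self, Complex.ofReal_eq_zero]
    apply S.null
    rw [QN_add, QN_smul, QN_smul, hh_smul_left, hh_smul_right, h, hN]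
    have : ‖(a + Complex.I * b : ℂ)‖ = ‖(a - Complex.I * b : ℂ)‖ := by
      rw [← Complex.norm_conj]; simp [sub_eq_add_neg]
    rw [this]; simp
  have h1 : ∀ (a : ℝ) (b : ℂ), hh ε (Q a b) (Q a ((starRingEnd ℂ) b)) = 0 := by
    intro a b
    exact entire_zero_of_real (u := fun b => hh ε (Q a b) (Q a ((starRingEnd ℂ) b)))
      (hh_diff ε (hdiff1 a) (hdiff1 a)) (fun x => by simpa using hreal a x) b
  have h2 : ∀ (a b : ℂ), hh ε (Q a b) (Q ((starRingEnd ℂ) a) ((starRingEnd ℂ) b)) = 0 := by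
    intro a b
    exact entire_zero_of_real (u := fun a => hh ε (Q a b) (Q ((starRingEnd ℂ) a) ((starRingEnd ℂ) b)))
      (hh_diff ε (hdiff2 b) (hdiff2 _)) (fun x => by simpa using h1 x b) a
  have h3 := h2 (1/2) (-Complex.I/2)
  have e1 : Q (1/2) (-Complex.I/2) = F z := by
    simp only [hQ]
    congr 1
    have i1 : (1/2 + Complex.I * (-Complex.I/2) : ℂ) = 1 := by
      linear_combination (-1/2) * Complex.I_mul_I
    have i2 : (1/2 - Complex.I * (-Complex.I/2) : ℂ) = 0 := by
      linear_combination (1/2) * Complex.I_mul_I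
    rw [i1, i2]; simp
  have e2 : Q ((starRingEnd ℂ) (1/2)) ((starRingEnd ℂ) (-Complex.I/2)) = F w := by
    simp only [hQ]
    congr 1
    have j1 : (starRingEnd ℂ) (1/2 : ℂ) = 1/2 := by simp [map_ofNat]
    have j2 : (starRingEnd ℂ) (-Complex.I/2 : ℂ) = Complex.I/2 := by simp [map_ofNat]
    have i1 : (1/2 + Complex.I * (Complex.I/2) : ℂ) = 0 := by
      linear_combination (1/2) * Complex.I_mul_I
    have i2 : (1/2 - Complex.I * (Complex.I/2) : ℂ) = 1 := by
      linear_combination (-1/2) * Complex.I_mul_I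
    rw [j1, j2, i1, i2]; simp
  rwa [e1, e2] at h3

theorem polar2 (S : Setup ι ε F G) {z w : ι → ℂ} (h : hh ε z w = 0) (hz : 0 < QN ε z)
    (hw : QN ε w < 0) : hh ε (F z) (F w) = 0 := by
  set κ : ℝ := Real.sqrt (QN ε z / (- QN ε w)) with hκ
  have hpos : 0 < QN ε z / (- QN ε w) := div_pos hz (by linarith)
  have hκpos : 0 < κ := Real.sqrt_pos.2 hpos
  have hκ2 : κ ^ 2 * QN ε w = - QN ε z := by
    rw [hκ, Real.sq_sqrt hpos.le]
    have : QN ε w ≠ 0 := hw.ne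
    field_simp
  have hd : Differentiable ℂ (fun s : ℂ => F (((κ:ℂ) * Complex.exp (Complex.I * s)) • w)) :=
    S.entF _ (by fun_prop)
  have hu := hh_diff ε (φ := fun _ => F z) (differentiable_const _) hd
  have hz := entire_zero_of_real hu (fun x => by
    simp only [Complex.conj_ofReal]
    apply S.polar
    · rw [hh_smul_right, h, mul_zero]
    · rw [QN_smul, norm_mul, mul_comm Complex.I, Complex.norm_exp_ofReal_mul_I, mul_one, Complex.norm_real,
        Real.norm_of_nonneg hκpos.le, hκ2]; ring)
    ((starRingEnd ℂ) (-Complex.I * Complex.log ((κ:ℂ)⁻¹)))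
  have hκ0 : (κ:ℂ) ≠ 0 := Complex.ofReal_ne_zero.2 hκpos.ne'
  have e : Complex.I * (-Complex.I * Complex.log ((κ:ℂ)⁻¹)) = Complex.log ((κ:ℂ)⁻¹) := by
    linear_combination (-Complex.log ((κ:ℂ)⁻¹)) * Complex.I_mul_I
  simp only [Complex.conj_conj] at hz
  rw [e, Complex.exp_log (inv_ne_zero hκ0), mul_inv_cancel₀ hκ0, one_smul] at hz
  exact hz

theorem exists_neg (S : Setup ι ε F G) {z : ι → ℂ} (hz : 0 < QN ε z) :
    ∃ w, hh ε z w = 0 ∧ QN ε w < 0 := by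
  classical
  obtain ⟨j, k, i, hkj, hj, hk, hi⟩ := S.ex
  -- orthogonal projection of `single i`
  have hz' : (QN ε z : ℂ) ≠ 0 := Complex.ofReal_ne_zero.2 hz.ne'
  set e : ι → ℂ := Pi.single i 1 with he
  set a : ℂ := hh ε e z / QN ε z with ha
  have hconj : (starRingEnd ℂ) a = hh ε z e / QN ε z := by
    rw [ha, map_div₀, hh_conj, Complex.conj_ofReal]
  have horth : hh ε z (e - a • z) = 0 := by
    rw [hh_sub_right, hh_smul_right, hh_self, hconj]
    field_simp
    ring
  refine ⟨e - a • z, horth, ?_⟩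
  have h1 := QN_add ε (e - a • z) (a • z)
  have h2 : hh ε (e - a • z) (a • z) = 0 := by
    rw [hh_smul_right, ← hh_conj, horth]; simp
  rw [sub_add_cancel, h2, QN_smul, he, QN_single, hi] at h1
  simp only [Complex.zero_re, mul_zero, add_zero] at h1
  have : 0 ≤ ‖a‖ ^ 2 * QN ε z := by positivity
  linarith

theorem polar3 (S : Setup ι ε F G) {z w : ι → ℂ} (h : hh ε z w = 0) (hz : 0 < QN ε z) :
    hh ε (F z) (F w) = 0 := by
  obtain ⟨w0, h0, hN⟩ := S.exists_neg hz
  have hd : Differentiable ℂ (fun s : ℂ => F (w0 + s • (w - w0))) := S.entF _ (line_diff _ _)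
  have hu := hh_diff ε (φ := fun _ => F z) (differentiable_const _) hd
  have hev : ∀ᶠ t in 𝓝 (0:ℂ), hh ε (F z) (F (w0 + ((starRingEnd ℂ) t) • (w - w0))) = 0 := by
    have hc : Continuous (fun t : ℂ => QN ε (w0 + ((starRingEnd ℂ) t) • (w - w0))) :=
      (continuous_QN ε).comp ((line_diff w0 (w - w0)).continuous.comp Complex.continuous_conj)
    filter_upwards [hc.continuousAt.eventually_lt continuousAt_const (by simpa using hN)] with t ht
    refine S.polar2 ?_ hz ht
    rw [hh_add_right, hh_smul_right, hh_sub_right, h, h0]; simp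
  have := entire_eq_of_eventually hu (differentiable_const 0) hev 1
  simpa using this

def cc (ε : ι → ℝ) (F : (ι → ℂ) → (ι → ℂ)) (z : ι → ℂ) (t : ℂ) : ℂ :=
  hh ε (F (t • z)) (F z) / hh ε (F z) (F z)

theorem cc_diff (S : Setup ι ε F G) (z : ι → ℂ) : Differentiable ℂ (cc ε F z) := by
  have h1 : Differentiable ℂ (fun t : ℂ => F (t • z)) := S.entF _ (by fun_prop)
  exact (hh_diff ε h1 (ψ := fun _ => F z) (differentiable_const _)).div_const _

theorem cc_eq (S : Setup ι ε F G) {z : ι → ℂ} (hz : 0 < QN ε z) (t : ℂ) :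
    F (t • z) = cc ε F z t • F z := by
  classical
  have hFz := S.FD z hz
  have hne : hh ε (F z) (F z) ≠ 0 := by
    rw [hh_self]; exact Complex.ofReal_ne_zero.2 hFz.ne'
  have main : ∀ t : ℂ, t ≠ 0 → F (t • z) = cc ε F z t • F z := by
    intro t ht
    have htz : 0 < QN ε (t • z) := by
      rw [QN_smul]; have := norm_pos_iff.2 ht; positivity
    have key : ∀ w, hh ε (F z) w = 0 → hh ε (F (t • z)) w = 0 := by
      intro w hw
      have h1 := S.symm.polar3 hw hFz
      rw [S.GF] at h1
      have h2 : hh ε (t • z) (G w) = 0 := by rw [hh_smul_left, h1, mul_zero]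
      have h3 := S.polar3 h2 htz
      rwa [S.FG] at h3
    rw [← sub_eq_zero]
    apply hh_nondeg ε S.hε
    intro w
    set b : ℂ := (starRingEnd ℂ) (hh ε (F z) w / hh ε (F z) (F z)) with hb
    have horth : hh ε (F z) (w - b • F z) = 0 := by
      rw [hh_sub_right, hh_smul_right, hb, Complex.conj_conj]
      field_simp
      ring
    have e1 : hh ε (F (t • z) - cc ε F z t • F z) (w - b • F z) = 0 := by
      rw [hh_sub_left, hh_smul_left, horth, key _ horth]; simp
    have e2 : hh ε (F (t • z) - cc ε F z t • F z) (F z) = 0 := by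
      rw [hh_sub_left, hh_smul_left, cc]
      field_simp
      ring
    rw [hh_sub_right, hh_smul_right, e2] at e1
    simpa using e1
  have h1 : Differentiable ℂ (fun t : ℂ => F (t • z)) := S.entF _ (by fun_prop)
  have h2 : Continuous (fun t => cc ε F z t • F z) := (S.cc_diff z).continuous.smul continuous_const
  have hev : (fun t : ℂ => F (t • z)) =ᶠ[𝓝[≠] 0] (fun t => cc ε F z t • F z) := by
    filter_upwards [self_mem_nhdsWithin] with t ht
    exact main t ht
  by_cases ht : t = 0
  · subst ht
    have t1 := (h1.continuous.tendsto 0).mono_left (nhdsWithin_le_nhds (s := {0}ᶜ))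
    have t2 := (h2.tendsto 0).mono_left (nhdsWithin_le_nhds (s := {0}ᶜ))
    exact tendsto_nhds_unique t1 (t2.congr' hev.symm)
  · exact main t ht

theorem map_zero' (S : Setup ι ε F G) : F 0 = 0 := by
  classical
  obtain ⟨j, k, i, hkj, hj, hk, hi⟩ := S.ex
  have key : ∀ y, 0 < QN ε y → ∃ c : ℂ, F 0 = c • y := by
    intro y hy
    have := S.cc_eq (S.GD y hy) 0
    rw [zero_smul, S.FG] at this
    exact ⟨_, this⟩
  obtain ⟨a, ha⟩ := key (Pi.single j 1) (by rw [QN_single, hj]; norm_num)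
  obtain ⟨b, hb⟩ := key (Pi.single k 1) (by rw [QN_single, hk]; norm_num)
  have h1 : F 0 j = 0 := by rw [hb]; simp [hkj.symm]
  have h2 : a = 0 := by
    rw [ha] at h1; simpa using h1
  rw [ha, h2, zero_smul]

theorem ne_zero_of_pos {z : ι → ℂ} (hz : 0 < QN ε z) : z ≠ 0 := by
  rintro rfl
  simp [QN] at hz

theorem homog (S : Setup ι ε F G) {z : ι → ℂ} (hz : 0 < QN ε z) (t : ℂ) : F (t • z) = t • F z := by
  have hFz := S.FD z hz
  have hz0 := ne_zero_of_pos hz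
  have hF0 := ne_zero_of_pos hFz
  have hc : ∀ t, cc ε F z t = t := by
    refine entire_linear_of_inv (S.cc_diff z) (S.symm.cc_diff (F z)) ?_ ?_ ?_ ?_
    · intro t
      have h1 := S.symm.cc_eq hFz (cc ε F z t)
      rw [← S.cc_eq hz, S.GF, S.GF] at h1
      exact (smul_left_injective ℂ hz0 h1).symm
    · have := S.cc_eq hz 0
      rw [zero_smul, S.map_zero'] at this
      exact (smul_eq_zero.1 this.symm).resolve_right hF0
    · have := S.symm.cc_eq hFz 0
      rw [zero_smul, S.symm.map_zero', S.GF] at this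
      exact (smul_eq_zero.1 this.symm).resolve_right hz0
    · have := S.cc_eq hz 1
      rw [one_smul] at this
      exact smul_left_injective ℂ hF0 (by simpa using this.symm)
  rw [S.cc_eq hz, hc]

theorem additive (S : Setup ι ε F G) {w : ι → ℂ} (hw : 0 < QN ε w) (z : ι → ℂ) (t : ℂ) :
    F (z + t • w) = F z + t • F w := by
  have hd : Differentiable ℂ (fun t : ℂ => F (z + t • w)) := S.entF _ (line_diff _ _)
  have hs := differentiable_dslope0 hd
  have hd2 : Differentiable ℂ (fun s : ℂ => F (w + s • z)) := S.entF _ (line_diff _ _)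
  have hinv : Tendsto (fun t : ℂ => t⁻¹) (cocompact ℂ) (𝓝 0) := by
    rw [← Metric.cobounded_eq_cocompact]
    exact tendsto_inv₀_cobounded
  have hlim : Tendsto (dslope (fun t : ℂ => F (z + t • w)) 0) (cocompact ℂ) (𝓝 (F w)) := by
    have h1 : Tendsto (fun t : ℂ => F (w + t⁻¹ • z) - t⁻¹ • F z) (cocompact ℂ) (𝓝 (F w)) := by
      have a1 : Tendsto (fun t : ℂ => F (w + t⁻¹ • z)) (cocompact ℂ) (𝓝 (F w)) := by
        have := (hd2.continuous.tendsto 0).comp hinv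
        simpa [Function.comp_def] using this
      have a2 := a1.sub (hinv.smul_const (F z))
      simpa using a2
    refine h1.congr' ?_
    have hne : ∀ᶠ t in cocompact ℂ, t ≠ (0:ℂ) := by
      have := (isCompact_singleton (x := (0:ℂ))).compl_mem_cocompact
      filter_upwards [this] with t ht
      exact ht
    have hp : ∀ᶠ t in cocompact ℂ, 0 < QN ε (w + (t:ℂ)⁻¹ • z) := by
      have hc : Continuous (fun s : ℂ => QN ε (w + s • z)) :=
        (continuous_QN ε).comp (line_diff w z).continuous
      have := (continuousAt_const (y := (0:ℝ))).eventually_lt (hc.continuousAt (x := 0)) (by simpa using hw)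
      exact hinv.eventually this
    filter_upwards [hne, hp] with t ht hpt
    rw [dslope_of_ne _ ht, slope_def_module]
    have e : z + t • w = t • (w + t⁻¹ • z) := by
      rw [smul_add, smul_smul, mul_inv_cancel₀ ht, one_smul, add_comm]
    rw [e, S.homog hpt, smul_sub]
    simp [smul_smul, ht]
  have := hs.apply_eq_of_tendsto_cocompact t hlim
  have h2 := sub_smul_dslope (fun t : ℂ => F (z + t • w)) 0 t
  rw [this] at h2
  simp only [sub_zero, zero_smul, add_zero] at h2
  rw [h2]; abel

end Setup

namespace Setup
variable {ι : Type*} [Fintype ι] [DecidableEq ι] {ε : ι → ℝ} {F G : (ι → ℂ) → (ι → ℂ)}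

theorem pos_two (j a : ι) (hj : ε j = 1) (ha : ε a = -1) :
    0 < QN ε (Pi.single a (1:ℂ) + (2:ℂ) • Pi.single j (1:ℂ)) := by
  have hja : j ≠ a := by
    rintro rfl; rw [hj] at ha; norm_num at ha
  have : Pi.single a (1:ℂ) + (2:ℂ) • Pi.single j (1:ℂ) = Function.update (Pi.single a (1:ℂ)) j 2 := by
    ext i
    by_cases h : i = j
    · subst h; simp [hja]
    · simp [h]
  rw [this, QN_update ε _ j hj, QN_single, ha]
  simp only [Pi.single_eq_of_ne hja]
  norm_num

theorem add_single (S : Setup ι ε F G) (a : ι) (z : ι → ℂ) (t : ℂ) :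
    F (z + t • Pi.single a (1:ℂ)) = F z + t • F (Pi.single a 1) := by
  obtain ⟨j, k, i, hkj, hj, hk, hi⟩ := S.ex
  have hjD : 0 < QN ε (Pi.single j (1:ℂ)) := by rw [QN_single, hj]; norm_num
  rcases S.hε a with ha | ha
  · exact S.additive (by rw [QN_single, ha]; norm_num) z t
  · have hb := pos_two j a hj ha
    have key : ∀ (z : ι → ℂ) (t : ℂ), F (z + t • Pi.single a (1:ℂ)) = F z +
        t • F (Pi.single a (1:ℂ) + (2:ℂ) • Pi.single j (1:ℂ)) + (-2 * t) • F (Pi.single j 1) := by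
      intro z t
      have e : z + t • Pi.single a (1:ℂ) = (z + t • (Pi.single a (1:ℂ) + (2:ℂ) • Pi.single j (1:ℂ)))
          + (-2 * t) • Pi.single j (1:ℂ) := by
        module
      rw [e, S.additive hjD, S.additive hb]
    have h1 := key 0 1
    rw [zero_add, one_smul, S.map_zero'] at h1
    rw [key, h1]
    module

theorem linear (S : Setup ι ε F G) (z : ι → ℂ) :
    F z = (Matrix.of fun a b => F (Pi.single b 1) a).mulVec z := by
  have h : ∀ s : Finset ι, F (∑ b ∈ s, z b • Pi.single b (1:ℂ)) = ∑ b ∈ s, z b • F (Pi.single b 1) := by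
    intro s
    induction s using Finset.induction_on with
    | empty => simpa using S.map_zero'
    | insert a s ha ih =>
      rw [Finset.sum_insert ha, Finset.sum_insert ha, add_comm, S.add_single, ih, add_comm]
  have hz : z = ∑ b, z b • Pi.single b (1:ℂ) := by
    ext i
    simp [Finset.sum_apply, Pi.single_apply]
  conv_lhs => rw [hz]
  rw [h]
  ext i
  simp [Matrix.mulVec, dotProduct, Finset.sum_apply, mul_comm]

theorem hh_single (a b : ι) (hab : a ≠ b) : hh ε (Pi.single a (1:ℂ)) (Pi.single b 1) = 0 := by
  unfold hh
  refine Finset.sum_eq_zero fun i _ => ?_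
  by_cases h : i = a
  · subst h; simp [hab]
  · simp [h]

theorem offdiag1 (S : Setup ι ε F G) (a b : ι) (hab : a ≠ b) (ha : ε a = 1) :
    hh ε (F (Pi.single a 1)) (F (Pi.single b 1)) = 0 :=
  S.polar3 (hh_single a b hab) (by rw [QN_single, ha]; norm_num)

theorem offdiag2 (S : Setup ι ε F G) (a b : ι) (hab : a ≠ b) (ha : ε a = -1) (hb : ε b = -1) :
    hh ε (F (Pi.single a 1)) (F (Pi.single b 1)) = 0 := by
  obtain ⟨j, k, i, hkj, hj, hk, hi⟩ := S.ex
  have hjb : j ≠ b := by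
    intro h
    rw [← h, hj] at hb; norm_num at hb
  have h0 : hh ε (Pi.single a (1:ℂ) + (2:ℂ) • Pi.single j (1:ℂ)) (Pi.single b (1:ℂ)) = 0 := by
    rw [hh_add_left, hh_smul_left, hh_single a b hab, hh_single j b hjb, mul_zero, add_zero]
  have h1 := S.polar3 h0 (pos_two j a hj ha)
  rw [S.add_single, hh_add_left, hh_smul_left, S.offdiag1 j b hjb hj, mul_zero, add_zero] at h1
  exact h1

theorem offdiag (S : Setup ι ε F G) (a b : ι) (hab : a ≠ b) :
    hh ε (F (Pi.single a 1)) (F (Pi.single b 1)) = 0 := by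
  rcases S.hε a with ha | ha
  · exact S.offdiag1 a b hab ha
  · rcases S.hε b with hb | hb
    · rw [← hh_conj, S.offdiag1 b a hab.symm hb, map_zero]
    · exact S.offdiag2 a b hab ha hb

theorem diag (S : Setup ι ε F G) (a b : ι) (ha : ε a = 1) (hb : ε b = -1) :
    QN ε (F (Pi.single b 1)) = - QN ε (F (Pi.single a 1)) := by
  have hab : a ≠ b := by
    rintro rfl; rw [ha] at hb; norm_num at hb
  have h1 : QN ε (F (Pi.single a 1 + (1:ℂ) • Pi.single b 1)) = 0 := by
    apply S.null
    rw [one_smul, QN_add, QN_single, QN_single, hh_single a b hab, ha, hb]; simp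
  rw [S.add_single, one_smul, QN_add, S.offdiag a b hab] at h1
  simp at h1
  linarith

theorem exists_nu (S : Setup ι ε F G) : ∃ ν : ℝ, 0 < ν ∧ ∀ a b : ι,
    hh ε (F (Pi.single b 1)) (F (Pi.single a 1)) = ν * (if a = b then (ε a : ℂ) else 0) := by
  obtain ⟨j, k, i, hkj, hj, hk, hi⟩ := S.ex
  refine ⟨QN ε (F (Pi.single j 1)), S.FD _ (by rw [QN_single, hj]; norm_num), ?_⟩
  intro a b
  split_ifs with hab
  · subst hab
    rw [hh_self, ← Complex.ofReal_mul]
    congr 1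
    rcases S.hε a with ha | ha
    · have h1 := S.diag a i ha hi
      have h2 := S.diag j i hj hi
      rw [ha]; linarith
    · have h2 := S.diag j a hj ha
      rw [ha]; linarith
  · rw [S.offdiag b a (Ne.symm hab), mul_zero]

end Setup

theorem comp_id_of_inv {ι : Type*} [Fintype ι] {ε : ι → ℝ} {d : ι → ℂ} (hd : 0 < QN ε d)
    {F G : (ι → ℂ) → (ι → ℂ)} (hF : Ent F) (hG : Ent G)
    (h : ∀ z, 0 < QN ε z → F (G z) = z) (z : ι → ℂ) : F (G z) = z := by
  have hl := Setup.line_diff d (z - d)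
  have h1 := hF _ (hG _ hl)
  have hc : Continuous (fun t : ℂ => QN ε (d + t • (z - d))) := (continuous_QN ε).comp hl.continuous
  have hev : ∀ᶠ t in 𝓝 (0:ℂ), F (G (d + t • (z - d))) = d + t • (z - d) := by
    filter_upwards [(continuousAt_const (y := (0:ℝ))).eventually_lt (hc.continuousAt (x := 0))
      (by simpa using hd)] with t ht
    exact h _ ht
  have := entire_eq_of_eventually h1 hl hev 1
  simpa using this

end helpers

/-- For `p > 1` and `q > 0`, the automorphism group of `D^{p,q}` is
`GU(p,q)`: every biholomorphic self-map of `D^{p,q}` is the restriction of a linear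
map belonging to `GU(p,q)`. -/
theorem aut_Dpq_eq_GU (p q : ℕ) (hp : 1 < p) (hq : 0 < q)
    (f g : (Fin (p+q) → ℂ) → (Fin (p+q) → ℂ))
    (hfm : Set.MapsTo f (Dpq p q) (Dpq p q)) (hgm : Set.MapsTo g (Dpq p q) (Dpq p q))
    (hinv : Set.InvOn g f (Dpq p q) (Dpq p q))
    (hf : DifferentiableOn ℂ f (Dpq p q)) (hg : DifferentiableOn ℂ g (Dpq p q)) :
    ∃ A : Matrix (Fin (p+q)) (Fin (p+q)) ℂ, memGU p q A ∧
      ∀ z ∈ Dpq p q, f z = A.mulVec z := by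
  set ε : Fin (p+q) → ℝ := fun i => if (i : ℕ) < q then (-1 : ℝ) else 1 with hεdef
  have hD : Dpq p q = {z | 0 < QN ε z} := rfl
  rw [hD] at hfm hgm hinv hf hg
  have hε : ∀ i, ε i = 1 ∨ ε i = -1 := by
    intro i
    simp only [hεdef]
    split_ifs <;> simp
  set j : Fin (p+q) := ⟨q, by omega⟩ with hjdef
  set k : Fin (p+q) := ⟨q+1, by omega⟩ with hkdef
  set i0 : Fin (p+q) := ⟨0, by omega⟩ with hidef
  have hj : ε j = 1 := by simp [hεdef, hjdef]
  have hk : ε k = 1 := by simp [hεdef, hkdef]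
  have hi : ε i0 = -1 := by simp [hεdef, hidef, hq]
  have hkj : k ≠ j := by simp [hkdef, hjdef]
  obtain ⟨F, hF, hFf⟩ := hartogs ε hε j k hj hk hkj f hf
  obtain ⟨G, hG, hGg⟩ := hartogs ε hε j k hj hk hkj g hg
  have hdj : 0 < QN ε (Pi.single j (1:ℂ)) := by rw [QN_single, hj]; norm_num
  have hFD : ∀ z, 0 < QN ε z → 0 < QN ε (F z) := fun z hz => by
    rw [hFf z hz]; exact hfm hz
  have hGD : ∀ z, 0 < QN ε z → 0 < QN ε (G z) := fun z hz => by
    rw [hGg z hz]; exact hgm hz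
  have S : Setup (Fin (p+q)) ε F G := by
    refine ⟨hε, hF, hG, ?_, ?_, hFD, hGD, ⟨j, k, i0, hkj, hj, hk, hi⟩⟩
    · refine comp_id_of_inv hdj hF hG fun z hz => ?_
      rw [hFf _ (hGD z hz), hGg z hz]
      exact hinv.2 hz
    · refine comp_id_of_inv hdj hG hF fun z hz => ?_
      rw [hGg _ (hFD z hz), hFf z hz]
      exact hinv.1 hz
  refine ⟨Matrix.of fun a b => F (Pi.single b 1) a, ?_, ?_⟩
  · obtain ⟨ν, hν, h⟩ := S.exists_nu
    refine ⟨ν, hν, ?_⟩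
    ext a b
    have h1 := h a b
    have hcast : ∀ i : Fin (p+q), ((ε i : ℝ) : ℂ) = if (i : ℕ) < q then (-1 : ℂ) else 1 := by
      intro i
      simp only [hεdef]
      split_ifs <;> simp
    rw [Matrix.smul_apply, Jmat, Matrix.diagonal_apply, smul_eq_mul, ← hcast, ← h1,
      Matrix.mul_apply]
    unfold hh
    refine Finset.sum_congr rfl fun c _ => ?_
    rw [Matrix.mul_diagonal, Matrix.conjTranspose_apply, hcast]
    simp only [Matrix.of_apply, RCLike.star_def]
    ring
  · intro z hz
    rw [← hFf z hz]
    exact S.linear z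

end
end

section
/- Let Ω be a Reinhardt domain in ℂ^n with n = p + q and p > 1. Suppose the linear U(p)-action on the first p coordinates preserves Ω. Then for every holomorphic function f on Ω, the Laurent expansion f(z) = Σ_{ν ∈ ℤ^n} a_ν z^ν has a_ν = 0 whenever any of ν_1, …, ν_p is negative. -/
noncomputable section

open MeasureTheory Filter Topology in
lemma torus_integral {ι : Type*} [Fintype ι] (m : ι → ℤ) (hm : m ≠ 0) :
    ∫ t : ι → UnitAddCircle, ∏ k, (fourier (m k) (t k) : ℂ)
      ∂(Measure.pi fun _ : ι => (AddCircle.haarAddCircle : Measure UnitAddCircle)) = 0 := by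
  obtain ⟨i, hi⟩ := Function.ne_iff.mp hm
  rw [integral_fintype_prod_eq_prod (𝕜 := ℂ) (f := fun k (x : UnitAddCircle) => (fourier (m k) x : ℂ))]
  apply Finset.prod_eq_zero (Finset.mem_univ i)
  have h := (orthonormal_iff_ite.mp (orthonormal_fourier (T := (1:ℝ)))) 0 (m i)
  rw [if_neg (fun h => hi h.symm)] at h
  rw [ContinuousMap.inner_toLp] at h
  simpa using h

open MeasureTheory Filter Topology in
lemma coeff_bound {ι : Type*} [Fintype ι] (c : (ι → ℤ) → ℂ) (hc : Summable c)
    (F : (ι → UnitAddCircle) → ℂ)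
    (hF : ∀ t, HasSum (fun ν => c ν * ∏ k, (fourier (ν k) (t k) : ℂ)) (F t))
    (M : ℝ) (hM : ∀ t, ‖F t‖ ≤ M) (n : ι → ℤ) : ‖c n‖ ≤ M := by
  set μ := Measure.pi fun _ : ι => (AddCircle.haarAddCircle : Measure UnitAddCircle) with hμ
  have hnorm : ∀ (m : ι → ℤ) (t : ι → UnitAddCircle), ‖∏ k, (fourier (m k) (t k) : ℂ)‖ = 1 := by
    intro m t
    rw [norm_prod]
    exact Finset.prod_eq_one fun k _ => by rw [fourier_apply]; exact Circle.norm_coe _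
  let G : (ι → ℤ) → (ι → UnitAddCircle) → ℂ := fun ν t => c ν * ∏ k, (fourier (ν k - n k) (t k) : ℂ)
  have hGn : ∀ ν t, ‖G ν t‖ = ‖c ν‖ := by
    intro ν t
    have := hnorm (ν - n) t
    simp only [Pi.sub_apply] at this
    simp only [G, norm_mul, this, mul_one]
  have hGc : ∀ ν, Continuous (G ν) := by
    intro ν
    simp only [G]
    fun_prop
  have hGi : ∀ ν, Integrable (G ν) μ := fun ν =>
    Integrable.of_bound (hGc ν).aestronglyMeasurable ‖c ν‖ (Eventually.of_forall fun t => (hGn ν t).le)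
  have hs := hasSum_integral_of_summable_integral_norm (μ := μ) (F := G) hGi
    (by simpa [hGn] using hc.norm)
  have hG1 : ∀ t, ∑' ν, G ν t = F t * ∏ k, (fourier (- n k) (t k) : ℂ) := by
    intro t
    refine HasSum.tsum_eq ?_
    have heq : ∀ ν, G ν t = c ν * (∏ k, (fourier (ν k) (t k) : ℂ)) * ∏ k, (fourier (- n k) (t k) : ℂ) := by
      intro ν
      simp only [G, sub_eq_add_neg, fourier_add, Finset.prod_mul_distrib]
      ring
    simp only [heq]
    exact (hF t).mul_right _
  have hGint : ∀ ν, ν ≠ n → ∫ t, G ν t ∂μ = 0 := by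
    intro ν hν
    simp only [G]
    rw [integral_const_mul]
    have := torus_integral (ν - n) (sub_ne_zero.mpr hν)
    simp only [Pi.sub_apply] at this
    rw [this, mul_zero]
  have hGn' : ∫ t, G n t ∂μ = c n := by
    simp [G]
  have h2 := hs.unique (hasSum_single n hGint)
  rw [hGn'] at h2
  rw [← h2]
  calc _ ≤ M * μ.real Set.univ := norm_integral_le_of_norm_le_const (Eventually.of_forall fun t => by
          rw [hG1]
          have := hnorm (-n) t
          simp only [Pi.neg_apply] at this
          rw [norm_mul, this, mul_one]; exact hM t)
    _ = M := by simp

lemma householder {p : ℕ} (v : Fin p → ℂ) (hv : star v ⬝ᵥ v = 1) :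
    (1 - (2:ℂ) • Matrix.vecMulVec v (star v)) ∈ Matrix.unitaryGroup (Fin p) ℂ := by
  rw [Matrix.mem_unitaryGroup_iff]
  have h1 : star (1 - (2:ℂ) • Matrix.vecMulVec v (star v)) = 1 - (2:ℂ) • Matrix.vecMulVec v (star v) := by
    rw [star_sub, star_smul, Matrix.star_eq_conjTranspose (Matrix.vecMulVec _ _), Matrix.conjTranspose_vecMulVec]
    simp
  have h2 : Matrix.vecMulVec v (star v) * Matrix.vecMulVec v (star v) = Matrix.vecMulVec v (star v) := by
    rw [Matrix.vecMulVec_mul_vecMulVec, hv]; simp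
  rw [h1, sub_mul, mul_sub, mul_sub, one_mul, one_mul, mul_one, smul_mul_smul_comm, h2]
  module

open Filter Topology in
lemma exists_nonzero {p q : ℕ} (Ω : Set ((Fin p → ℂ) × (Fin q → ℂ))) (hopen : IsOpen Ω)
    (hne : Ω.Nonempty) : ∃ z ∈ Ω, (∀ i, z.1 i ≠ 0) ∧ (∀ j, z.2 j ≠ 0) := by
  obtain ⟨z, hz⟩ := hne
  have key : ∀ w : ℂ, ∀ᶠ e in 𝓝[≠] (0:ℂ), w + e ≠ 0 := by
    intro w
    by_cases hw : w = 0
    · filter_upwards [self_mem_nhdsWithin] with e he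
      simpa [hw] using he
    · have : Tendsto (fun e : ℂ => w + e) (𝓝[≠] 0) (𝓝 (w + 0)) :=
        ((continuous_const.add continuous_id).tendsto 0).mono_left nhdsWithin_le_nhds
      exact this.eventually_ne (by simpa using hw)
  have hc : Tendsto (fun e : ℂ => ((fun i => z.1 i + e, fun j => z.2 j + e) : (Fin p → ℂ) × (Fin q → ℂ)))
      (𝓝[≠] 0) (𝓝 z) := by
    have : Continuous (fun e : ℂ => ((fun i => z.1 i + e, fun j => z.2 j + e) : (Fin p → ℂ) × (Fin q → ℂ))) := by
      fun_prop
    have := (this.tendsto 0).mono_left (nhdsWithin_le_nhds (s := {0}ᶜ))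
    simpa using this
  obtain ⟨e, h1, h2, h3⟩ := ((hc.eventually (hopen.mem_nhds hz)).and
    ((eventually_all.mpr fun i => key (z.1 i)).and (eventually_all.mpr fun j => key (z.2 j)))).exists
  exact ⟨_, h1, h2, h3⟩

/-- the rotated point -/
def rotPt {p q : ℕ} (z : (Fin p → ℂ) × (Fin q → ℂ)) (i j : Fin p) (r θ : ℝ) :
    (Fin p → ℂ) × (Fin q → ℂ) :=
  (fun k => if k = i then ((r * Real.cos θ : ℝ) : ℂ) else if k = j then ((r * Real.sin θ : ℝ) : ℂ)
    else z.1 k, z.2)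

lemma rotPt_mem {p q : ℕ} (Ω : Set ((Fin p → ℂ) × (Fin q → ℂ)))
    (hrein : ∀ z ∈ Ω, ∀ (u : Fin p → ℂ) (v : Fin q → ℂ),
      (∀ i, ‖u i‖ = 1) → (∀ j, ‖v j‖ = 1) →
      ((fun i => u i * z.1 i, fun j => v j * z.2 j) :
        (Fin p → ℂ) × (Fin q → ℂ)) ∈ Ω)
    (hU : ∀ U : Matrix (Fin p) (Fin p) ℂ, U ∈ Matrix.unitaryGroup (Fin p) ℂ →
      ∀ z ∈ Ω, ((U.mulVec z.1, z.2) : (Fin p → ℂ) × (Fin q → ℂ)) ∈ Ω)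
    (z : (Fin p → ℂ) × (Fin q → ℂ)) (hz : z ∈ Ω) (i j : Fin p) (hij : i ≠ j) (hi : z.1 i ≠ 0) :
    ∃ r : ℝ, 0 < r ∧ ∀ θ, rotPt z i j r θ ∈ Ω := by
  have hunit : ∀ w : ℂ, ∃ u : ℂ, ‖u‖ = 1 ∧ u * w = ‖w‖ := by
    intro w
    by_cases hw : w = 0
    · exact ⟨1, by simp, by simp [hw]⟩
    · have hw' : (‖w‖ : ℂ) ≠ 0 := by exact_mod_cast norm_ne_zero_iff.mpr hw
      refine ⟨‖w‖ / w, ?_, by field_simp⟩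
      rw [norm_div, Complex.norm_real, norm_norm, div_self (norm_ne_zero_iff.mpr hw)]
  obtain ⟨u, hu, huz⟩ := hunit (z.1 i)
  obtain ⟨u', hu', huz'⟩ := hunit (z.1 j)
  set x := ‖z.1 i‖ with hx
  set y := ‖z.1 j‖ with hy
  have hxpos : 0 < x := norm_pos_iff.mpr hi
  let ζ : ℂ := ⟨x, y⟩
  have hζ : ζ ≠ 0 := fun h => hxpos.ne' (by simpa [ζ] using congrArg Complex.re h)
  set r := ‖ζ‖ with hr
  set φ := ζ.arg with hφ
  have hxr : r * Real.cos φ = x := Complex.norm_mul_cos_arg ζ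
  have hyr : r * Real.sin φ = y := Complex.norm_mul_sin_arg ζ
  refine ⟨r, norm_pos_iff.mpr hζ, fun θ => ?_⟩
  have hji : j ≠ i := hij.symm
  -- step 1: make the two coordinates equal to minus their absolute values
  have h1 := hrein z hz (fun k => if k = i then -u else if k = j then -u' else 1) (fun _ => 1)
    (by intro k; split_ifs <;> simp [hu, hu']) (by simp)
  set α := (θ + φ) / 2 with hα
  set v : Fin p → ℂ := fun k => if k = i then ((Real.cos α : ℝ) : ℂ) else
    if k = j then ((Real.sin α : ℝ) : ℂ) else 0 with hv
  have hsum : ∀ g : Fin p → ℂ, star v ⬝ᵥ g = Real.cos α * g i + Real.sin α * g j := by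
    intro g
    rw [dotProduct, ← Finset.sum_subset (Finset.subset_univ {i, j})]
    · rw [Finset.sum_pair hij]
      simp only [hv, Pi.star_apply, if_true, if_neg hji, RCLike.star_def, Complex.conj_ofReal]
    · intro k _ hk
      simp only [Finset.mem_insert, Finset.mem_singleton, not_or] at hk
      simp [hv, hk.1, hk.2]
  have hvv : star v ⬝ᵥ v = 1 := by
    rw [hsum]
    simp only [hv, if_true, if_neg hji]
    have := Real.cos_sq_add_sin_sq α
    rw [sq, sq] at this
    exact_mod_cast this
  have h2 := hU _ (householder v hvv) _ h1
  have hdot : Real.cos α * x + Real.sin α * y = r * Real.cos (α - φ) := by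
    rw [← hxr, ← hyr, Real.cos_sub]; ring
  have e1 : θ = α + (α - φ) := by rw [hα]; ring
  have e2 : φ = α - (α - φ) := by ring
  have c1 : -x + 2 * (r * Real.cos (α - φ)) * Real.cos α = r * Real.cos θ := by
    have h3 : Real.cos φ = Real.cos (α - (α - φ)) := by rw [← e2]
    rw [← hxr, e1, h3, Real.cos_add, Real.cos_sub α (α - φ)]; ring
  have c2 : -y + 2 * (r * Real.cos (α - φ)) * Real.sin α = r * Real.sin θ := by
    have h3 : Real.sin φ = Real.sin (α - (α - φ)) := by rw [← e2]
    rw [← hyr, e1, h3, Real.sin_add, Real.sin_sub α (α - φ)]; ring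
  convert h2 using 1
  unfold rotPt
  ext k
  · simp only [Matrix.sub_mulVec, Matrix.smul_mulVec, Matrix.vecMulVec_mulVec, Matrix.one_mulVec,
      hsum, Pi.sub_apply, Pi.smul_apply, if_true, if_neg hji, neg_mul, huz, huz']
    have hd : ((Real.cos α : ℝ) : ℂ) * -(x : ℂ) + (Real.sin α : ℝ) * -(y : ℂ)
        = -((r * Real.cos (α - φ) : ℝ) : ℂ) := by
      rw [← hdot]; push_cast; ring
    rw [hd]
    by_cases hki : k = i
    · subst hki
      simp only [if_true, hv, ← c1, neg_mul, huz]
      push_cast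
      simp only [MulOpposite.op_neg, smul_eq_mul, MulOpposite.smul_eq_mul_unop,
        MulOpposite.unop_neg, MulOpposite.unop_op]
      ring
    · by_cases hkj : k = j
      · subst hkj
        simp only [if_true, if_neg hki, hv, ← c2, neg_mul, huz']
        push_cast
        simp only [MulOpposite.op_neg, smul_eq_mul, MulOpposite.smul_eq_mul_unop,
          MulOpposite.unop_neg, MulOpposite.unop_op]
        ring
      · simp [hki, hkj, hv]
  · simp

lemma laurent_bound {p q : ℕ} (a : ((Fin p → ℤ) × (Fin q → ℤ)) → ℂ)
    (f : ((Fin p → ℂ) × (Fin q → ℂ)) → ℂ) (x : Fin p → ℂ) (y : Fin q → ℂ) (M : ℝ)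
    (hs : ∀ (u : Fin p → ℂ) (v : Fin q → ℂ), (∀ i, ‖u i‖ = 1) → (∀ j, ‖v j‖ = 1) →
      HasSum (fun ν : (Fin p → ℤ) × (Fin q → ℤ) =>
        a ν * (∏ i : Fin p, (u i * x i) ^ ν.1 i) * (∏ j : Fin q, (v j * y j) ^ ν.2 j))
        (f (fun i => u i * x i, fun j => v j * y j)))
    (hM : ∀ (u : Fin p → ℂ) (v : Fin q → ℂ), (∀ i, ‖u i‖ = 1) → (∀ j, ‖v j‖ = 1) →
      ‖f (fun i => u i * x i, fun j => v j * y j)‖ ≤ M)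
    (ν : (Fin p → ℤ) × (Fin q → ℤ)) :
    ‖a ν * (∏ k, x k ^ ν.1 k) * (∏ k, y k ^ ν.2 k)‖ ≤ M := by
  let e := Equiv.sumArrowEquivProdArrow (Fin p) (Fin q) ℤ
  have hz : ∀ (n : ℤ) (x : UnitAddCircle), (fourier n x : ℂ) = ((AddCircle.toCircle x : Circle) : ℂ) ^ n := by
    intro n x
    rw [fourier_apply, AddCircle.toCircle_zsmul, Circle.coe_zpow]
  let c : (Fin p ⊕ Fin q → ℤ) → ℂ :=
    fun m => a (e m) * (∏ k, x k ^ (e m).1 k) * (∏ k, y k ^ (e m).2 k)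
  have hc : Summable c := by
    have h := hs (fun _ => 1) (fun _ => 1) (by simp) (by simp)
    simp only [one_mul] at h
    have h' := h.summable.comp_injective e.injective
    exact h'
  have h := coeff_bound c hc
    (fun t => f (fun k => ((AddCircle.toCircle (t (Sum.inl k)) : Circle) : ℂ) * x k,
      fun k => ((AddCircle.toCircle (t (Sum.inr k)) : Circle) : ℂ) * y k))
    (fun t => by
      have h := e.hasSum_iff.mpr (hs (fun k => ((AddCircle.toCircle (t (Sum.inl k)) : Circle) : ℂ))
        (fun k => ((AddCircle.toCircle (t (Sum.inr k)) : Circle) : ℂ))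
        (fun _ => Circle.norm_coe _) (fun _ => Circle.norm_coe _))
      convert h using 1
      funext m
      simp only [Function.comp, mul_zpow, Finset.prod_mul_distrib, Fintype.prod_sum_type, hz, c]
      have h1 : ∀ k, (e m).1 k = m (Sum.inl k) := fun _ => rfl
      have h2 : ∀ k, (e m).2 k = m (Sum.inr k) := fun _ => rfl
      simp only [h1, h2]
      ring)
    M (fun t => hM _ _ (fun _ => Circle.norm_coe _) (fun _ => Circle.norm_coe _)) (e.symm ν)
  simpa only [c, Equiv.apply_symm_apply] using h

/-- Let `Ω` be a Reinhardt domain in `ℂ^n = ℂ^p × ℂ^q` with `p > 1`,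
preserved by the linear `U(p)`-action on the first `p` coordinates. Then every
holomorphic function `f` on `Ω` has Laurent expansion `f(z) = Σ_ν a_ν z^ν` with
`a_ν = 0` whenever some of the first `p` exponents `ν_1, …, ν_p` is negative. -/
theorem reinhardt_laurent_no_negative_powers (p q : ℕ) (hp : 1 < p)
    (Ω : Set ((Fin p → ℂ) × (Fin q → ℂ))) (hopen : IsOpen Ω) (hconn : IsConnected Ω)
    (hrein : ∀ z ∈ Ω, ∀ (u : Fin p → ℂ) (v : Fin q → ℂ),
      (∀ i, ‖u i‖ = 1) → (∀ j, ‖v j‖ = 1) →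
      ((fun i => u i * z.1 i, fun j => v j * z.2 j) :
        (Fin p → ℂ) × (Fin q → ℂ)) ∈ Ω)
    (hU : ∀ U : Matrix (Fin p) (Fin p) ℂ, U ∈ Matrix.unitaryGroup (Fin p) ℂ →
      ∀ z ∈ Ω, ((U.mulVec z.1, z.2) : (Fin p → ℂ) × (Fin q → ℂ)) ∈ Ω)
    (f : ((Fin p → ℂ) × (Fin q → ℂ)) → ℂ) (hf : DifferentiableOn ℂ f Ω)
    (a : ((Fin p → ℤ) × (Fin q → ℤ)) → ℂ)
    (hlaurent : ∀ z ∈ Ω, HasSum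
      (fun ν : (Fin p → ℤ) × (Fin q → ℤ) =>
        a ν * (∏ i : Fin p, z.1 i ^ ν.1 i) * (∏ j : Fin q, z.2 j ^ ν.2 j)) (f z)) :
    ∀ ν : (Fin p → ℤ) × (Fin q → ℤ), (∃ i : Fin p, ν.1 i < 0) → a ν = 0 := by
  classical
  rintro ν ⟨i, hνi⟩
  obtain ⟨j, hji⟩ : ∃ j : Fin p, j ≠ i := by
    have : Nontrivial (Fin p) := Fin.nontrivial_iff_two_le.mpr hp
    exact exists_ne i
  obtain ⟨z, hz, hz1, hz2⟩ := exists_nonzero Ω hopen hconn.nonempty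
  obtain ⟨r, hr, hrot⟩ := rotPt_mem Ω hrein hU z hz i j hji.symm (hz1 i)
  -- the compact set
  let S : Set ((Fin p → ℂ) × (Fin q → ℂ) × ℝ) :=
    (Set.univ.pi fun _ => Metric.sphere 0 1) ×ˢ ((Set.univ.pi fun _ => Metric.sphere 0 1) ×ˢ
      Set.Icc 0 (Real.pi / 2))
  have hS : IsCompact S :=
    (isCompact_univ_pi fun _ => isCompact_sphere _ _).prod
      ((isCompact_univ_pi fun _ => isCompact_sphere _ _).prod isCompact_Icc)
  let Φ : (Fin p → ℂ) × (Fin q → ℂ) × ℝ → (Fin p → ℂ) × (Fin q → ℂ) := fun s =>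
    (fun k => s.1 k * (rotPt z i j r s.2.2).1 k, fun k => s.2.1 k * (rotPt z i j r s.2.2).2 k)
  have hΦ : Continuous Φ := by
    refine Continuous.prodMk (continuous_pi fun k => ?_) (continuous_pi fun k => ?_)
    · simp only [rotPt]
      split_ifs <;> fun_prop
    · simp only [rotPt]
      fun_prop
  have hmaps : Set.MapsTo Φ S Ω := by
    rintro ⟨u, v, θ⟩ ⟨hu, hv, -⟩
    exact hrein _ (hrot θ) u v (fun k => by simpa using hu k trivial) (fun k => by simpa using hv k trivial)
  obtain ⟨M, hM⟩ := hS.exists_bound_of_continuousOn (hf.continuousOn.comp hΦ.continuousOn hmaps)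
  -- Cauchy estimates
  have hbound : ∀ θ ∈ Set.Icc 0 (Real.pi / 2),
      ‖a ν * (∏ k, (rotPt z i j r θ).1 k ^ ν.1 k) * (∏ k, (rotPt z i j r θ).2 k ^ ν.2 k)‖ ≤ M := by
    intro θ hθ
    refine laurent_bound a f _ _ M (fun u v hu hv => ?_) (fun u v hu hv => ?_) ν
    · have h := hlaurent _ (hrein _ (hrot θ) u v hu hv)
      exact h
    · have h := hM (u, v, θ) ⟨fun k _ => by simpa using hu k, fun k _ => by simpa using hv k, hθ⟩
      exact h
  -- isolate the two coordinates
  set C : ℝ := (∏ k ∈ (Finset.univ.erase i).erase j, ‖z.1 k‖ ^ ν.1 k) * ∏ k, ‖z.2 k‖ ^ ν.2 k with hC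
  have hCpos : 0 < C := by
    refine mul_pos (Finset.prod_pos fun k _ => zpow_pos (norm_pos_iff.mpr (hz1 k)) _)
      (Finset.prod_pos fun k _ => zpow_pos (norm_pos_iff.mpr (hz2 k)) _)
  have hineq : ∀ θ ∈ Set.Ioo 0 (Real.pi / 2),
      ‖a ν‖ * C ≤ M * (r * Real.cos θ) ^ (-ν.1 i) * (r * Real.sin θ) ^ (-ν.1 j) := by
    intro θ hθ
    have hcos : 0 < r * Real.cos θ :=
      mul_pos hr (Real.cos_pos_of_mem_Ioo ⟨by linarith [hθ.1, Real.pi_pos], hθ.2⟩)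
    have hsin : 0 < r * Real.sin θ :=
      mul_pos hr (Real.sin_pos_of_pos_of_lt_pi hθ.1 (by linarith [hθ.2, Real.pi_pos]))
    have h := hbound θ ⟨hθ.1.le, hθ.2.le⟩
    rw [norm_mul, norm_mul, norm_prod, norm_prod,
      ← Finset.mul_prod_erase _ _ (Finset.mem_univ i),
      ← Finset.mul_prod_erase _ _ (Finset.mem_erase.mpr ⟨hji, Finset.mem_univ j⟩)] at h
    have hrest : ∏ k ∈ (Finset.univ.erase i).erase j, ‖(rotPt z i j r θ).1 k ^ ν.1 k‖
        = ∏ k ∈ (Finset.univ.erase i).erase j, ‖z.1 k‖ ^ ν.1 k := by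
      refine Finset.prod_congr rfl fun k hk => ?_
      simp only [Finset.mem_erase] at hk
      simp [rotPt, hk.1, hk.2.1]
    have hi' : ‖(rotPt z i j r θ).1 i ^ ν.1 i‖ = (r * Real.cos θ) ^ ν.1 i := by
      simp only [rotPt, if_true, norm_zpow, Complex.norm_real, Real.norm_of_nonneg hcos.le]
    have hj' : ‖(rotPt z i j r θ).1 j ^ ν.1 j‖ = (r * Real.sin θ) ^ ν.1 j := by
      simp only [rotPt, if_true, if_neg hji, norm_zpow, Complex.norm_real, Real.norm_of_nonneg hsin.le]
    have h2' : ∏ k, ‖(rotPt z i j r θ).2 k ^ ν.2 k‖ = ∏ k, ‖z.2 k‖ ^ ν.2 k := by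
      simp [rotPt]
    rw [hrest, hi', hj', h2'] at h
    have hA := zpow_pos hcos (ν.1 i)
    have hB := zpow_pos hsin (ν.1 j)
    rw [zpow_neg, zpow_neg, ← div_eq_mul_inv, ← div_eq_mul_inv, div_div, le_div_iff₀ (mul_pos hA hB)]
    calc _ = _ := by rw [hC]; ring
      _ ≤ M := h
  have hlim : Filter.Tendsto
      (fun θ => M * (r * Real.cos θ) ^ (-ν.1 i) * (r * Real.sin θ) ^ (-ν.1 j))
      (nhdsWithin (Real.pi / 2) (Set.Iio (Real.pi / 2))) (nhds 0) := by
    have hc : ContinuousAt (fun θ => M * (r * Real.cos θ) ^ (-ν.1 i) * (r * Real.sin θ) ^ (-ν.1 j))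
        (Real.pi / 2) := by
      refine ContinuousAt.mul (continuousAt_const.mul ?_) ?_
      · exact ContinuousAt.zpow₀ (by fun_prop) _ (Or.inr (by omega))
      · exact ContinuousAt.zpow₀ (by fun_prop) _ (Or.inl (by simp [hr.ne']))
    have := hc.tendsto
    simp only [Real.cos_pi_div_two, mul_zero] at this
    rw [zero_zpow _ (by omega), mul_zero, zero_mul] at this
    exact this.mono_left nhdsWithin_le_nhds
  have hle : ‖a ν‖ * C ≤ 0 := by
    refine ge_of_tendsto hlim ?_
    filter_upwards [Ioo_mem_nhdsLT (show (0:ℝ) < Real.pi / 2 by positivity)] with θ hθ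
    exact hineq θ hθ
  have : ‖a ν‖ ≤ 0 := by
    by_contra hcon
    push Not at hcon
    linarith [mul_pos hcon hCpos]
  exact norm_le_zero_iff.mp this

end
end
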